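/- arXiv:1901.08491 — 2 statements merged into one kernel-verified Lean document; each statement's English description precedes it below -/
import Mathlib

section
/- Theorem 3.1(ii), finite-dimensional part (via Cramér–Wold): Under assumptions (G) and (U) and under the null hypothesis H0, for every K ∈ ℕ, all s_1,…,s_K ∈ [0,1], z_1,…,z_K ∈ ℝ^d and λ_1,…,λ_K ∈ ℝ, the random variable Σ_{j=1}^K λ_j T_n(s_j, z_j) converges in distribution as n → ∞ to the centered normal distribution N(0, v) with variance v = Σ_{j=1}^K Σ_{k=1}^K λ_j λ_k (s_j ∧ s_k) Σ(z_j ∧ z_k), where Σ(x) = ∫_{(−∞,x]} σ²(u) f(u) du (interpreting N(0,0) as the Dirac measure at 0). -/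
open MeasureTheory ProbabilityTheory Filter Set Topology Asymptotics
open scoped ENNReal

noncomputable section

namespace ChangePointDetection

variable {Ω : Type*} [MeasurableSpace Ω] {d : ℕ}

/-- Real-valued indicator of the lower-left orthant `{x : x ≤ z}`. -/
def orth (z x : Fin d → ℝ) : ℝ :=
  {p : Fin d → ℝ | p ≤ z}.indicator (fun _ => (1 : ℝ)) x

/-- Real-valued indicator of the cube `J_n = [-c_n, c_n]^d`. -/
def cube (c : ℝ) (x : Fin d → ℝ) : ℝ :=
  (Icc (fun _ : Fin d => -c) fun _ : Fin d => c).indicator (fun _ => (1 : ℝ)) x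

/-- The σ-algebra generated by `(Y_s, X_s)`, `s ≤ k`. -/
def sigPast (Y : ℤ → Ω → ℝ) (X : ℤ → Ω → Fin d → ℝ) (k : ℤ) : MeasurableSpace Ω :=
  ⨆ (s : ℤ) (_ : s ≤ k),
    MeasurableSpace.comap (Y s) inferInstance ⊔ MeasurableSpace.comap (X s) inferInstance

/-- The σ-algebra generated by `(Y_s, X_s)`, `s ≥ k`. -/
def sigFuture (Y : ℤ → Ω → ℝ) (X : ℤ → Ω → Fin d → ℝ) (k : ℤ) : MeasurableSpace Ω :=
  ⨆ (s : ℤ) (_ : k ≤ s),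
    MeasurableSpace.comap (Y s) inferInstance ⊔ MeasurableSpace.comap (X s) inferInstance

/-- The strong (α-) mixing coefficient of the process `(Y_t, X_t)_{t ∈ ℤ}`:
`α(t) = sup_k sup {|P(A∩B) - P(A)P(B)| : A ∈ σ((Y_s,X_s) : s ≤ k),
B ∈ σ((Y_s,X_s) : s ≥ k+t)}`. -/
def alphaMix (P : Measure Ω) (Y : ℤ → Ω → ℝ) (X : ℤ → Ω → Fin d → ℝ) (t : ℕ) : ℝ :=
  sSup {r : ℝ | ∃ (k : ℤ) (A B : Set Ω),
    MeasurableSet[sigPast Y X k] A ∧ MeasurableSet[sigFuture Y X (k + t)] B ∧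
    r = |(P (A ∩ B)).toReal - (P A).toReal * (P B).toReal|}

/-- The filtration `F^t = σ(U_{j-1}, X_j : j ≤ t)`, where `U_t = Y_t - m(X_t)`. -/
def sigF (Y : ℤ → Ω → ℝ) (X : ℤ → Ω → Fin d → ℝ) (m : (Fin d → ℝ) → ℝ) (t : ℤ) :
    MeasurableSpace Ω :=
  ⨆ (j : ℤ) (_ : j ≤ t),
    MeasurableSpace.comap (fun ω => Y (j - 1) ω - m (X (j - 1) ω)) inferInstance ⊔
      MeasurableSpace.comap (X j) inferInstance

/-- First-order partial derivative in coordinate direction `i`. -/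
def pd (i : Fin d) (g : (Fin d → ℝ) → ℝ) : (Fin d → ℝ) → ℝ :=
  fun x => fderiv ℝ g x (Pi.single i 1)

/-- The multi-index partial derivative `D^k = ∂^{|k|} / ∂x_1^{k_1} ⋯ ∂x_d^{k_d}`. -/
def mderiv (k : Fin d → ℕ) (g : (Fin d → ℝ) → ℝ) : (Fin d → ℝ) → ℝ :=
  (Finset.univ : Finset (Fin d)).toList.foldr (fun i acc => (pd i)^[k i] acc) g

/-- `c̄ = max{σ², c², …, c^Q}`. -/
def cbar (σ2 c : (Fin d → ℝ) → ℝ) (Q : ℕ) (u : Fin d → ℝ) : ℝ :=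
  (insert (σ2 u) ((Finset.Icc 2 Q).image fun i => c u ^ i)).max'
    (Finset.insert_nonempty _ _)

/-- The Nadaraya–Watson estimator `m̂_n` built from `(Y_1,X_1),…,(Y_n,X_n)`. -/
def NW (K : (Fin d → ℝ) → ℝ) (h : ℝ) (Y : ℤ → Ω → ℝ) (X : ℤ → Ω → Fin d → ℝ)
    (n : ℕ) (x : Fin d → ℝ) (ω : Ω) : ℝ :=
  (∑ j ∈ Finset.Icc (1 : ℤ) (n : ℤ), K (h⁻¹ • (x - X j ω)) * Y j ω) /
    ∑ j ∈ Finset.Icc (1 : ℤ) (n : ℤ), K (h⁻¹ • (x - X j ω))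

/-- The kernel density estimator `f̂_n`. -/
def KDE (K : (Fin d → ℝ) → ℝ) (h : ℝ) (X : ℤ → Ω → Fin d → ℝ)
    (n : ℕ) (x : Fin d → ℝ) (ω : Ω) : ℝ :=
  ((n : ℝ) * h ^ d)⁻¹ * ∑ j ∈ Finset.Icc (1 : ℤ) (n : ℤ), K (h⁻¹ • (x - X j ω))

/-- The rescaled kernel `K_h(u) = h^{-d} K(u/h)`. -/
def Kh (K : (Fin d → ℝ) → ℝ) (h : ℝ) (u : Fin d → ℝ) : ℝ := (h ^ d)⁻¹ * K (h⁻¹ • u)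

/-- The sequential marked empirical process of residuals `T̂_n(s,z)`. -/
def That (K : (Fin d → ℝ) → ℝ) (h cn : ℕ → ℝ) (Y : ℤ → Ω → ℝ)
    (X : ℤ → Ω → Fin d → ℝ) (n : ℕ) (s : ℝ) (z : Fin d → ℝ) (ω : Ω) : ℝ :=
  (Real.sqrt n)⁻¹ * ∑ i ∈ Finset.Icc (1 : ℤ) ⌊(n : ℝ) * s⌋,
    (Y i ω - NW K (h n) Y X n (X i ω) ω) * cube (cn n) (X i ω) * orth z (X i ω)

/-- The process `T_n(s,z) = n^{-1/2} Σ_{i=1}^{⌊ns⌋} U_i 1{X_i ≤ z}`,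
with `U_i = Y_i - m(X_i)`. -/
def Tn (Y : ℤ → Ω → ℝ) (X : ℤ → Ω → Fin d → ℝ) (m : (Fin d → ℝ) → ℝ)
    (n : ℕ) (s : ℝ) (z : Fin d → ℝ) (ω : Ω) : ℝ :=
  (Real.sqrt n)⁻¹ * ∑ i ∈ Finset.Icc (1 : ℤ) ⌊(n : ℝ) * s⌋,
    (Y i ω - m (X i ω)) * orth z (X i ω)

/-- The point `exp(iu)` of the unit circle. -/
def phase (u : ℝ) : ℂ := Complex.exp (u * Complex.I)

lemma norm_phase (u : ℝ) : ‖phase u‖ = 1 := Complex.norm_exp_ofReal_mul_I u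

lemma phase_add (u v : ℝ) : phase (u + v) = phase u * phase v := by
  simp [phase, add_mul, Complex.exp_add]

lemma continuous_phase : Continuous phase := by
  unfold phase; fun_prop

lemma norm_phase_sub_phase_le (u v : ℝ) : ‖phase u - phase v‖ ≤ |u - v| := by
  have h : phase u - phase v = phase v * (phase (u - v) - 1) := by
    rw [mul_sub, ← phase_add]; simp
  rw [h, norm_mul, norm_phase, one_mul, phase, mul_comm]
  exact Real.norm_exp_I_mul_ofReal_sub_one_le

lemma norm_phase_sub_taylor_le (u : ℝ) :
    ‖phase u - (1 + u * Complex.I - u ^ 2 / 2)‖ ≤ 4 * |u| ^ 3 := by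
  rcases le_or_gt |u| 1 with h | h
  · have hx : ‖(u * Complex.I : ℂ)‖ ≤ 1 := by simpa using h
    have := Complex.exp_bound hx (n := 3) (by norm_num)
    simp only [Finset.sum_range_succ, Finset.sum_range_zero] at this
    have e : (0 + (u * Complex.I : ℂ) ^ 0 / (Nat.factorial 0 : ℂ)
        + (u * Complex.I) ^ 1 / (Nat.factorial 1 : ℂ)
        + (u * Complex.I) ^ 2 / (Nat.factorial 2 : ℂ)) = 1 + u * Complex.I - u ^ 2 / 2 := by
      simp [mul_pow, Nat.factorial]; ring
    rw [e] at this
    refine this.trans ?_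
    have : ‖(u * Complex.I : ℂ)‖ = |u| := by simp
    rw [this, mul_comm]
    refine mul_le_mul_of_nonneg_right ?_ (by positivity)
    norm_num [Nat.factorial]
  · have h1 : ‖phase u - (1 + u * Complex.I - u ^ 2 / 2)‖ ≤ 1 + (1 + |u| + |u| ^ 2 / 2) := by
      refine (norm_sub_le _ _).trans (add_le_add (norm_phase u).le ?_)
      refine (norm_sub_le _ _).trans (add_le_add ((norm_add_le _ _).trans ?_) ?_)
      · simp
      · simp
    nlinarith [sq_nonneg (|u| - 1), mul_pos (sub_pos.2 h) (sub_pos.2 h),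
      mul_pos (mul_pos (sub_pos.2 h) (sub_pos.2 h)) (sub_pos.2 h)]

lemma abs_exp_neg_sub_le {x : ℝ} (hx : 0 ≤ x) : |Real.exp (-x) - 1 + x| ≤ x ^ 2 := by
  rcases le_or_gt x 1 with h | h
  · have := Real.norm_exp_sub_one_sub_id_le (x := -x) (by simpa [abs_of_nonneg hx] using h)
    simpa [Real.norm_eq_abs] using this
  · rw [abs_le]
    have h1 := Real.add_one_le_exp (-x)
    have h2 : Real.exp (-x) ≤ 1 := Real.exp_le_one_iff.2 (by linarith)
    constructor <;> nlinarith

section Array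

variable {Ω' : Type*} {mΩ' : MeasurableSpace Ω'}

lemma integrable_of_abs_pow_three {μ : Measure Ω'} [IsFiniteMeasure μ] {W : Ω' → ℝ}
    (hW : Measurable W) (h3 : Integrable (fun ω => |W ω| ^ 3) μ) : Integrable W μ := by
  refine Integrable.mono' ((integrable_const 1).add h3) hW.aestronglyMeasurable
    (ae_of_all _ fun ω => ?_)
  simp only [Pi.add_apply, Real.norm_eq_abs]
  have := abs_nonneg (W ω)
  nlinarith [mul_nonneg this (sq_nonneg (|W ω| - 1)), sq_nonneg (|W ω| - 1)]

lemma integrable_sq_of_abs_pow_three {μ : Measure Ω'} [IsFiniteMeasure μ] {W : Ω' → ℝ}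
    (hW : Measurable W) (h3 : Integrable (fun ω => |W ω| ^ 3) μ) :
    Integrable (fun ω => W ω ^ 2) μ := by
  refine Integrable.mono' ((integrable_const 1).add h3) (hW.pow_const 2).aestronglyMeasurable
    (ae_of_all _ fun ω => ?_)
  simp only [Pi.add_apply, Real.norm_eq_abs, abs_pow]
  have := abs_nonneg (W ω)
  nlinarith [mul_nonneg this (sq_nonneg (|W ω| - 1)), sq_nonneg (|W ω| - 1)]

lemma norm_integral_increment_le {μ : Measure Ω'} [IsProbabilityMeasure μ] {W : Ω' → ℝ}
    (hW : Measurable W) (h3 : Integrable (fun ω => |W ω| ^ 3) μ) {E : Ω' → ℂ}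
    (hE : Measurable E) (hE1 : ∀ ω, ‖E ω‖ ≤ 1) {c : ℝ} (hc : 0 ≤ c) (t : ℝ)
    (h0 : ∫ ω, W ω • E ω ∂μ = 0) :
    ‖∫ ω, E ω * (phase (t * W ω) - Real.exp (-(t ^ 2 * c / 2))) ∂μ‖ ≤
      4 * |t| ^ 3 * ∫ ω, |W ω| ^ 3 ∂μ + (t ^ 2 * c / 2) ^ 2 +
        t ^ 2 / 2 * ‖∫ ω, (W ω ^ 2 - c) • E ω ∂μ‖ := by
  set x := t ^ 2 * c / 2 with hx
  have hx0 : 0 ≤ x := by positivity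
  have hEb : ∀ᵐ ω ∂μ, ‖E ω‖ ≤ 1 := ae_of_all _ hE1
  have i1 : Integrable (fun ω => W ω • E ω) μ :=
    (integrable_of_abs_pow_three hW h3).smul_bdd 1 hE.aestronglyMeasurable hEb
  have i2 : Integrable (fun ω => (W ω ^ 2 - c) • E ω) μ :=
    ((integrable_sq_of_abs_pow_three hW h3).sub (integrable_const c)).smul_bdd 1
      hE.aestronglyMeasurable hEb
  have i3 : Integrable (fun ω => E ω * (phase (t * W ω) - Real.exp (-x))) μ := by
    refine Integrable.of_bound (C := 1 + |Real.exp (-x)|) ?_ (ae_of_all _ fun ω => ?_)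
    · exact (hE.mul ((continuous_phase.measurable.comp
        (hW.const_mul t)).sub_const _)).aestronglyMeasurable
    · rw [norm_mul]
      calc _ ≤ 1 * ‖phase (t * W ω) - Real.exp (-x)‖ :=
            mul_le_mul_of_nonneg_right (hE1 ω) (norm_nonneg _)
        _ ≤ _ := by
            rw [one_mul]
            refine (norm_sub_le _ _).trans ?_
            rw [norm_phase, Complex.norm_real, Real.norm_eq_abs]
  have key : ∫ ω, E ω * (phase (t * W ω) - Real.exp (-x)) ∂μ =
      ∫ ω, (E ω * (phase (t * W ω) - Real.exp (-x)) - (t * Complex.I) * (W ω • E ω)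
        + (t ^ 2 / 2 : ℂ) * ((W ω ^ 2 - c) • E ω)) ∂μ
      - (t ^ 2 / 2 : ℂ) * ∫ ω, (W ω ^ 2 - c) • E ω ∂μ := by
    have i4 : Integrable (fun ω => E ω * (phase (t * W ω) - Real.exp (-x))
        - (t * Complex.I) * (W ω • E ω)) μ := i3.sub (i1.const_mul _)
    rw [integral_add i4 (i2.const_mul _), integral_sub i3 (i1.const_mul _),
      integral_const_mul, integral_const_mul, h0]
    ring
  rw [key]
  refine (norm_sub_le _ _).trans (add_le_add ?_ ?_)
  · calc _ ≤ ∫ ω, (4 * |t| ^ 3 * |W ω| ^ 3 + x ^ 2) ∂μ := by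
          refine norm_integral_le_of_norm_le ((h3.const_mul _).add (integrable_const _))
            (ae_of_all _ fun ω => ?_)
          have e : E ω * (phase (t * W ω) - Real.exp (-x)) - (t * Complex.I) * (W ω • E ω)
              + (t ^ 2 / 2 : ℂ) * ((W ω ^ 2 - c) • E ω) =
              E ω * ((phase (t * W ω) - (1 + (t * W ω : ℝ) * Complex.I - (t * W ω : ℝ) ^ 2 / 2))
                - (Real.exp (-x) - 1 + x : ℝ)) := by
            simp only [Complex.real_smul, hx]
            push_cast
            ring
          rw [e, norm_mul]
          calc _ ≤ 1 * _ := mul_le_mul_of_nonneg_right (hE1 ω) (norm_nonneg _)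
            _ ≤ 4 * |t * W ω| ^ 3 + x ^ 2 := by
              rw [one_mul]
              refine (norm_sub_le _ _).trans (add_le_add (norm_phase_sub_taylor_le _) ?_)
              rw [Complex.norm_real]
              exact abs_exp_neg_sub_le hx0
            _ = _ := by rw [abs_mul]; ring
      _ = _ := by
          rw [integral_add (h3.const_mul _) (integrable_const _), integral_const_mul]
          simp
  · rw [norm_mul]
    refine mul_le_mul_of_nonneg_right (le_of_eq ?_) (norm_nonneg _)
    have : (t ^ 2 / 2 : ℂ) = ((t ^ 2 / 2 : ℝ) : ℂ) := by push_cast; ring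
    rw [this, Complex.norm_real, Real.norm_eq_abs, abs_of_nonneg (by positivity)]

lemma norm_integral_phase_lag_le {μ : Measure Ω'} [IsProbabilityMeasure μ] {ι : Type*}
    {V : ι → Ω' → ℝ} (hV : ∀ l, Measurable (V l))
    (hV3 : ∀ l, Integrable (fun ω => |V l ω| ^ 3) μ) {k : ι} (I : Finset ι)
    {S S' : Ω' → ℝ} (hS : Measurable S) (hS' : Measurable S')
    (hSS : ∀ ω, S ω = S' ω + ∑ l ∈ I, V l ω) {c : ℝ} (hc : 0 ≤ c) (t : ℝ) :
    ‖∫ ω, (V k ω ^ 2 - c) • phase (t * S ω) ∂μ‖ ≤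
      ‖∫ ω, (V k ω ^ 2 - c) • phase (t * S' ω) ∂μ‖ +
        |t| * ∑ l ∈ I, (∫ ω, |V l ω| ^ 3 ∂μ + ∫ ω, |V k ω| ^ 3 ∂μ + c * ∫ ω, |V l ω| ∂μ) := by
  have i0 := (integrable_sq_of_abs_pow_three (hV k) (hV3 k)).sub (integrable_const (μ := μ) c)
  have i1 {S : Ω' → ℝ} (hS : Measurable S) :
      Integrable (fun ω => (V k ω ^ 2 - c) • phase (t * S ω)) μ :=
    i0.smul_bdd 1
      (continuous_phase.measurable.comp (hS.const_mul t)).aestronglyMeasurable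
      (ae_of_all _ fun ω => (norm_phase _).le)
  have iV (l : ι) := (integrable_of_abs_pow_three (hV l) (hV3 l)).abs
  have i3 (l : ι) : Integrable (fun ω => |V l ω| ^ 3 + |V k ω| ^ 3) μ := (hV3 l).add (hV3 k)
  have i2 (l : ι) : Integrable (fun ω => |V l ω| ^ 3 + |V k ω| ^ 3 + c * |V l ω|) μ :=
    (i3 l).add ((iV l).const_mul c)
  have key : ‖∫ ω, ((V k ω ^ 2 - c) • phase (t * S ω)
      - (V k ω ^ 2 - c) • phase (t * S' ω)) ∂μ‖ ≤
      |t| * ∑ l ∈ I, (∫ ω, |V l ω| ^ 3 ∂μ + ∫ ω, |V k ω| ^ 3 ∂μ + c * ∫ ω, |V l ω| ∂μ) := by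
    calc _ ≤ ∫ ω, |t| * ∑ l ∈ I, (|V l ω| ^ 3 + |V k ω| ^ 3 + c * |V l ω|) ∂μ := by
          refine norm_integral_le_of_norm_le
            ((integrable_finsetSum _ fun l _ => i2 l).const_mul _) (ae_of_all _ fun ω => ?_)
          rw [← smul_sub, norm_smul]
          have h1 : ‖phase (t * S ω) - phase (t * S' ω)‖ ≤ |t| * ∑ l ∈ I, |V l ω| := by
            refine (norm_phase_sub_phase_le _ _).trans ?_
            rw [← mul_sub, abs_mul, hSS ω, add_sub_cancel_left]
            exact mul_le_mul_of_nonneg_left (Finset.abs_sum_le_sum_abs _ _) (abs_nonneg t)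
          have h2 : ‖V k ω ^ 2 - c‖ ≤ |V k ω| ^ 2 + c := by
            refine (norm_sub_le _ _).trans ?_
            simp [abs_of_nonneg hc]
          refine (mul_le_mul h2 h1 (norm_nonneg _) (by positivity)).trans ?_
          rw [mul_left_comm, Finset.mul_sum]
          refine mul_le_mul_of_nonneg_left (Finset.sum_le_sum fun l _ => ?_) (abs_nonneg t)
          have ha := abs_nonneg (V l ω)
          have hb := abs_nonneg (V k ω)
          have h3 : |V k ω| ^ 2 * |V l ω| ≤ |V l ω| ^ 3 + |V k ω| ^ 3 := by
            rcases le_total (|V l ω|) (|V k ω|) with h | h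
            · have := mul_le_mul_of_nonneg_left h (sq_nonneg |V k ω|)
              have := pow_nonneg ha 3
              nlinarith
            · have := mul_le_mul_of_nonneg_right (pow_le_pow_left₀ hb h 2) ha
              have := pow_nonneg hb 3
              nlinarith
          rw [add_mul]
          linarith
      _ = _ := by
          rw [integral_const_mul, integral_finsetSum _ fun l _ => i2 l]
          congr 1
          refine Finset.sum_congr rfl fun l _ => ?_
          rw [integral_add (i3 l) ((iV l).const_mul c),
            integral_add (hV3 l) (hV3 k), integral_const_mul]
  rw [integral_sub (i1 hS) (i1 hS')] at key
  have := norm_le_norm_add_norm_sub' (∫ ω, (V k ω ^ 2 - c) • phase (t * S ω) ∂μ)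
    (∫ ω, (V k ω ^ 2 - c) • phase (t * S' ω) ∂μ)
  linarith

lemma norm_telescope_le (a : ℕ → ℂ) (A : ℕ → ℝ) {K : ℝ} {n : ℕ} (hA : ∀ k, |A k| ≤ K)
    (δ : ℕ → ℝ) (h : ∀ k < n, ‖a (k + 1) - (A k / A (k + 1) : ℝ) * a k‖ ≤ δ k)
    (hA0 : ∀ k, A k ≠ 0) :
    ‖A n * a n - A 0 * a 0‖ ≤ K * ∑ k ∈ Finset.range n, δ k := by
  rw [← Finset.sum_range_sub (fun k => (A k * a k : ℂ)), Finset.mul_sum]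
  refine (norm_sum_le _ _).trans (Finset.sum_le_sum fun k hk => ?_)
  have e : (A (k + 1) * a (k + 1) - A k * a k : ℂ) =
      A (k + 1) * (a (k + 1) - (A k / A (k + 1) : ℝ) * a k) := by
    have : (A (k + 1) : ℂ) ≠ 0 := by exact_mod_cast hA0 _
    push_cast
    field_simp
  rw [e, norm_mul, Complex.norm_real]
  exact mul_le_mul (hA _) (h k (Finset.mem_range.1 hk)) (norm_nonneg _)
    ((abs_nonneg _).trans (hA 0))

/-- A central limit theorem for triangular arrays of uncorrelated-with-the-past increments, in
terms of characteristic functions. -/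
theorem tendsto_integral_phase_sum {μ : Measure Ω'} [IsProbabilityMeasure μ]
    {W : ℕ → ℕ → Ω' → ℝ} (hW : ∀ n k, Measurable (W n k))
    (hW3 : ∀ n k, Integrable (fun ω => |W n k ω| ^ 3) μ) {C : ℝ} {c : ℕ → ℕ → ℝ}
    (hc0 : ∀ n k, 0 ≤ c n k) (hcC : ∀ n k, c n k ≤ C * (Real.sqrt n)⁻¹ ^ 2)
    (hW1C : ∀ n k, ∫ ω, |W n k ω| ∂μ ≤ C * (Real.sqrt n)⁻¹)
    (hW3C : ∀ n k, ∫ ω, |W n k ω| ^ 3 ∂μ ≤ C * (Real.sqrt n)⁻¹ ^ 3) (t : ℝ)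
    (hmart : ∀ n k, ∫ ω, W n k ω • phase (t * ∑ l ∈ Finset.range k, W n l ω) ∂μ = 0)
    (hlag : ∀ ε > 0, ∃ b : ℕ, ∀ n, ∀ k,
      ‖∫ ω, (W n k ω ^ 2 - c n k) • phase (t * ∑ l ∈ Finset.range (k - b), W n l ω) ∂μ‖ ≤
        ε * (Real.sqrt n)⁻¹ ^ 2)
    {v : ℝ} (hv : Tendsto (fun n => ∑ k ∈ Finset.range n, c n k) atTop (𝓝 v)) :
    Tendsto (fun n => ∫ ω, phase (t * ∑ k ∈ Finset.range n, W n k ω) ∂μ) atTop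
      (𝓝 (Real.exp (-(t ^ 2 * v / 2)) : ℂ)) := by
  have hC : 0 ≤ C := by
    have := (integral_nonneg fun ω => abs_nonneg (W 1 0 ω)).trans (hW1C 1 0)
    simpa using this
  set S : ℕ → ℕ → Ω' → ℝ := fun n k ω => ∑ l ∈ Finset.range k, W n l ω with hS
  have mS (n k) : Measurable (S n k) := Finset.measurable_fun_sum _ fun l _ => hW n l
  set a : ℕ → ℕ → ℂ := fun n k => ∫ ω, phase (t * S n k ω) ∂μ with ha
  set A : ℕ → ℕ → ℝ := fun n k => Real.exp (t ^ 2 / 2 * ∑ l ∈ Finset.range k, c n l) with hA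
  have hstep (n k b : ℕ) (ε : ℝ) (hb : ‖∫ ω, (W n k ω ^ 2 - c n k) •
      phase (t * ∑ l ∈ Finset.range (k - b), W n l ω) ∂μ‖ ≤ ε * (Real.sqrt n)⁻¹ ^ 2) :
      ‖a n (k + 1) - (A n k / A n (k + 1) : ℝ) * a n k‖ ≤
        4 * |t| ^ 3 * (C * (Real.sqrt n)⁻¹ ^ 3) + (t ^ 2 * (C * (Real.sqrt n)⁻¹ ^ 2) / 2) ^ 2 +
        t ^ 2 / 2 * (ε * (Real.sqrt n)⁻¹ ^ 2 +
          |t| * (b * (C * (Real.sqrt n)⁻¹ ^ 3 + C * (Real.sqrt n)⁻¹ ^ 3 +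
            C * (Real.sqrt n)⁻¹ ^ 2 * (C * (Real.sqrt n)⁻¹)))) := by
    have hr : A n k / A n (k + 1) = Real.exp (-(t ^ 2 * c n k / 2)) := by
      simp only [hA]
      rw [← Real.exp_sub, Finset.sum_range_succ]
      congr 1
      ring
    have e : a n (k + 1) - (A n k / A n (k + 1) : ℝ) * a n k =
        ∫ ω, phase (t * S n k ω) * (phase (t * W n k ω) - Real.exp (-(t ^ 2 * c n k / 2))) ∂μ := by
      have ib (j : ℕ) : Integrable (fun ω => phase (t * S n j ω)) μ :=
        Integrable.of_bound (C := 1) (continuous_phase.measurable.comp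
          ((mS n j).const_mul t)).aestronglyMeasurable (ae_of_all _ fun ω => (norm_phase _).le)
      rw [hr, ha]
      simp only
      rw [← integral_const_mul, ← integral_sub (ib _) ((ib _).const_mul _)]
      refine integral_congr_ae (ae_of_all _ fun ω => ?_)
      simp only [hS]
      rw [Finset.sum_range_succ, mul_add, phase_add]
      ring
    rw [e]
    refine (norm_integral_increment_le (hW n k) (hW3 n k)
      (continuous_phase.measurable.comp ((mS n k).const_mul t))
      (fun ω => (norm_phase _).le) (hc0 n k) t (hmart n k)).trans ?_
    have hlag' := norm_integral_phase_lag_le (μ := μ) (V := W n) (hW n) (hW3 n) (k := k)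
      (Finset.Ico (k - b) k) (mS n k) (mS n (k - b)) (fun ω => by
        simp only [hS]
        rw [Finset.range_eq_Ico, Finset.range_eq_Ico,
          Finset.sum_Ico_consecutive _ (Nat.zero_le _) (Nat.sub_le _ _)]) (hc0 n k) t
    have hcard : ((Finset.Ico (k - b) k).card : ℝ) ≤ b := by
      rw [Nat.card_Ico]
      exact_mod_cast (by omega : k - (k - b) ≤ b)
    have hsum : ∑ l ∈ Finset.Ico (k - b) k, (∫ ω, |W n l ω| ^ 3 ∂μ + ∫ ω, |W n k ω| ^ 3 ∂μ
        + c n k * ∫ ω, |W n l ω| ∂μ) ≤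
        b * (C * (Real.sqrt n)⁻¹ ^ 3 + C * (Real.sqrt n)⁻¹ ^ 3 +
            C * (Real.sqrt n)⁻¹ ^ 2 * (C * (Real.sqrt n)⁻¹)) := by
      refine (Finset.sum_le_card_nsmul _ _ (C * (Real.sqrt n)⁻¹ ^ 3 + C * (Real.sqrt n)⁻¹ ^ 3 +
            C * (Real.sqrt n)⁻¹ ^ 2 * (C * (Real.sqrt n)⁻¹)) fun l _ => ?_).trans ?_
      · exact add_le_add (add_le_add (hW3C n l) (hW3C n k)) (mul_le_mul (hcC n k) (hW1C n l)
          (integral_nonneg fun ω => abs_nonneg _) (by positivity))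
      · rw [nsmul_eq_mul]
        exact mul_le_mul_of_nonneg_right hcard (by positivity)
    gcongr
    · exact hW3C n k
    · have := hc0 n k
      positivity
    · exact hcC n k
    · exact hlag'.trans (add_le_add hb (mul_le_mul_of_nonneg_left hsum (abs_nonneg t)))
  set K := Real.exp (t ^ 2 / 2 * C) with hK
  have hbound (b : ℕ) (ε : ℝ) (hb : ∀ n k, ‖∫ ω, (W n k ω ^ 2 - c n k) •
      phase (t * ∑ l ∈ Finset.range (k - b), W n l ω) ∂μ‖ ≤ ε * (Real.sqrt n)⁻¹ ^ 2)
      (n : ℕ) (hn : n ≠ 0) :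
      ‖(A n n : ℂ) * a n n - 1‖ ≤ K * ((4 * |t| ^ 3 * C + t ^ 2 / 2 * |t| * b * (2 * C + C ^ 2))
        * (Real.sqrt n)⁻¹ + t ^ 4 * C ^ 2 / 4 * (Real.sqrt n)⁻¹ ^ 2 + t ^ 2 / 2 * ε) := by
    have hn' : (n : ℝ) * (Real.sqrt n)⁻¹ ^ 2 = 1 := by
      rw [inv_pow, Real.sq_sqrt (Nat.cast_nonneg n), mul_inv_cancel₀ (by exact_mod_cast hn)]
    have hAK (k : ℕ) : |A n (min k n)| ≤ K := by
      rw [abs_of_pos (Real.exp_pos _)]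
      refine Real.exp_le_exp.2 (mul_le_mul_of_nonneg_left ?_ (by positivity))
      calc _ ≤ ∑ l ∈ Finset.range n, c n l :=
            Finset.sum_le_sum_of_subset_of_nonneg
              (Finset.range_subset_range.2 (min_le_right k n)) fun l _ _ => hc0 n l
        _ ≤ n * (C * (Real.sqrt n)⁻¹ ^ 2) := by
            refine (Finset.sum_le_card_nsmul _ _ _ fun l _ => hcC n l).trans ?_
            simp
        _ = C := by rw [mul_left_comm, hn', mul_one]
    have := norm_telescope_le (a n) (fun k => A n (min k n)) (n := n) hAK
      (fun _ => 4 * |t| ^ 3 * (C * (Real.sqrt n)⁻¹ ^ 3) +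
        (t ^ 2 * (C * (Real.sqrt n)⁻¹ ^ 2) / 2) ^ 2 +
        t ^ 2 / 2 * (ε * (Real.sqrt n)⁻¹ ^ 2 +
          |t| * (b * (C * (Real.sqrt n)⁻¹ ^ 3 + C * (Real.sqrt n)⁻¹ ^ 3 +
            C * (Real.sqrt n)⁻¹ ^ 2 * (C * (Real.sqrt n)⁻¹))))) (fun k hk => by
      have h1 : min k n = k := min_eq_left hk.le
      have h2 : min (k + 1) n = k + 1 := min_eq_left hk
      rw [h1, h2]
      exact hstep n k b ε (hb n k)) (fun k => (Real.exp_pos _).ne')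
    have e0 : (A n (min 0 n) : ℂ) * a n 0 = 1 := by simp [hA, ha, hS, phase]
    rw [e0, min_self] at this
    refine this.trans (mul_le_mul_of_nonneg_left (le_of_eq ?_) (Real.exp_pos _).le)
    rw [Finset.sum_const, Finset.card_range, nsmul_eq_mul]
    linear_combination ((4 * |t| ^ 3 * C + t ^ 2 / 2 * |t| * b * (2 * C + C ^ 2))
        * (Real.sqrt n)⁻¹ + t ^ 4 * C ^ 2 / 4 * (Real.sqrt n)⁻¹ ^ 2 + t ^ 2 / 2 * ε) * hn'
  have hr0 : Tendsto (fun n : ℕ => (Real.sqrt n)⁻¹) atTop (𝓝 0) :=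
    tendsto_inv_atTop_zero.comp (Real.tendsto_sqrt_atTop.comp tendsto_natCast_atTop_atTop)
  have hlim : Tendsto (fun n => (A n n : ℂ) * a n n) atTop (𝓝 1) := by
    rw [Metric.tendsto_nhds]
    intro η hη
    have hKpos : 0 < K := Real.exp_pos _
    obtain ⟨b, hb⟩ := hlag (η / (K * (t ^ 2 + 1))) (by positivity)
    have hT : Tendsto (fun n : ℕ => K * ((4 * |t| ^ 3 * C + t ^ 2 / 2 * |t| * b * (2 * C + C ^ 2))
        * (Real.sqrt n)⁻¹ + t ^ 4 * C ^ 2 / 4 * (Real.sqrt n)⁻¹ ^ 2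
        + t ^ 2 / 2 * (η / (K * (t ^ 2 + 1))))) atTop
        (𝓝 (K * ((4 * |t| ^ 3 * C + t ^ 2 / 2 * |t| * b * (2 * C + C ^ 2))
        * 0 + t ^ 4 * C ^ 2 / 4 * 0 ^ 2 + t ^ 2 / 2 * (η / (K * (t ^ 2 + 1)))))) :=
      (((hr0.const_mul _).add ((hr0.pow 2).const_mul _)).add_const _).const_mul _
    have hlt : K * ((4 * |t| ^ 3 * C + t ^ 2 / 2 * |t| * b * (2 * C + C ^ 2))
        * 0 + t ^ 4 * C ^ 2 / 4 * 0 ^ 2 + t ^ 2 / 2 * (η / (K * (t ^ 2 + 1)))) < η := by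
      have : K * ((4 * |t| ^ 3 * C + t ^ 2 / 2 * |t| * b * (2 * C + C ^ 2))
        * 0 + t ^ 4 * C ^ 2 / 4 * 0 ^ 2 + t ^ 2 / 2 * (η / (K * (t ^ 2 + 1)))) =
          η * (t ^ 2 / (2 * (t ^ 2 + 1))) := by
        field_simp
        ring
      rw [this]
      refine mul_lt_of_lt_one_right hη ?_
      rw [div_lt_one (by positivity)]
      nlinarith [sq_nonneg t]
    filter_upwards [hT.eventually_lt_const hlt, eventually_ne_atTop 0] with n h1 h2
    rw [dist_eq_norm]
    exact (hbound b _ hb n h2).trans_lt h1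
  have hAinv : Tendsto (fun n => (Real.exp (-(t ^ 2 * (∑ k ∈ Finset.range n, c n k) / 2)) : ℂ))
      atTop (𝓝 (Real.exp (-(t ^ 2 * v / 2)) : ℂ)) :=
    ((Complex.continuous_ofReal.comp Real.continuous_exp).tendsto _).comp
      (((hv.const_mul _).div_const _).neg)
  have := hAinv.mul hlim
  rw [mul_one] at this
  refine this.congr fun n => ?_
  rw [← mul_assoc, ← Complex.ofReal_mul, ← Real.exp_add]
  have : -(t ^ 2 * (∑ k ∈ Finset.range n, c n k) / 2)
      + t ^ 2 / 2 * ∑ k ∈ Finset.range n, c n k = 0 := by ring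
  rw [this]
  simp [ha, hS]

lemma norm_integral_smul_le_integral_abs_condExp {μ : Measure Ω'}
    [IsFiniteMeasure μ] {m : MeasurableSpace Ω'} (hm : m ≤ mΩ') {g : Ω' → ℝ}
    (hg : Integrable g μ) {F : Ω' → ℂ} (hF : StronglyMeasurable[m] F) (hF1 : ∀ ω, ‖F ω‖ ≤ 1) :
    ‖∫ ω, g ω • F ω ∂μ‖ ≤ ∫ ω, |(μ[g|m]) ω| ∂μ := by
  have hi : Integrable (g • F) μ :=
    hg.smul_bdd 1 (hF.mono hm).aestronglyMeasurable (ae_of_all _ hF1)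
  have h := condExp_smul_of_aestronglyMeasurable_right hg hi hF.aestronglyMeasurable
  have e : ∫ ω, g ω • F ω ∂μ = ∫ ω, (μ[g|m]) ω • F ω ∂μ := by
    exact (integral_condExp hm).symm.trans (integral_congr_ae h)
  rw [e]
  refine norm_integral_le_of_norm_le integrable_condExp.abs (ae_of_all _ fun ω => ?_)
  rw [norm_smul, Real.norm_eq_abs]
  exact mul_le_of_le_one_right (abs_nonneg _) (hF1 ω)

lemma integral_abs_condExp_le_of_abs_setIntegral_le {μ : Measure Ω'}
    [IsFiniteMeasure μ] {m : MeasurableSpace Ω'} (hm : m ≤ mΩ') {g : Ω' → ℝ}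
    (hg : Integrable g μ) {δ : ℝ} (h : ∀ A, MeasurableSet[m] A → |∫ ω in A, g ω ∂μ| ≤ δ) :
    ∫ ω, |(μ[g|m]) ω| ∂μ ≤ 2 * δ := by
  set A : Set Ω' := {ω | 0 ≤ (μ[g|m]) ω} with hA
  have mA : MeasurableSet[m] A := stronglyMeasurable_condExp.measurable measurableSet_Ici
  have hi : Integrable (fun ω => |(μ[g|m]) ω|) μ := integrable_condExp.abs
  rw [← integral_add_compl (hm _ mA) hi]
  have h1 : ∫ ω in A, |(μ[g|m]) ω| ∂μ = ∫ ω in A, g ω ∂μ := by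
    rw [← setIntegral_condExp hm hg mA]
    exact setIntegral_congr_fun (hm _ mA) fun ω hω => abs_of_nonneg hω
  have h2 : ∫ ω in Aᶜ, |(μ[g|m]) ω| ∂μ = -∫ ω in Aᶜ, g ω ∂μ := by
    rw [← setIntegral_condExp hm hg mA.compl, ← integral_neg]
    exact setIntegral_congr_fun (hm _ mA).compl fun ω hω => abs_of_neg (not_le.1 hω)
  rw [h1, h2]
  have := (abs_le.1 (h A mA)).2
  have := (abs_le.1 (h Aᶜ mA.compl)).1
  linarith

/-- If conditional probabilities of `B` decouple along `(ξ j, m j)`, then so do conditional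
expectations of integrable functions. -/
lemma exists_forall_integral_abs_condExp_le {μ : Measure Ω'}
    [IsProbabilityMeasure μ] {α ι : Type*} [MeasurableSpace α] {ν : Measure α}
    [IsProbabilityMeasure ν] {ξ : ι → Ω' → α} (hξ : ∀ i, Measurable (ξ i))
    (hlaw : ∀ i, μ.map (ξ i) = ν) (m : ℕ → ι → MeasurableSpace Ω')
    (hB : ∀ ε > 0, ∃ b₀ : ℕ, ∀ b ≥ b₀, ∀ i (B : Set α), MeasurableSet B →
      ∫ ω, |(μ[fun ω => B.indicator (fun _ => (1 : ℝ)) (ξ i ω) - ν.real B|m b i]) ω| ∂μ ≤ ε)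
    {h : α → ℝ} (hh : Integrable h ν) :
    ∀ ε > 0, ∃ b₀ : ℕ, ∀ b ≥ b₀, ∀ i,
      ∫ ω, |(μ[fun ω => h (ξ i ω) - ∫ x, h x ∂ν|m b i]) ω| ∂μ ≤ ε := by
  have hcomp {h : α → ℝ} (hh : Integrable h ν) (i : ι) : Integrable (fun ω => h (ξ i ω)) μ :=
    Integrable.comp_measurable (by rwa [hlaw i]) (hξ i)
  have hsub {h : α → ℝ} (hh : Integrable h ν) (i : ι) :
      Integrable (fun ω => h (ξ i ω) - ∫ x, h x ∂ν) μ := (hcomp hh i).sub (integrable_const _)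
  have hadd {g₁ g₂ : Ω' → ℝ} (h₁ : Integrable g₁ μ) (h₂ : Integrable g₂ μ)
      (m' : MeasurableSpace Ω') :
      ∫ ω, |(μ[g₁ + g₂|m']) ω| ∂μ ≤ ∫ ω, |(μ[g₁|m']) ω| ∂μ + ∫ ω, |(μ[g₂|m']) ω| ∂μ := by
    rw [← integral_add integrable_condExp.abs integrable_condExp.abs]
    refine integral_mono_ae integrable_condExp.abs
      (integrable_condExp.abs.add integrable_condExp.abs) ?_
    filter_upwards [condExp_add h₁ h₂ m'] with ω hω
    rw [hω]
    exact abs_add_le _ _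
  have hcont {f g : α → ℝ} (hf : Integrable f ν) (hg : Integrable g ν) (b : ℕ) (i : ι) :
      ∫ ω, |(μ[fun ω => f (ξ i ω) - ∫ x, f x ∂ν|m b i]) ω| ∂μ ≤
        ∫ ω, |(μ[fun ω => g (ξ i ω) - ∫ x, g x ∂ν|m b i]) ω| ∂μ
          + 2 * ∫ x, |f x - g x| ∂ν := by
    have e : (fun ω => f (ξ i ω) - ∫ x, f x ∂ν) = (fun ω => g (ξ i ω) - ∫ x, g x ∂ν)
        + fun ω => (f - g) (ξ i ω) - ∫ x, (f - g) x ∂ν := by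
      ext ω
      simp only [Pi.add_apply, Pi.sub_apply, integral_sub hf hg]
      ring
    rw [e]
    refine (hadd (hsub hg i) (hsub (hf.sub hg) i) _).trans (add_le_add_right ?_ _)
    refine (integral_abs_condExp_le _).trans ?_
    have h1 : ∫ ω, |(f - g) (ξ i ω)| ∂μ = ∫ x, |f x - g x| ∂ν := by
      rw [← hlaw i, integral_map (hξ i).aemeasurable]
      · rfl
      · rw [hlaw i]
        exact (hf.sub hg).abs.aestronglyMeasurable
    calc _ ≤ ∫ ω, (|(f - g) (ξ i ω)| + |∫ x, (f - g) x ∂ν|) ∂μ :=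
          integral_mono (hsub (hf.sub hg) i).abs
            ((hcomp (hf.sub hg) i).abs.add (integrable_const _)) fun ω => abs_sub _ _
      _ = ∫ x, |f x - g x| ∂ν + |∫ x, (f - g) x ∂ν| := by
          rw [integral_add (hcomp (hf.sub hg) i).abs (integrable_const _), h1]
          simp
      _ ≤ _ := by
          rw [two_mul]
          exact add_le_add_right abs_integral_le_integral_abs _
  refine Integrable.induction (P := fun h => ∀ ε > 0, ∃ b₀ : ℕ, ∀ b ≥ b₀, ∀ i,
      ∫ ω, |(μ[fun ω => h (ξ i ω) - ∫ x, h x ∂ν|m b i]) ω| ∂μ ≤ ε) ?_ ?_ ?_ ?_ hh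
  · intro c s hs _ ε hε
    obtain ⟨b₀, hb₀⟩ := hB (ε / (|c| + 1)) (by positivity)
    refine ⟨b₀, fun b hb i => ?_⟩
    have e : (fun ω => s.indicator (fun _ => c) (ξ i ω) - ∫ x, s.indicator (fun _ => c) x ∂ν) =
        c • fun ω => s.indicator (fun _ => (1 : ℝ)) (ξ i ω) - ν.real s := by
      ext ω
      rw [integral_indicator_const _ hs]
      by_cases hω : ξ i ω ∈ s <;> simp [hω] <;> ring
    rw [e]
    have e2 : ∫ ω, |(μ[c • fun ω => s.indicator (fun _ => (1 : ℝ)) (ξ i ω)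
        - ν.real s|m b i]) ω| ∂μ = |c| * ∫ ω, |(μ[fun ω => s.indicator (fun _ => (1 : ℝ)) (ξ i ω)
        - ν.real s|m b i]) ω| ∂μ := by
      rw [← integral_const_mul]
      refine integral_congr_ae ?_
      filter_upwards [condExp_smul (μ := μ) c (fun ω => s.indicator (fun _ => (1 : ℝ)) (ξ i ω)
        - ν.real s) (m b i)] with ω hω
      rw [hω, Pi.smul_apply, smul_eq_mul, abs_mul]
    rw [e2]
    calc _ ≤ |c| * (ε / (|c| + 1)) :=
          mul_le_mul_of_nonneg_left (hb₀ b hb i s hs) (abs_nonneg c)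
      _ ≤ (|c| + 1) * (ε / (|c| + 1)) :=
          mul_le_mul_of_nonneg_right (by linarith) (by positivity)
      _ = ε := by field_simp
  · intro f g _ hf hg ihf ihg ε hε
    obtain ⟨b₁, hb₁⟩ := ihf (ε / 2) (by positivity)
    obtain ⟨b₂, hb₂⟩ := ihg (ε / 2) (by positivity)
    refine ⟨max b₁ b₂, fun b hb i => ?_⟩
    have e : (fun ω => (f + g) (ξ i ω) - ∫ x, (f + g) x ∂ν) = (fun ω => f (ξ i ω) - ∫ x, f x ∂ν)
        + fun ω => g (ξ i ω) - ∫ x, g x ∂ν := by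
      ext ω
      simp only [Pi.add_apply, integral_add hf hg]
      ring
    rw [e]
    have h1 := hb₁ b (le_of_max_le_left hb) i
    have h2 := hb₂ b (le_of_max_le_right hb) i
    exact (hadd (hsub hf i) (hsub hg i) _).trans (by linarith)
  · refine isClosed_of_closure_subset fun f hf ε hε => ?_
    obtain ⟨g, hg, hfg⟩ := Metric.mem_closure_iff.1 hf (ε / 4) (by positivity)
    obtain ⟨b₀, hb₀⟩ := hg (ε / 2) (by positivity)
    refine ⟨b₀, fun b hb i => ?_⟩
    have h1 := hcont (L1.integrable_coeFn f) (L1.integrable_coeFn g) b i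
    have h2 := hb₀ b hb i
    rw [L1.dist_eq_integral_dist] at hfg
    simp only [Real.dist_eq] at hfg
    linarith
  · intro f g hfg hf ih ε hε
    obtain ⟨b₀, hb₀⟩ := ih ε hε
    refine ⟨b₀, fun b hb i => ?_⟩
    have h1 := hcont (hf.congr hfg) hf b i
    have h2 : ∫ x, |g x - f x| ∂ν = 0 := by
      rw [integral_eq_zero_of_ae]
      filter_upwards [hfg] with x hx
      simp [hx]
    have h3 := hb₀ b hb i
    linarith

end Array

section DataGenerating

variable {P : Measure Ω} {Y : ℤ → Ω → ℝ} {X : ℤ → Ω → Fin d → ℝ} {m : (Fin d → ℝ) → ℝ}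

lemma sigPast_le (hY : ∀ t, Measurable (Y t)) (hX : ∀ t, Measurable (X t)) (k : ℤ) :
    sigPast Y X k ≤ ‹MeasurableSpace Ω› :=
  iSup₂_le fun s _ => sup_le (hY s).comap_le (hX s).comap_le

lemma sigF_le (hY : ∀ t, Measurable (Y t)) (hX : ∀ t, Measurable (X t)) (hm : Measurable m)
    (k : ℤ) : sigF Y X m k ≤ ‹MeasurableSpace Ω› :=
  iSup₂_le fun s _ => sup_le ((hY (s - 1)).sub (hm.comp (hX (s - 1)))).comap_le (hX s).comap_le

omit [MeasurableSpace Ω] in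
lemma measurable_sigPast_response {s k : ℤ} (h : s ≤ k) : Measurable[sigPast Y X k] (Y s) :=
  Measurable.of_comap_le (le_sup_left.trans (le_iSup₂_of_le s h le_rfl))

omit [MeasurableSpace Ω] in
lemma measurable_sigPast_covariate {s k : ℤ} (h : s ≤ k) : Measurable[sigPast Y X k] (X s) :=
  Measurable.of_comap_le (le_sup_right.trans (le_iSup₂_of_le s h le_rfl))

omit [MeasurableSpace Ω] in
lemma measurable_sigFuture_pair {s k : ℤ} (h : k ≤ s) :
    Measurable[sigFuture Y X k] fun ω => (Y s ω, X s ω) :=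
  Measurable.prodMk
    (Measurable.of_comap_le (le_sup_left.trans (le_iSup₂_of_le s h le_rfl)))
    (Measurable.of_comap_le (le_sup_right.trans (le_iSup₂_of_le s h le_rfl)))

omit [MeasurableSpace Ω] in
lemma measurable_sigF_covariate {s k : ℤ} (h : s ≤ k) : Measurable[sigF Y X m k] (X s) :=
  Measurable.of_comap_le (le_sup_right.trans (le_iSup₂_of_le s h le_rfl))

omit [MeasurableSpace Ω] in
lemma measurable_sigF_error {s k : ℤ} (h : s < k) :
    Measurable[sigF Y X m k] fun ω => Y s ω - m (X s ω) := by
  have h1 : Measurable[sigF Y X m k] fun ω => Y (s + 1 - 1) ω - m (X (s + 1 - 1) ω) :=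
    Measurable.of_comap_le (le_sup_left.trans (le_iSup₂_of_le (s + 1) h le_rfl))
  simpa using h1

lemma measurable_orth (z : Fin d → ℝ) : Measurable (orth z) :=
  measurable_const.indicator measurableSet_Iic

lemma abs_orth_le_one (z x : Fin d → ℝ) : |orth z x| ≤ 1 := by
  by_cases h : x ≤ z <;> simp [orth, h]

lemma orth_mul_orth (z z' x : Fin d → ℝ) : orth z x * orth z' x = orth (z ⊓ z') x := by
  by_cases h : x ≤ z <;> by_cases h' : x ≤ z' <;> simp [orth, h, h']

lemma abs_measure_inter_sub_le_alphaMix [IsProbabilityMeasure P] {k : ℤ} {t : ℕ} {A B : Set Ω}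
    (hA : MeasurableSet[sigPast Y X k] A) (hB : MeasurableSet[sigFuture Y X (k + t)] B) :
    |P.real (A ∩ B) - P.real A * P.real B| ≤ alphaMix P Y X t := by
  refine le_csSup ⟨1, ?_⟩ ⟨k, A, B, hA, hB, rfl⟩
  rintro r ⟨_, A, B, -, -, rfl⟩
  have h1 : (P (A ∩ B)).toReal ≤ 1 := measureReal_le_one
  have h2 : (P A).toReal ≤ 1 := measureReal_le_one
  have h3 : (P B).toReal ≤ 1 := measureReal_le_one
  have h4 : 0 ≤ (P (A ∩ B)).toReal := measureReal_nonneg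
  have h5 : 0 ≤ (P A).toReal := measureReal_nonneg
  have h6 : 0 ≤ (P B).toReal := measureReal_nonneg
  have h7 := mul_nonneg h5 h6
  have h8 := mul_le_one₀ h2 h6 h3
  rw [abs_le]
  constructor <;> linarith

lemma integral_abs_condExp_indicator_le [IsProbabilityMeasure P] (hY : ∀ t, Measurable (Y t))
    (hX : ∀ t, Measurable (X t)) {i : ℤ} (b : ℕ) {B : Set (ℝ × (Fin d → ℝ))}
    (hB : MeasurableSet B) :
    ∫ ω, |(P[fun ω => B.indicator (fun _ => (1 : ℝ)) (Y i ω, X i ω)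
      - (P.map fun ω => (Y i ω, X i ω)).real B|sigPast Y X (i - b)]) ω| ∂P ≤
      2 * alphaMix P Y X b := by
  have hξ : Measurable fun ω => (Y i ω, X i ω) := (hY i).prodMk (hX i)
  have hi : Integrable (fun ω => B.indicator (fun _ => (1 : ℝ)) (Y i ω, X i ω)) P :=
    (integrable_const (1 : ℝ)).indicator (hξ hB)
  refine integral_abs_condExp_le_of_abs_setIntegral_le (sigPast_le hY hX _)
    (hi.sub (integrable_const _)) fun A hA => ?_
  have hA' := sigPast_le hY hX _ _ hA
  have hBf : MeasurableSet[sigFuture Y X (i - b + b)] ((fun ω => (Y i ω, X i ω)) ⁻¹' B) :=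
    measurable_sigFuture_pair (by omega) hB
  have e : ∫ ω in A, (B.indicator (fun _ => (1 : ℝ)) (Y i ω, X i ω)
      - (P.map fun ω => (Y i ω, X i ω)).real B) ∂P =
      P.real (A ∩ (fun ω => (Y i ω, X i ω)) ⁻¹' B)
        - P.real A * P.real ((fun ω => (Y i ω, X i ω)) ⁻¹' B) := by
    rw [integral_sub hi.integrableOn (integrable_const _), map_measureReal_apply hξ hB]
    congr 1
    · change ∫ ω in A, ((fun ω => (Y i ω, X i ω)) ⁻¹' B).indicator (fun _ => (1 : ℝ)) ω ∂P = _
      rw [integral_indicator_const _ (hξ hB), measureReal_restrict_apply (hξ hB), inter_comm]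
      simp
    · simp
  refine (congrArg abs e).trans_le ?_
  exact abs_measure_inter_sub_le_alphaMix hA hBf

lemma map_pair_eq (hY : ∀ t, Measurable (Y t)) (hX : ∀ t, Measurable (X t))
    (hstat : ∀ (k : ℤ) (I : Finset ℤ),
      Measure.map (fun ω (i : I) => (Y (i : ℤ) ω, X (i : ℤ) ω)) P =
        Measure.map (fun ω (i : I) => (Y ((i : ℤ) + k) ω, X ((i : ℤ) + k) ω)) P) (t : ℤ) :
    P.map (fun ω => (Y t ω, X t ω)) = P.map fun ω => (Y 1 ω, X 1 ω) := by
  have h := congrArg (Measure.map fun x : ({1} : Finset ℤ) → ℝ × (Fin d → ℝ) =>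
    x ⟨1, Finset.mem_singleton_self 1⟩) (hstat (t - 1) {1})
  rw [Measure.map_map (measurable_pi_apply _)
      (measurable_pi_lambda _ fun i => (hY _).prodMk (hX _)),
    Measure.map_map (measurable_pi_apply _)
      (measurable_pi_lambda _ fun i => (hY _).prodMk (hX _))] at h
  rw [← add_sub_cancel 1 t]
  exact h.symm

lemma integral_sq_mul_orth [IsProbabilityMeasure P] (hY : Measurable (Y 1))
    (hX : Measurable (X 1)) (hm : Measurable m)
    (hUsq : Integrable (fun ω => (Y 1 ω - m (X 1 ω)) ^ 2) P) {σ2 f : (Fin d → ℝ) → ℝ}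
    (hσ2 : Measurable σ2) (hf : Measurable f) (hf0 : ∀ x, 0 ≤ f x)
    (hcondvar : P[fun ω => (Y 1 ω - m (X 1 ω)) ^ 2|MeasurableSpace.comap (X 1) inferInstance]
        =ᵐ[P] fun ω => σ2 (X 1 ω))
    (hXlaw : Measure.map (X 1) P =
      (volume : Measure (Fin d → ℝ)).withDensity fun x => ENNReal.ofReal (f x))
    (z : Fin d → ℝ) :
    ∫ p, (p.1 - m p.2) ^ 2 * orth z p.2 ∂(P.map fun ω => (Y 1 ω, X 1 ω)) =
      ∫ u in {u : Fin d → ℝ | u ≤ z}, σ2 u * f u := by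
  have hS : MeasurableSet {u : Fin d → ℝ | u ≤ z} := measurableSet_Iic
  have hmz := measurable_orth z
  rw [integral_map (hY.prodMk hX).aemeasurable (by fun_prop)]
  calc ∫ ω, (Y 1 ω - m (X 1 ω)) ^ 2 * orth z (X 1 ω) ∂P
      = ∫ ω in X 1 ⁻¹' {u | u ≤ z}, (Y 1 ω - m (X 1 ω)) ^ 2 ∂P := by
        rw [← integral_indicator (hX hS)]
        refine integral_congr_ae (ae_of_all _ fun ω => ?_)
        by_cases h : X 1 ω ≤ z <;> simp [orth, h]
    _ = ∫ ω in X 1 ⁻¹' {u | u ≤ z}, σ2 (X 1 ω) ∂P := by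
        rw [← setIntegral_condExp hX.comap_le hUsq ⟨_, hS, rfl⟩]
        exact integral_congr_ae (ae_restrict_of_ae hcondvar)
    _ = ∫ u in {u | u ≤ z}, σ2 u ∂(P.map (X 1)) :=
        (setIntegral_map hS hσ2.aestronglyMeasurable hX.aemeasurable).symm
    _ = ∫ u in {u | u ≤ z}, σ2 u * f u := by
        rw [hXlaw, setIntegral_withDensity_eq_setIntegral_toReal_smul (by fun_prop)
          (ae_of_all _ fun _ => ENNReal.ofReal_lt_top) _ hS]
        refine integral_congr_ae (ae_of_all _ fun u => ?_)
        simp [ENNReal.toReal_ofReal (hf0 u), mul_comm]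

end DataGenerating

lemma sum_Icc_int_eq_sum_range {M : Type*} [AddCommMonoid M] (g : ℤ → M) {n : ℕ} {N : ℤ}
    (hN : N ≤ n) :
    ∑ i ∈ Finset.Icc 1 N, g i =
      ∑ k ∈ Finset.range n, if (k : ℤ) + 1 ≤ N then g (k + 1) else 0 := by
  rw [← Finset.sum_filter]
  refine Finset.sum_nbij' (fun i => (i - 1).toNat) (fun k => (k : ℤ) + 1) ?_ ?_ ?_ ?_ ?_
  · intro i hi
    simp only [Finset.mem_Icc] at hi
    simp only [Finset.mem_filter, Finset.mem_range]
    omega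
  · intro k hk
    simp only [Finset.mem_filter, Finset.mem_range] at hk
    simp only [Finset.mem_Icc]
    omega
  · intro i hi
    simp only [Finset.mem_Icc] at hi
    omega
  · intro k _
    simp
  · intro i hi
    simp only [Finset.mem_Icc] at hi
    congr 1
    omega

lemma tendsto_inv_sqrt_sq_mul_count {s : ℝ} (hs : s ∈ Icc (0 : ℝ) 1) :
    Tendsto (fun n : ℕ => (Real.sqrt n)⁻¹ ^ 2 *
      ∑ k ∈ Finset.range n, if (k : ℤ) + 1 ≤ ⌊(n : ℝ) * s⌋ then (1 : ℝ) else 0) atTop (𝓝 s) := by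
  refine ((tendsto_nat_floor_mul_div_atTop hs.1).comp
    (tendsto_natCast_atTop_atTop (R := ℝ))).congr fun n => ?_
  have hN : ⌊(n : ℝ) * s⌋ ≤ n := by
    have : (n : ℝ) * s ≤ n := mul_le_of_le_one_right (Nat.cast_nonneg n) hs.2
    exact_mod_cast (Int.floor_le_floor this).trans_eq (Int.floor_natCast n)
  rw [← sum_Icc_int_eq_sum_range (fun _ => (1 : ℝ)) hN]
  simp only [Function.comp_apply, Finset.sum_const, Int.card_Icc, nsmul_eq_mul, mul_one,
    add_sub_cancel_right, Int.floor_toNat]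
  rw [inv_pow, Real.sq_sqrt (Nat.cast_nonneg n), mul_comm s, div_eq_inv_mul]

section Increments

variable {KK : ℕ}

/-- The coefficient of the `k`-th error in `Σ_j λ_j T_n(s_j, z_j)` due to the `j`-th summand. -/
def weight (s lam : Fin KK → ℝ) (n k : ℕ) (j : Fin KK) : ℝ :=
  if (k : ℤ) + 1 ≤ ⌊(n : ℝ) * s j⌋ then lam j else 0

/-- The contribution of the `k`-th observation to `Σ_j λ_j T_n(s_j, z_j)`. -/
def increment (Y : ℤ → Ω → ℝ) (X : ℤ → Ω → Fin d → ℝ) (m : (Fin d → ℝ) → ℝ)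
    (s lam : Fin KK → ℝ) (z : Fin KK → Fin d → ℝ) (n k : ℕ) (ω : Ω) : ℝ :=
  (Real.sqrt n)⁻¹ * ∑ j, weight s lam n k j *
    ((Y (k + 1) ω - m (X (k + 1) ω)) * orth (z j) (X (k + 1) ω))

variable {Y : ℤ → Ω → ℝ} {X : ℤ → Ω → Fin d → ℝ} {m : (Fin d → ℝ) → ℝ}
  {s lam : Fin KK → ℝ} {z : Fin KK → Fin d → ℝ}

lemma abs_weight_le (n k : ℕ) (j : Fin KK) : |weight s lam n k j| ≤ |lam j| := by
  unfold weight
  split_ifs <;> simp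

omit [MeasurableSpace Ω] in
lemma measurable_increment {mΩ : MeasurableSpace Ω} {n k : ℕ}
    (hU : Measurable[mΩ] fun ω => Y (k + 1) ω - m (X (k + 1) ω))
    (hX : Measurable[mΩ] (X (k + 1))) :
    Measurable[mΩ] (increment Y X m s lam z n k) :=
  (Finset.measurable_fun_sum _ fun j _ =>
    (hU.mul ((measurable_orth (z j)).comp hX)).const_mul _).const_mul _

omit [MeasurableSpace Ω] in
lemma sum_mul_Tn_eq (hs : ∀ j, s j ∈ Icc (0 : ℝ) 1) (n : ℕ) (ω : Ω) :
    ∑ j, lam j * Tn Y X m n (s j) (z j) ω =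
      ∑ k ∈ Finset.range n, increment Y X m s lam z n k ω := by
  simp only [increment]
  rw [← Finset.mul_sum, Finset.sum_comm, Finset.mul_sum]
  refine Finset.sum_congr rfl fun j _ => ?_
  have hN : ⌊(n : ℝ) * s j⌋ ≤ n := by
    have : (n : ℝ) * s j ≤ n := mul_le_of_le_one_right (Nat.cast_nonneg n) (hs j).2
    exact_mod_cast (Int.floor_le_floor this).trans_eq (Int.floor_natCast n)
  rw [Tn, sum_Icc_int_eq_sum_range _ hN, mul_left_comm, Finset.mul_sum (a := lam j)]
  congr 1
  refine Finset.sum_congr rfl fun k _ => ?_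
  simp only [weight]
  split_ifs <;> simp

omit [MeasurableSpace Ω] in
lemma abs_increment_le (n k : ℕ) (ω : Ω) :
    |increment Y X m s lam z n k ω| ≤
      (Real.sqrt n)⁻¹ * ((∑ j, |lam j|) * |Y (k + 1) ω - m (X (k + 1) ω)|) := by
  have h0 : 0 ≤ (Real.sqrt n)⁻¹ := by positivity
  rw [increment, abs_mul, abs_of_nonneg h0, Finset.sum_mul]
  refine mul_le_mul_of_nonneg_left ((Finset.abs_sum_le_sum_abs _ _).trans
    (Finset.sum_le_sum fun j _ => ?_)) h0
  rw [abs_mul, abs_mul]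
  exact mul_le_mul (abs_weight_le n k j)
    (mul_le_of_le_one_right (abs_nonneg _) (abs_orth_le_one _ _)) (by positivity) (abs_nonneg _)

omit [MeasurableSpace Ω] in
lemma increment_sq (n k : ℕ) (ω : Ω) :
    increment Y X m s lam z n k ω ^ 2 =
      ∑ p : Fin KK × Fin KK, (Real.sqrt n)⁻¹ ^ 2 * (weight s lam n k p.1 * weight s lam n k p.2) *
        ((Y (k + 1) ω - m (X (k + 1) ω)) ^ 2 * orth (z p.1 ⊓ z p.2) (X (k + 1) ω)) := by
  rw [increment, mul_pow, sq (∑ j, _), Finset.sum_mul_sum, ← Finset.univ_product_univ,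
    ← Finset.sum_product', Finset.mul_sum]
  refine Finset.sum_congr rfl fun p _ => ?_
  rw [← orth_mul_orth]
  ring

lemma tendsto_sum_weight_mul_weight (hs : ∀ j, s j ∈ Icc (0 : ℝ) 1) (p : Fin KK × Fin KK) :
    Tendsto (fun n : ℕ => ∑ k ∈ Finset.range n,
      (Real.sqrt n)⁻¹ ^ 2 * (weight s lam n k p.1 * weight s lam n k p.2)) atTop
      (𝓝 (lam p.1 * lam p.2 * min (s p.1) (s p.2))) := by
  have hmin : min (s p.1) (s p.2) ∈ Icc (0 : ℝ) 1 :=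
    ⟨le_min (hs _).1 (hs _).1, (min_le_left _ _).trans (hs _).2⟩
  refine ((tendsto_inv_sqrt_sq_mul_count hmin).const_mul (lam p.1 * lam p.2)).congr fun n => ?_
  rw [Finset.mul_sum, Finset.mul_sum]
  refine Finset.sum_congr rfl fun k _ => ?_
  have hfl : ⌊(n : ℝ) * min (s p.1) (s p.2)⌋ = min ⌊(n : ℝ) * s p.1⌋ ⌊(n : ℝ) * s p.2⌋ := by
    rw [mul_min_of_nonneg _ _ (Nat.cast_nonneg n)]
    exact Int.floor_mono.map_min
  simp only [hfl, le_min_iff, weight]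
  split_ifs <;> first | (exfalso; tauto) | ring

end Increments

/-- A sequence of random variables whose characteristic functions converge to that of a centred
Gaussian law converges in distribution to it. -/
lemma tendsto_integral_of_tendsto_phase {P : Measure Ω} [IsProbabilityMeasure P]
    {Z : ℕ → Ω → ℝ} (hZ : ∀ n, Measurable (Z n)) {v : ℝ} (hv : 0 ≤ v)
    (h : ∀ t : ℝ, Tendsto (fun n => ∫ ω, phase (t * Z n ω) ∂P) atTop
      (𝓝 (Real.exp (-(t ^ 2 * v / 2)) : ℂ))) (g : BoundedContinuousFunction ℝ ℝ) :
    Tendsto (fun n => ∫ ω, g (Z n ω) ∂P) atTop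
      (𝓝 (∫ x, g x ∂(gaussianReal 0 v.toNNReal))) := by
  let μs : ℕ → ProbabilityMeasure ℝ := fun n =>
    ⟨P.map (Z n), Measure.isProbabilityMeasure_map (hZ n).aemeasurable⟩
  let μ₀ : ProbabilityMeasure ℝ := ⟨gaussianReal 0 v.toNNReal, inferInstance⟩
  have hlim : Tendsto μs atTop (𝓝 μ₀) := by
    refine ProbabilityMeasure.tendsto_of_tendsto_charFun fun t => ?_
    have h0 : charFun (μ₀ : Measure ℝ) t = (Real.exp (-(t ^ 2 * v / 2)) : ℂ) := by
      change charFun (gaussianReal 0 v.toNNReal) t = _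
      rw [charFun_gaussianReal, Complex.ofReal_exp]
      congr 1
      rw [Real.coe_toNNReal _ hv]
      push_cast
      ring
    rw [h0]
    refine (h t).congr fun n => ?_
    change _ = charFun (P.map (Z n)) t
    rw [charFun_apply_real, integral_map (hZ n).aemeasurable (by fun_prop)]
    simp [phase]
  refine ((ProbabilityMeasure.tendsto_iff_forall_integral_tendsto.1 hlim) g).congr fun n => ?_
  exact integral_map (hZ n).aemeasurable g.continuous.aestronglyMeasurable

section MartingaleDifference

variable {P : Measure Ω} [IsProbabilityMeasure P] {Y : ℤ → Ω → ℝ} {X : ℤ → Ω → Fin d → ℝ}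
  {m : (Fin d → ℝ) → ℝ} {KK : ℕ} {s lam : Fin KK → ℝ} {z : Fin KK → Fin d → ℝ}

lemma integral_increment_smul_phase_eq_zero (hY : ∀ t, Measurable (Y t))
    (hX : ∀ t, Measurable (X t)) (hm : Measurable m) {n k : ℕ}
    (hU : Integrable (fun ω => Y (k + 1) ω - m (X (k + 1) ω)) P)
    (hmart : P[fun ω => Y (k + 1) ω - m (X (k + 1) ω)|sigF Y X m (k + 1)] =ᵐ[P] 0) (t : ℝ) :
    ∫ ω, increment Y X m s lam z n k ω •
      phase (t * ∑ l ∈ Finset.range k, increment Y X m s lam z n l ω) ∂P = 0 := by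
  set F : Ω → ℂ := fun ω => phase (t * ∑ l ∈ Finset.range k, increment Y X m s lam z n l ω)
    with hFdef
  have hF : Measurable[sigF Y X m (k + 1)] F := by
    refine continuous_phase.measurable.comp (Measurable.const_mul
      (Finset.measurable_fun_sum _ fun l hl => measurable_increment ?_ ?_) _)
    · refine measurable_sigF_error ?_
      have := Finset.mem_range.1 hl
      omega
    · refine measurable_sigF_covariate ?_
      have := Finset.mem_range.1 hl
      omega
  set G : Fin KK → Ω → ℂ := fun j ω => (orth (z j) (X (k + 1) ω) : ℂ) * F ω with hGdef
  have hG (j : Fin KK) : Measurable[sigF Y X m (k + 1)] (G j) :=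
    (Complex.measurable_ofReal.comp
      ((measurable_orth (z j)).comp (measurable_sigF_covariate le_rfl))).mul hF
  have hG1 (j : Fin KK) (ω : Ω) : ‖G j ω‖ ≤ 1 := by
    simpa [hGdef, hFdef, norm_phase] using abs_orth_le_one (z j) (X (k + 1) ω)
  have hle := sigF_le hY hX hm (k + 1)
  have h0 (j : Fin KK) : ∫ ω, (Y (k + 1) ω - m (X (k + 1) ω)) • G j ω ∂P = 0 := by
    refine norm_le_zero_iff.1 ((norm_integral_smul_le_integral_abs_condExp hle hU
      (hG j).stronglyMeasurable (hG1 j)).trans_eq ?_)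
    rw [integral_eq_zero_of_ae]
    filter_upwards [hmart] with ω hω
    simp [hω]
  have e (ω : Ω) : increment Y X m s lam z n k ω • F ω =
      ∑ j, ((Real.sqrt n)⁻¹ * weight s lam n k j) •
        ((Y (k + 1) ω - m (X (k + 1) ω)) • G j ω) := by
    simp only [increment, hGdef, Complex.real_smul, Finset.mul_sum, Finset.sum_mul,
      Complex.ofReal_sum, Complex.ofReal_mul]
    exact Finset.sum_congr rfl fun j _ => by ring
  refine (integral_congr_ae (ae_of_all _ e)).trans ?_
  rw [integral_finsetSum _ fun j _ => ?_]
  · exact Finset.sum_eq_zero fun j _ => by rw [integral_smul, h0, smul_zero]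
  · exact Integrable.smul ((Real.sqrt n)⁻¹ * weight s lam n k j)
      (hU.smul_bdd 1 ((hG j).mono hle le_rfl).aestronglyMeasurable (ae_of_all _ (hG1 j)))

lemma norm_integral_increment_sq_sub_smul_phase_le (hY : ∀ t, Measurable (Y t))
    (hX : ∀ t, Measurable (X t)) {n k b : ℕ} {Γ : Fin KK × Fin KK → ℝ} {ε : ℝ}
    (hi : ∀ p : Fin KK × Fin KK, Integrable (fun ω =>
      (Y (k + 1) ω - m (X (k + 1) ω)) ^ 2 * orth (z p.1 ⊓ z p.2) (X (k + 1) ω)) P)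
    (hm : Measurable m)
    (hε : ∀ p : Fin KK × Fin KK, ∫ ω, |(P[fun ω => (Y (k + 1) ω - m (X (k + 1) ω)) ^ 2 *
      orth (z p.1 ⊓ z p.2) (X (k + 1) ω) - Γ p|sigPast Y X (k + 1 - b)]) ω| ∂P ≤ ε) (t : ℝ) :
    ‖∫ ω, (increment Y X m s lam z n k ω ^ 2 - ∑ p : Fin KK × Fin KK,
        (Real.sqrt n)⁻¹ ^ 2 * (weight s lam n k p.1 * weight s lam n k p.2) * Γ p) •
      phase (t * ∑ l ∈ Finset.range (k - b), increment Y X m s lam z n l ω) ∂P‖ ≤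
      (∑ p : Fin KK × Fin KK, |lam p.1| * |lam p.2|) * ε * (Real.sqrt n)⁻¹ ^ 2 := by
  set F : Ω → ℂ := fun ω =>
    phase (t * ∑ l ∈ Finset.range (k - b), increment Y X m s lam z n l ω) with hFdef
  have hF : Measurable[sigPast Y X (k + 1 - b)] F := by
    refine continuous_phase.measurable.comp (Measurable.const_mul
      (Finset.measurable_fun_sum _ fun l hl => ?_) _)
    have hl' : (l : ℤ) + 1 ≤ k + 1 - b := by
      have := Finset.mem_range.1 hl
      omega
    exact measurable_increment ((measurable_sigPast_response hl').sub
      (hm.comp (measurable_sigPast_covariate hl'))) (measurable_sigPast_covariate hl')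
  have hF1 (ω : Ω) : ‖F ω‖ ≤ 1 := (norm_phase _).le
  have hle := sigPast_le hY hX (k + 1 - b)
  set q : Fin KK × Fin KK → Ω → ℝ := fun p ω =>
    (Y (k + 1) ω - m (X (k + 1) ω)) ^ 2 * orth (z p.1 ⊓ z p.2) (X (k + 1) ω) - Γ p with hqdef
  have hq (p : Fin KK × Fin KK) : Integrable (q p) P := (hi p).sub (integrable_const _)
  have hqF (p : Fin KK × Fin KK) : ‖∫ ω, q p ω • F ω ∂P‖ ≤ ε :=
    (norm_integral_smul_le_integral_abs_condExp hle (hq p) hF.stronglyMeasurable hF1).trans (hε p)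
  have e (ω : Ω) : (increment Y X m s lam z n k ω ^ 2 - ∑ p : Fin KK × Fin KK,
        (Real.sqrt n)⁻¹ ^ 2 * (weight s lam n k p.1 * weight s lam n k p.2) * Γ p) • F ω =
      ∑ p : Fin KK × Fin KK, ((Real.sqrt n)⁻¹ ^ 2 *
        (weight s lam n k p.1 * weight s lam n k p.2)) • (q p ω • F ω) := by
    rw [increment_sq, ← Finset.sum_sub_distrib, Finset.sum_smul]
    refine Finset.sum_congr rfl fun p _ => ?_
    rw [smul_smul, ← mul_sub]
  refine (congrArg norm (integral_congr_ae (ae_of_all _ e))).trans_le ?_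
  rw [integral_finsetSum _ fun p _ => ?_]
  · refine (norm_sum_le _ _).trans ?_
    rw [Finset.sum_mul, Finset.sum_mul]
    refine Finset.sum_le_sum fun p _ => ?_
    rw [integral_smul, norm_smul, Real.norm_eq_abs, abs_mul, abs_mul,
      abs_of_nonneg (by positivity : 0 ≤ (Real.sqrt n)⁻¹ ^ 2)]
    calc (Real.sqrt n)⁻¹ ^ 2 * (|weight s lam n k p.1| * |weight s lam n k p.2|) *
          ‖∫ ω, q p ω • F ω ∂P‖
        ≤ (Real.sqrt n)⁻¹ ^ 2 * (|lam p.1| * |lam p.2|) * ε := by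
          have h1 : |weight s lam n k p.1| ≤ |lam p.1| := abs_weight_le n k p.1
          have h2 : |weight s lam n k p.2| ≤ |lam p.2| := abs_weight_le n k p.2
          exact mul_le_mul (mul_le_mul_of_nonneg_left
            (mul_le_mul h1 h2 (abs_nonneg _) (abs_nonneg _)) (by positivity)) (hqF p)
            (norm_nonneg _) (by positivity)
      _ = |lam p.1| * |lam p.2| * ε * (Real.sqrt n)⁻¹ ^ 2 := by ring
  · exact Integrable.smul ((Real.sqrt n)⁻¹ ^ 2 * (weight s lam n k p.1 * weight s lam n k p.2))
      ((hq p).smul_bdd 1 (hF.mono hle le_rfl).aestronglyMeasurable (ae_of_all _ hF1))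

end MartingaleDifference

lemma integrable_abs_pow_three_of_rpow {μ : Measure Ω} [IsFiniteMeasure μ] {U : Ω → ℝ}
    (hU : Measurable U) {q : ℝ} (hq : 3 ≤ q) (h : Integrable (fun ω => |U ω| ^ q) μ) :
    Integrable (fun ω => |U ω| ^ 3) μ := by
  refine ((integrable_const (1 : ℝ)).add h).mono' (by fun_prop) (ae_of_all _ fun ω => ?_)
  rw [Real.norm_eq_abs, abs_of_nonneg (by positivity)]
  change |U ω| ^ 3 ≤ 1 + |U ω| ^ q
  have h0 : 0 ≤ |U ω| ^ q := Real.rpow_nonneg (abs_nonneg _) q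
  rcases le_total |U ω| 1 with h1 | h1
  · exact (pow_le_one₀ (abs_nonneg _) h1).trans (by linarith)
  · have := Real.rpow_le_rpow_of_exponent_le h1 hq
    rw [show (3 : ℝ) = (3 : ℕ) by norm_num, Real.rpow_natCast] at this
    linarith

lemma integral_comp_pair_eq {P : Measure Ω} {Y : ℤ → Ω → ℝ} {X : ℤ → Ω → Fin d → ℝ}
    (hY : ∀ t, Measurable (Y t)) (hX : ∀ t, Measurable (X t))
    {ν : Measure (ℝ × (Fin d → ℝ))} {t : ℤ} (hlaw : P.map (fun ω => (Y t ω, X t ω)) = ν)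
    {h : ℝ × (Fin d → ℝ) → ℝ} (hh : Measurable h) :
    ∫ ω, h (Y t ω, X t ω) ∂P = ∫ x, h x ∂ν := by
  rw [← hlaw, integral_map ((hY t).prodMk (hX t)).aemeasurable hh.aestronglyMeasurable]

/-- **Theorem 3.1(ii), finite-dimensional part (via Cramér–Wold).** Under
assumptions (G) and (U) and under H0, every linear combination
`Σ_j λ_j T_n(s_j, z_j)` converges in distribution to
`N(0, Σ_{j,k} λ_j λ_k (s_j ∧ s_k) Σ(z_j ∧ z_k))`, where
`Σ(x) = ∫_{(-∞,x]} σ²(u) f(u) du` (and `N(0,0) = δ_0`).  Convergence in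
distribution is expressed via convergence of integrals of bounded continuous
functions. -/
theorem statement1
    {Ω : Type*} [MeasurableSpace Ω] {d : ℕ} (hd : 0 < d)
    (P : Measure Ω) [IsProbabilityMeasure P]
    (Y : ℤ → Ω → ℝ) (X : ℤ → Ω → Fin d → ℝ)
    (hY : ∀ t, Measurable (Y t)) (hX : ∀ t, Measurable (X t))
    -- H0: the conditional mean function is time-invariant, `Y_t = m(X_t) + U_t`
    -- with `U_t := Y_t - m(X_t)`; that `m` is the conditional mean is part of (U).
    (m : (Fin d → ℝ) → ℝ) (hm : Measurable m)
    -- (G) strict stationarity: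
    (hstat : ∀ (k : ℤ) (I : Finset ℤ),
      Measure.map (fun ω (i : I) => (Y (i : ℤ) ω, X (i : ℤ) ω)) P =
        Measure.map (fun ω (i : I) => (Y ((i : ℤ) + k) ω, X ((i : ℤ) + k) ω)) P)
    -- (G) geometric α-mixing, `α(t) = O(a^{-t})` for some `a > 1`:
    (a : ℝ) (ha : 1 < a)
    (hmix : (fun t : ℕ => alphaMix P Y X t) =O[atTop] fun t : ℕ => (a ^ t)⁻¹)
    -- (U):
    (γ : ℝ) (hγ : 0 < γ) (Q : ℕ) (hQeven : Even Q) (hQ : ((d : ℝ) + 1) * (2 + γ) < Q)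
    (σ2 c : (Fin d → ℝ) → ℝ) (hσ2 : Measurable σ2) (hc : Measurable c)
    (hmart : ∀ t : ℤ, P[fun ω => Y t ω - m (X t ω)|sigF Y X m t] =ᵐ[P] 0)
    (hUsq : ∀ t : ℤ, Integrable (fun ω => (Y t ω - m (X t ω)) ^ 2) P)
    (hcondvar : ∀ t : ℤ,
      P[fun ω => (Y t ω - m (X t ω)) ^ 2|MeasurableSpace.comap (X t) inferInstance]
        =ᵐ[P] fun ω => σ2 (X t ω))
    (hUQ : ∀ t : ℤ,
      Integrable (fun ω => |Y t ω - m (X t ω)| ^ ((Q : ℝ) * (2 + γ) / 2)) P)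
    (hcondmom : ∀ t : ℤ,
      P[fun ω => |Y t ω - m (X t ω)| ^ ((Q : ℝ) * (2 + γ) / 2)|
          MeasurableSpace.comap (X t) inferInstance] ≤ᵐ[P] fun ω => c (X t ω) ^ Q)
    (f : (Fin d → ℝ) → ℝ) (hf : Measurable f) (hf0 : ∀ x, 0 ≤ f x)
    (M : ℝ) (hM : (∫ u, cbar σ2 c Q u * f u) ≤ M)
    -- (M):
    (hXlaw : Measure.map (X 1) P =
      (volume : Measure (Fin d → ℝ)).withDensity fun x => ENNReal.ofReal (f x)) :
    ∀ (KK : ℕ) (s : Fin KK → ℝ), (∀ j, s j ∈ Icc (0 : ℝ) 1) →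
      ∀ (z : Fin KK → Fin d → ℝ) (lam : Fin KK → ℝ)
        (g : BoundedContinuousFunction ℝ ℝ),
        Tendsto
          (fun n : ℕ => ∫ ω, g (∑ j, lam j * Tn Y X m n (s j) (z j) ω) ∂P)
          atTop
          (𝓝 (∫ x, g x ∂(gaussianReal 0 (Real.toNNReal
            (∑ j, ∑ k, lam j * lam k * min (s j) (s k) *
              ∫ u in {u : Fin d → ℝ | u ≤ z j ⊓ z k}, σ2 u * f u))))) := by
  intro KK s hs z lam g
  have hξ (t : ℤ) : Measurable fun ω => (Y t ω, X t ω) := (hY t).prodMk (hX t)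
  set ν : Measure (ℝ × (Fin d → ℝ)) := P.map fun ω => (Y 1 ω, X 1 ω)
  have hνP : IsProbabilityMeasure ν := Measure.isProbabilityMeasure_map (hξ 1).aemeasurable
  have hlaw (t : ℤ) : P.map (fun ω => (Y t ω, X t ω)) = ν := map_pair_eq hY hX hstat t
  have hUm (t : ℤ) : Measurable fun ω => Y t ω - m (X t ω) := (hY t).sub (hm.comp (hX t))
  have hq3 : 3 ≤ (Q : ℝ) * (2 + γ) / 2 := by
    have h1 : (1 : ℝ) ≤ d := by exact_mod_cast hd
    nlinarith
  have hU3 (t : ℤ) : Integrable (fun ω => |Y t ω - m (X t ω)| ^ 3) P :=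
    integrable_abs_pow_three_of_rpow (hUm t) hq3 (hUQ t)
  have hU1 (t : ℤ) : Integrable (fun ω => Y t ω - m (X t ω)) P :=
    integrable_of_abs_pow_three (hUm t) (hU3 t)
  set κ : ℕ → ℝ := fun r => ∫ x, |x.1 - m x.2| ^ r ∂ν
  have hκU (r : ℕ) (t : ℤ) : ∫ ω, |Y t ω - m (X t ω)| ^ r ∂P = κ r :=
    integral_comp_pair_eq hY hX (hlaw t) (h := fun x => |x.1 - m x.2| ^ r) (by fun_prop)
  have hκ0 (r : ℕ) : 0 ≤ κ r := integral_nonneg fun x => by positivity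
  set h : Fin KK × Fin KK → ℝ × (Fin d → ℝ) → ℝ :=
    fun p x => (x.1 - m x.2) ^ 2 * orth (z p.1 ⊓ z p.2) x.2
  have hhm (p : Fin KK × Fin KK) : Measurable (h p) := by
    have := measurable_orth (z p.1 ⊓ z p.2)
    fun_prop
  have hhP (p : Fin KK × Fin KK) (t : ℤ) : Integrable (fun ω => h p (Y t ω, X t ω)) P :=
    (hUsq t).mul_bdd (c := 1) ((measurable_orth _).comp (hX t)).aestronglyMeasurable
      (ae_of_all _ fun ω => abs_orth_le_one _ _)
  have hhν (p : Fin KK × Fin KK) : Integrable (h p) ν :=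
    (integrable_map_measure (hhm p).aestronglyMeasurable (hξ 1).aemeasurable).2 (hhP p 1)
  set Γ : Fin KK × Fin KK → ℝ := fun p => ∫ x, h p x ∂ν
  have hΓeq (p : Fin KK × Fin KK) :
      Γ p = ∫ u in {u : Fin d → ℝ | u ≤ z p.1 ⊓ z p.2}, σ2 u * f u :=
    integral_sq_mul_orth (hY 1) (hX 1) hm (hUsq 1) hσ2 hf hf0 (hcondvar 1) hXlaw _
  set W : ℕ → ℕ → Ω → ℝ := increment Y X m s lam z with hWdef
  set cv : ℕ → ℕ → ℝ := fun n k => ∑ p : Fin KK × Fin KK,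
    (Real.sqrt n)⁻¹ ^ 2 * (weight s lam n k p.1 * weight s lam n k p.2) * Γ p with hcv
  have hW (n k : ℕ) : Measurable (W n k) := measurable_increment (hUm _) (hX _)
  have hcvW (n k : ℕ) : cv n k = ∫ ω, W n k ω ^ 2 ∂P := by
    simp only [hWdef, increment_sq]
    rw [integral_finsetSum _ fun p _ => (hhP p (k + 1)).const_mul _]
    refine Finset.sum_congr rfl fun p _ => ?_
    rw [integral_const_mul]
    congr 1
    exact (integral_comp_pair_eq hY hX (hlaw (k + 1)) (hhm p)).symm
  set L : ℝ := ∑ j, |lam j|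
  have hL0 : 0 ≤ L := Finset.sum_nonneg fun j _ => abs_nonneg _
  have hUpow (r : ℕ) (hr : r ∈ ({1, 2, 3} : Set ℕ)) (t : ℤ) :
      Integrable (fun ω => |Y t ω - m (X t ω)| ^ r) P := by
    rcases hr with rfl | rfl | rfl
    · simpa using (hU1 t).abs
    · simpa using hUsq t
    · exact hU3 t
  have hWle (r n k : ℕ) (ω : Ω) : |W n k ω| ^ r ≤
      (Real.sqrt n)⁻¹ ^ r * L ^ r * |Y (k + 1) ω - m (X (k + 1) ω)| ^ r := by
    rw [← mul_pow, ← mul_pow, mul_assoc]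
    exact pow_le_pow_left₀ (abs_nonneg _) (abs_increment_le n k ω) r
  have hWpow (r : ℕ) (hr : r ∈ ({1, 2, 3} : Set ℕ)) (n k : ℕ) :
      Integrable (fun ω => |W n k ω| ^ r) P :=
    ((hUpow r hr (k + 1)).const_mul _).mono' (((hW n k).abs.pow_const r).aestronglyMeasurable)
      (ae_of_all _ fun ω => by
        rw [Real.norm_eq_abs, abs_of_nonneg (by positivity)]
        exact hWle r n k ω)
  set C : ℝ := L ^ 1 * κ 1 + L ^ 2 * κ 2 + L ^ 3 * κ 3
  have hWC (r : ℕ) (hr : r ∈ ({1, 2, 3} : Set ℕ)) (n k : ℕ) :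
      ∫ ω, |W n k ω| ^ r ∂P ≤ C * (Real.sqrt n)⁻¹ ^ r := by
    have hCr : L ^ r * κ r ≤ C := by
      have h1 : 0 ≤ L ^ 1 * κ 1 := mul_nonneg (pow_nonneg hL0 _) (hκ0 _)
      have h2 : 0 ≤ L ^ 2 * κ 2 := mul_nonneg (pow_nonneg hL0 _) (hκ0 _)
      have h3 : 0 ≤ L ^ 3 * κ 3 := mul_nonneg (pow_nonneg hL0 _) (hκ0 _)
      rcases hr with rfl | rfl | rfl <;> linarith
    calc ∫ ω, |W n k ω| ^ r ∂P
        ≤ ∫ ω, (Real.sqrt n)⁻¹ ^ r * L ^ r * |Y (k + 1) ω - m (X (k + 1) ω)| ^ r ∂P :=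
          integral_mono (hWpow r hr n k) ((hUpow r hr (k + 1)).const_mul _) (hWle r n k)
      _ = L ^ r * κ r * (Real.sqrt n)⁻¹ ^ r := by
          rw [integral_const_mul, hκU]
          ring
      _ ≤ C * (Real.sqrt n)⁻¹ ^ r := by gcongr
  have hlag (ε : ℝ) (hε : 0 < ε) : ∃ b₀ : ℕ, ∀ b ≥ b₀, ∀ p : Fin KK × Fin KK, ∀ i : ℤ,
      ∫ ω, |(P[fun ω => h p (Y i ω, X i ω) - Γ p|sigPast Y X (i - b)]) ω| ∂P ≤ ε := by
    have hα : Tendsto (fun b : ℕ => 2 * alphaMix P Y X b) atTop (𝓝 0) := by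
      have h0 : Tendsto (fun t : ℕ => (a ^ t)⁻¹) atTop (𝓝 0) :=
        (tendsto_pow_atTop_atTop_of_one_lt ha).inv_tendsto_atTop
      simpa using (hmix.trans_tendsto h0).const_mul 2
    have hB : ∀ ε > 0, ∃ b₀ : ℕ, ∀ b ≥ b₀, ∀ i (B : Set (ℝ × (Fin d → ℝ))), MeasurableSet B →
        ∫ ω, |(P[fun ω => B.indicator (fun _ => (1 : ℝ)) (Y i ω, X i ω) - ν.real B|
          sigPast Y X (i - b)]) ω| ∂P ≤ ε := by
      intro ε hε
      obtain ⟨b₀, hb₀⟩ := eventually_atTop.1 (hα.eventually (gt_mem_nhds hε))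
      refine ⟨b₀, fun b hb i B hB => ?_⟩
      rw [← hlaw i]
      exact (integral_abs_condExp_indicator_le hY hX b hB).trans (hb₀ b hb).le
    choose b₀ hb₀ using fun p => exists_forall_integral_abs_condExp_le
      (fun i => hξ i) hlaw (fun b i => sigPast Y X (i - b)) hB (hhν p) ε hε
    exact ⟨Finset.univ.sup b₀, fun b hb p =>
      hb₀ p b ((Finset.le_sup (Finset.mem_univ p)).trans hb)⟩
  set v : ℝ := ∑ j, ∑ k, lam j * lam k * min (s j) (s k) *
    ∫ u in {u : Fin d → ℝ | u ≤ z j ⊓ z k}, σ2 u * f u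
  have hv : Tendsto (fun n => ∑ k ∈ Finset.range n, cv n k) atTop (𝓝 v) := by
    have hlim : Tendsto (fun n : ℕ => ∑ p : Fin KK × Fin KK, (∑ k ∈ Finset.range n,
        (Real.sqrt n)⁻¹ ^ 2 * (weight s lam n k p.1 * weight s lam n k p.2)) * Γ p) atTop
        (𝓝 (∑ p : Fin KK × Fin KK, lam p.1 * lam p.2 * min (s p.1) (s p.2) * Γ p)) :=
      tendsto_finsetSum _ fun p _ => (tendsto_sum_weight_mul_weight hs p).mul_const _
    have hv' : v = ∑ p : Fin KK × Fin KK, lam p.1 * lam p.2 * min (s p.1) (s p.2) * Γ p := by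
      simp only [hΓeq]
      rw [Fintype.sum_prod_type]
    rw [hv']
    refine hlim.congr fun n => ?_
    simp only [hcv, Finset.sum_mul]
    exact Finset.sum_comm
  have hcv0 (n k : ℕ) : 0 ≤ cv n k := (hcvW n k).symm ▸ integral_nonneg fun ω => sq_nonneg _
  have hv0 : 0 ≤ v := ge_of_tendsto' hv fun n => Finset.sum_nonneg fun k _ => hcv0 n k
  refine (tendsto_integral_of_tendsto_phase
    (Z := fun n ω => ∑ k ∈ Finset.range n, W n k ω)
    (fun n => Finset.measurable_fun_sum _ fun k _ => hW n k) hv0 (fun t => ?_) g).congr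
    fun n => integral_congr_ae (ae_of_all _ fun ω => congrArg g (sum_mul_Tn_eq hs n ω).symm)
  refine tendsto_integral_phase_sum hW (hWpow 3 (by simp)) (C := C) hcv0 (fun n k => ?_)
    (fun n k => by simpa using hWC 1 (by simp) n k) (hWC 3 (by simp)) t
    (fun n k => integral_increment_smul_phase_eq_zero hY hX hm (hU1 _) (hmart _) t)
    (fun ε hε => ?_) hv
  · simpa [hcvW] using hWC 2 (by simp) n k
  · set S : ℝ := ∑ p : Fin KK × Fin KK, |lam p.1| * |lam p.2| with hS
    have hS0 : 0 ≤ S := Finset.sum_nonneg fun p _ => by positivity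
    obtain ⟨b, hb⟩ := hlag (ε / (S + 1)) (by positivity)
    refine ⟨b, fun n k => (norm_integral_increment_sq_sub_smul_phase_le hY hX
      (fun p => hhP p (k + 1)) hm (fun p => hb b le_rfl p (k + 1)) t).trans ?_⟩
    refine mul_le_mul_of_nonneg_right ?_ (by positivity)
    rw [← hS, mul_div_assoc', div_le_iff₀ (by positivity)]
    nlinarith

end ChangePointDetection
end
end

section
/- Lemma A.4 (Lemma 1): Under the assumptions of Theorem 3.1(i) ((G), (U), (M), (J), (F1), (F2), (K), (B1), (B2)) and under the null hypothesis H0, the process A_{n2}(s,z) := n^{−1/2} Σ_{i=1}^{⌊ns⌋} U_i ω_n(X_i) 1{X_i ≤ z} satisfies A_{n2}(s,z) = T_n(s,z) + o_P(1) uniformly in s ∈ [0,1] and z ∈ ℝ^d; equivalently, for every ε > 0, P( sup_{s∈[0,1], z∈ℝ^d} | n^{−1/2} Σ_{i=1}^{⌊ns⌋} U_i 1{X_i ≤ z} 1{X_i ∉ [−c_n,c_n]^d} | > ε ) → 0 as n → ∞. -/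
open MeasureTheory ProbabilityTheory Filter Set Topology Asymptotics
open scoped ENNReal

noncomputable section

namespace ChangePointDetection

variable {Ω : Type*} [MeasurableSpace Ω] {d : ℕ}

lemma integrable_pow_four {P : Measure Ω} {g : Ω → ℝ} (hg : MemLp g 4 P) :
    Integrable (fun ω => g ω ^ 4) P := by
  refine (hg.integrable_norm_pow (p := 4) (by norm_num)).congr (ae_of_all _ fun ω => ?_)
  exact (show Even 4 by decide).pow_abs (g ω)

/-- Martingale transforms of centred differences are centred, conditionally on the past. -/
lemma condExp_mul_eq_zero {P : Measure Ω} {m₀ : MeasurableSpace Ω} {g ξ : Ω → ℝ}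
    (hg : StronglyMeasurable[m₀] g) (hgξ : Integrable (fun ω => g ω * ξ ω) P)
    (hξ : Integrable ξ P) (h0 : P[ξ|m₀] =ᵐ[P] 0) :
    P[fun ω => g ω * ξ ω|m₀] =ᵐ[P] 0 := by
  filter_upwards [condExp_mul_of_stronglyMeasurable_left (f := g) (g := ξ) hg hgξ hξ, h0]
    with ω h1 h2
  refine h1.trans ?_
  simp [h2]

/-- Burkholder's inequality for fourth moments of real martingales. -/
theorem integral_sum_pow_four_le {P : Measure Ω} [IsProbabilityMeasure P]
    (𝒢 : Filtration ℕ ‹MeasurableSpace Ω›) (ξ : ℕ → Ω → ℝ)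
    (hadapt : ∀ i, StronglyMeasurable[𝒢 (i + 1)] (ξ i))
    (hL4 : ∀ i, MemLp (ξ i) 4 P) (hcond : ∀ i, P[ξ i|𝒢 i] =ᵐ[P] 0) (n : ℕ) :
    ∫ ω, (∑ i ∈ Finset.range n, ξ i ω) ^ 4 ∂P ≤
      87 * ∫ ω, (∑ i ∈ Finset.range n, ξ i ω ^ 2) ^ 2 ∂P := by
  set S : ℕ → Ω → ℝ := fun k ω => ∑ i ∈ Finset.range k, ξ i ω with hS
  set V : ℕ → Ω → ℝ := fun k ω => ∑ i ∈ Finset.range k, ξ i ω ^ 2 with hV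
  have hξ4 : ∀ i, Integrable (fun ω => ξ i ω ^ 4) P := fun i =>
    integrable_pow_four (hL4 i)
  have hS4 : ∀ k, Integrable (fun ω => S k ω ^ 4) P := fun k =>
    integrable_pow_four (memLp_finsetSum _ fun i _ => hL4 i)
  have hV2 : ∀ k, Integrable (fun ω => V k ω ^ 2) P := fun k => by
    have : MemLp (V k) 2 P := memLp_finsetSum _ fun i _ => by
      refine (memLp_two_iff_integrable_sq ((hL4 i).1.pow 2)).2 ?_
      refine (hξ4 i).congr (ae_of_all _ fun ω => ?_)
      simp only [Pi.pow_apply]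
      ring
    exact this.integrable_sq
  have hSm : ∀ k, StronglyMeasurable[𝒢 k] (S k) := fun k =>
    Finset.stronglyMeasurable_fun_sum _ fun i hi =>
      (hadapt i).mono (𝒢.mono (Finset.mem_range.1 hi))
  have hVm : ∀ k, StronglyMeasurable[𝒢 k] (V k) := fun k =>
    Finset.stronglyMeasurable_fun_sum _ fun i hi =>
      ((hadapt i).mono (𝒢.mono (Finset.mem_range.1 hi))).pow 2
  set g : ℕ → Ω → ℝ := fun k ω => 4 * S k ω ^ 3 - 14 * S k ω * V k ω with hg
  have hgm : ∀ k, StronglyMeasurable[𝒢 k] (g k) := fun k =>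
    (((hSm k).pow 3).const_mul 4).sub (((hSm k).const_mul 14).mul (hVm k))
  have hgξ : ∀ k, Integrable (fun ω => g k ω * ξ k ω) P := fun k => by
    refine ((((hS4 k).add (hξ4 k)).add (hV2 k)).const_mul 18).mono'
      ((((hgm k).mono (𝒢.le k)).aestronglyMeasurable).mul (hL4 k).1) (ae_of_all _ fun ω => ?_)
    simp only [Pi.add_apply, hg]
    rw [Real.norm_eq_abs, abs_le]
    generalize S k ω = s
    generalize V k ω = v
    generalize ξ k ω = x
    constructor <;>
    nlinarith [sq_nonneg (s ^ 2 - x ^ 2), sq_nonneg (s ^ 2 + s * x), sq_nonneg (s ^ 2 - s * x),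
      sq_nonneg (s * x - v), sq_nonneg (s * x + v), sq_nonneg (s ^ 2), sq_nonneg (x ^ 2),
      sq_nonneg (s * x), sq_nonneg v]
  have hzero : ∀ k, ∫ ω, g k ω * ξ k ω ∂P = 0 := fun k => by
    rw [← integral_condExp (𝒢.le k)]
    rw [integral_congr_ae (condExp_mul_eq_zero (hgm k) (hgξ k)
      ((hL4 k).integrable (by norm_num)) (hcond k))]
    simp
  have key : ∀ k ω, S k ω ^ 4 - 7 * S k ω ^ 2 * V k ω - 19 * V k ω ^ 2 ≤
      ∑ i ∈ Finset.range k, g i ω * ξ i ω := by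
    intro k ω
    induction k with
    | zero => simp [hS, hV]
    | succ k ih =>
      have hVk : 0 ≤ V k ω := Finset.sum_nonneg fun i _ => sq_nonneg _
      have e1 : S (k + 1) ω = S k ω + ξ k ω := Finset.sum_range_succ _ _
      have e2 : V (k + 1) ω = V k ω + ξ k ω ^ 2 := Finset.sum_range_succ _ _
      rw [Finset.sum_range_succ, e1, e2]
      simp only [hg] at ih ⊢
      generalize S k ω = s at *
      generalize V k ω = v at *
      generalize ξ k ω = x at *
      nlinarith [sq_nonneg (s * x + 5 * x ^ 2), mul_nonneg hVk (sq_nonneg x)]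
  have hfin : ∀ ω, S n ω ^ 4 ≤
      87 * V n ω ^ 2 + 2 * ∑ i ∈ Finset.range n, g i ω * ξ i ω := fun ω => by
    nlinarith [key n ω, sq_nonneg (S n ω ^ 2 - 7 * V n ω)]
  have hsum : Integrable (fun ω => ∑ i ∈ Finset.range n, g i ω * ξ i ω) P :=
    integrable_finsetSum _ fun i _ => hgξ i
  calc ∫ ω, S n ω ^ 4 ∂P
      ≤ ∫ ω, (87 * V n ω ^ 2 + 2 * ∑ i ∈ Finset.range n, g i ω * ξ i ω) ∂P :=
        integral_mono (hS4 n) (((hV2 n).const_mul 87).add (hsum.const_mul 2)) hfin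
    _ = 87 * ∫ ω, V n ω ^ 2 ∂P := by
        rw [integral_add ((hV2 n).const_mul 87) (hsum.const_mul 2), integral_const_mul,
          integral_const_mul, integral_finsetSum _ fun i _ => hgξ i]
        simp [hzero]

/-- Maximal version of Burkholder's fourth moment inequality. -/
theorem measure_exists_le_abs_sum_le {P : Measure Ω} [IsProbabilityMeasure P]
    (𝒢 : Filtration ℕ ‹MeasurableSpace Ω›) (ξ : ℕ → Ω → ℝ)
    (hadapt : ∀ i, StronglyMeasurable[𝒢 (i + 1)] (ξ i))
    (hL4 : ∀ i, MemLp (ξ i) 4 P) (hcond : ∀ i, P[ξ i|𝒢 i] =ᵐ[P] 0) (n : ℕ)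
    {t : ℝ} (ht : 0 < t) :
    P {ω | ∃ k ≤ n, t ≤ |∑ i ∈ Finset.range k, ξ i ω|} ≤
      ENNReal.ofReal (87 * (∫ ω, (∑ i ∈ Finset.range n, ξ i ω ^ 2) ^ 2 ∂P) / t ^ 4) := by
  set S : ℕ → Ω → ℝ := fun k ω => ∑ i ∈ Finset.range k, ξ i ω with hS
  have hξ4 : ∀ i, Integrable (fun ω => ξ i ω ^ 4) P := fun i =>
    integrable_pow_four (hL4 i)
  have hS4 : ∀ k, Integrable (fun ω => S k ω ^ 4) P := fun k =>
    integrable_pow_four (memLp_finsetSum _ fun i _ => hL4 i)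
  have hSm : ∀ k, StronglyMeasurable[𝒢 k] (S k) := fun k =>
    Finset.stronglyMeasurable_fun_sum _ fun i hi =>
      (hadapt i).mono (𝒢.mono (Finset.mem_range.1 hi))
  have hgm : ∀ k, StronglyMeasurable[𝒢 k] fun ω => 4 * S k ω ^ 3 := fun k =>
    ((hSm k).pow 3).const_mul 4
  have hgξ : ∀ k, Integrable (fun ω => 4 * S k ω ^ 3 * ξ k ω) P := fun k => by
    refine (((hS4 k).add (hξ4 k)).const_mul 4).mono'
      ((((hgm k).mono (𝒢.le k)).aestronglyMeasurable).mul (hL4 k).1) (ae_of_all _ fun ω => ?_)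
    simp only [Pi.add_apply]
    rw [Real.norm_eq_abs, abs_le]
    generalize S k ω = s
    generalize ξ k ω = x
    constructor <;>
    nlinarith [sq_nonneg (s ^ 2 - x ^ 2), sq_nonneg (s ^ 2 + s * x), sq_nonneg (s ^ 2 - s * x),
      sq_nonneg (s ^ 2), sq_nonneg (x ^ 2), sq_nonneg (s * x)]
  have hsub : Submartingale (fun k ω => S k ω ^ 4) 𝒢 P := by
    refine submartingale_nat (fun k => (hSm k).pow 4) hS4 fun k => ?_
    have hle : (fun ω => S k ω ^ 4 + 4 * S k ω ^ 3 * ξ k ω) ≤ᵐ[P] fun ω => S (k + 1) ω ^ 4 := by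
      refine ae_of_all _ fun ω => ?_
      have e1 : S (k + 1) ω = S k ω + ξ k ω := Finset.sum_range_succ _ _
      simp only [e1]
      generalize S k ω = s
      generalize ξ k ω = x
      nlinarith [sq_nonneg (2 * s * x + x ^ 2), sq_nonneg (s * x)]
    have h1 := condExp_mono (m := 𝒢 k) ((hS4 k).add (hgξ k)) (hS4 (k + 1)) hle
    have h2 := condExp_add (m := 𝒢 k) (hS4 k) (hgξ k)
    have h3 := condExp_mul_eq_zero (hgm k) (hgξ k) ((hL4 k).integrable (by norm_num)) (hcond k)
    have h4 := condExp_of_stronglyMeasurable (𝒢.le k) ((hSm k).pow 4) (hS4 k)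
    filter_upwards [h1, h2, h3] with ω a1 a2 a3
    rw [Pi.add_apply, a3] at a2
    have a4 := congrFun h4 ω
    simp only [Pi.zero_apply, add_zero] at a2
    calc S k ω ^ 4 = _ := a4.symm
      _ = _ := a2.symm
      _ ≤ _ := a1
  have hmax := maximal_ineq hsub (fun k ω => by positivity) (ε := (t ^ 4).toNNReal) n
  have hpos : 0 < t ^ 4 := by positivity
  have hset : {ω | ∃ k ≤ n, t ≤ |S k ω|} ⊆ {ω | ((t ^ 4).toNNReal : ℝ) ≤
      (Finset.range (n + 1)).sup' Finset.nonempty_range_add_one fun k => S k ω ^ 4} := by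
    rintro ω ⟨k, hk, hkt⟩
    rw [mem_ofPred_eq, Real.coe_toNNReal _ hpos.le]
    refine le_trans ?_ (Finset.le_sup' (fun k => S k ω ^ 4)
      (Finset.mem_range.2 (Nat.lt_succ_of_le hk)))
    calc t ^ 4 ≤ |S k ω| ^ 4 := by gcongr
      _ = S k ω ^ 4 := by rw [← abs_pow]; exact abs_of_nonneg (by positivity)
  refine (measure_mono hset).trans ?_
  rw [ENNReal.ofReal_div_of_pos hpos, ENNReal.le_div_iff_mul_le
    (Or.inl (by simpa using hpos)) (Or.inl ENNReal.ofReal_ne_top), mul_comm]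
  refine hmax.trans (ENNReal.ofReal_le_ofReal ?_)
  refine (setIntegral_le_integral (hS4 n) (ae_of_all _ fun ω => by positivity)).trans ?_
  exact integral_sum_pow_four_le 𝒢 ξ hadapt hL4 hcond n

lemma lintegral_ofReal_le_of_meas_lt_le {μ₁ μ₂ : Measure Ω} {g : Ω → ℝ} (hg : Measurable g)
    (hg0 : ∀ ω, 0 ≤ g ω) {M : ℝ} (hgM : ∀ ω, g ω ≤ M) {c : ℝ≥0∞}
    (h : ∀ t, μ₁ {ω | t < g ω} ≤ μ₂ {ω | t < g ω} + c) :
    ∫⁻ ω, ENNReal.ofReal (g ω) ∂μ₁ ≤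
      ∫⁻ ω, ENNReal.ofReal (g ω) ∂μ₂ + c * ENNReal.ofReal M := by
  rw [lintegral_eq_lintegral_meas_lt _ (ae_of_all _ hg0) hg.aemeasurable,
    lintegral_eq_lintegral_meas_lt _ (ae_of_all _ hg0) hg.aemeasurable]
  have hle : ∀ t ∈ Ioi (0 : ℝ), μ₁ {ω | t < g ω} ≤
      μ₂ {ω | t < g ω} + (Iio M).indicator (fun _ => c) t := by
    intro t _
    by_cases htM : t < M
    · simpa [htM] using h t
    · have : {ω | t < g ω} = ∅ := by
        ext ω
        simpa using (hgM ω).trans (not_lt.1 htM)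
      simp [this]
  calc ∫⁻ t in Ioi 0, μ₁ {ω | t < g ω}
      ≤ ∫⁻ t in Ioi 0, (μ₂ {ω | t < g ω} + (Iio M).indicator (fun _ => c) t) :=
        setLIntegral_mono' measurableSet_Ioi hle
    _ = (∫⁻ t in Ioi 0, μ₂ {ω | t < g ω}) + c * ENNReal.ofReal M := by
        rw [lintegral_add_right _ (measurable_const.indicator measurableSet_Iio),
          lintegral_indicator measurableSet_Iio, Measure.restrict_restrict measurableSet_Iio,
          setLIntegral_const, Iio_inter_Ioi, Real.volume_Ioo, sub_zero]

/-- Covariance inequality for bounded nonnegative functions under strong mixing. -/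
theorem integral_mul_le_of_mixing {P : Measure Ω} [IsProbabilityMeasure P] {g₁ g₂ : Ω → ℝ}
    (hg₁ : Measurable g₁) (hg₂ : Measurable g₂) (h₁ : ∀ ω, 0 ≤ g₁ ω) (h₂ : ∀ ω, 0 ≤ g₂ ω)
    {M : ℝ} (hM : 0 ≤ M) (h₁M : ∀ ω, g₁ ω ≤ M) (h₂M : ∀ ω, g₂ ω ≤ M) {α : ℝ} (hα : 0 ≤ α)
    (hmix : ∀ s t, P ({ω | s < g₁ ω} ∩ {ω | t < g₂ ω}) ≤
      P {ω | s < g₁ ω} * P {ω | t < g₂ ω} + ENNReal.ofReal α) :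
    ∫ ω, g₁ ω * g₂ ω ∂P ≤ (∫ ω, g₁ ω ∂P) * (∫ ω, g₂ ω ∂P) + α * M ^ 2 := by
  have hm₁ : ∀ s, MeasurableSet {ω | s < g₁ ω} := fun s => measurableSet_lt measurable_const hg₁
  have hm₂ : ∀ s, MeasurableSet {ω | s < g₂ ω} := fun s => measurableSet_lt measurable_const hg₂
  have hi₁ : Integrable g₁ P := Integrable.of_bound hg₁.aestronglyMeasurable M
    (ae_of_all _ fun ω => by rw [Real.norm_of_nonneg (h₁ ω)]; exact h₁M ω)
  have hi₂ : Integrable g₂ P := Integrable.of_bound hg₂.aestronglyMeasurable M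
    (ae_of_all _ fun ω => by rw [Real.norm_of_nonneg (h₂ ω)]; exact h₂M ω)
  have hi₁₂ : Integrable (fun ω => g₁ ω * g₂ ω) P :=
    hi₂.bdd_mul hg₁.aestronglyMeasurable
      (ae_of_all _ fun ω => by rw [Real.norm_of_nonneg (h₁ ω)]; exact h₁M ω)
  have stepA : ∀ s, ∫⁻ ω in {ω | s < g₁ ω}, ENNReal.ofReal (g₂ ω) ∂P ≤
      P {ω | s < g₁ ω} * ∫⁻ ω, ENNReal.ofReal (g₂ ω) ∂P +
        ENNReal.ofReal α * ENNReal.ofReal M := by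
    intro s
    have := lintegral_ofReal_le_of_meas_lt_le (μ₁ := P.restrict {ω | s < g₁ ω})
      (μ₂ := P {ω | s < g₁ ω} • P) hg₂ h₂ h₂M (c := ENNReal.ofReal α) fun t => by
        rw [Measure.restrict_apply (hm₂ t), Measure.smul_apply, smul_eq_mul, inter_comm]
        exact hmix s t
    simpa [lintegral_smul_measure] using this
  have stepB := lintegral_ofReal_le_of_meas_lt_le
      (μ₁ := P.withDensity fun ω => ENNReal.ofReal (g₂ ω))
      (μ₂ := (∫⁻ ω, ENNReal.ofReal (g₂ ω) ∂P) • P) hg₁ h₁ h₁M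
      (c := ENNReal.ofReal α * ENNReal.ofReal M) fun s => by
        rw [withDensity_apply _ (hm₁ s), Measure.smul_apply, smul_eq_mul, mul_comm (∫⁻ _, _ ∂P)]
        exact stepA s
  rw [lintegral_withDensity_eq_lintegral_mul _ hg₂.ennreal_ofReal hg₁.ennreal_ofReal,
    lintegral_smul_measure] at stepB
  have e₁₂ : ∫⁻ ω, ((fun ω => ENNReal.ofReal (g₂ ω)) * fun ω => ENNReal.ofReal (g₁ ω)) ω ∂P =
      ENNReal.ofReal (∫ ω, g₁ ω * g₂ ω ∂P) := by
    rw [ofReal_integral_eq_lintegral_ofReal hi₁₂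
      (ae_of_all _ fun ω => mul_nonneg (h₁ ω) (h₂ ω))]
    refine lintegral_congr fun ω => ?_
    rw [Pi.mul_apply, ← ENNReal.ofReal_mul (h₂ ω), mul_comm]
  rw [e₁₂, ← ofReal_integral_eq_lintegral_ofReal hi₁ (ae_of_all _ h₁),
    ← ofReal_integral_eq_lintegral_ofReal hi₂ (ae_of_all _ h₂), smul_eq_mul,
    ← ENNReal.ofReal_mul (integral_nonneg h₂), ← ENNReal.ofReal_mul hα,
    ← ENNReal.ofReal_mul (mul_nonneg hα hM),
    ← ENNReal.ofReal_add (mul_nonneg (integral_nonneg h₂) (integral_nonneg h₁))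
      (mul_nonneg (mul_nonneg hα hM) hM)] at stepB
  have := (ENNReal.ofReal_le_ofReal_iff (add_nonneg
    (mul_nonneg (integral_nonneg h₂) (integral_nonneg h₁))
      (mul_nonneg (mul_nonneg hα hM) hM))).1 stepB
  linarith

/-- Second moment bound for sums of nonnegative weakly dependent variables. -/
theorem integral_sq_sum_le_of_mixing {P : Measure Ω} [IsProbabilityMeasure P]
    {η : ℕ → Ω → ℝ} (hη : ∀ i, Measurable (η i)) (hη0 : ∀ i ω, 0 ≤ η i ω)
    (hint : ∀ i, Integrable (fun ω => η i ω ^ 3) P) {v : ℝ}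
    (h1 : ∀ i, ∫ ω, η i ω ∂P ≤ v) (h2 : ∀ i, ∫ ω, η i ω ^ 2 ∂P ≤ v)
    (h3 : ∀ i, ∫ ω, η i ω ^ 3 ∂P ≤ v) {α : ℝ} (hα : 0 ≤ α) {r : ℕ}
    (hmix : ∀ i j, i + r ≤ j → ∀ A B : Set ℝ, MeasurableSet A → MeasurableSet B →
      P (η i ⁻¹' A ∩ η j ⁻¹' B) ≤ P (η i ⁻¹' A) * P (η j ⁻¹' B) + ENNReal.ofReal α)
    {b : ℝ} (hb : 0 < b) (n : ℕ) :
    ∫ ω, (∑ i ∈ Finset.range n, η i ω) ^ 2 ∂P ≤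
      n ^ 2 * (v ^ 2 + α * b ^ 2 + 2 * v / b) + 4 * n * r * v := by
  have hv : 0 ≤ v := (integral_nonneg (hη0 0)).trans (h1 0)
  have hint2 : ∀ i, Integrable (fun ω => η i ω ^ 2) P := fun i => by
    refine ((hint i).add (integrable_const 1)).mono' ((hη i).pow_const 2).aestronglyMeasurable
      (ae_of_all _ fun ω => ?_)
    rw [Real.norm_of_nonneg (sq_nonneg _)]
    simp only [Pi.add_apply]
    nlinarith [hη0 i ω, mul_nonneg (hη0 i ω) (sq_nonneg (η i ω - 1)), sq_nonneg (η i ω - 1)]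
  have hint1 : ∀ i, Integrable (η i) P := fun i => by
    refine ((hint2 i).add (integrable_const 1)).mono' (hη i).aestronglyMeasurable
      (ae_of_all _ fun ω => ?_)
    rw [Real.norm_of_nonneg (hη0 i ω)]
    simp only [Pi.add_apply]
    nlinarith [sq_nonneg (η i ω - 1), hη0 i ω]
  have hprod : ∀ i j, Integrable (fun ω => η i ω * η j ω) P := fun i j => by
    refine ((hint2 i).add (hint2 j)).mono' ((hη i).mul (hη j)).aestronglyMeasurable
      (ae_of_all _ fun ω => ?_)
    rw [Real.norm_of_nonneg (mul_nonneg (hη0 i ω) (hη0 j ω))]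
    simp only [Pi.add_apply]
    nlinarith [sq_nonneg (η i ω - η j ω), mul_nonneg (hη0 i ω) (hη0 j ω)]
  have hcrude : ∀ i j, ∫ ω, η i ω * η j ω ∂P ≤ 2 * v := fun i j => by
    have : ∫ ω, η i ω * η j ω ∂P ≤ ∫ ω, (η i ω ^ 2 + η j ω ^ 2) ∂P :=
      integral_mono (hprod i j) ((hint2 i).add (hint2 j)) fun ω => by
        nlinarith [sq_nonneg (η i ω - η j ω), mul_nonneg (hη0 i ω) (hη0 j ω)]
    rw [integral_add (hint2 i) (hint2 j)] at this
    linarith [h2 i, h2 j]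
  have hfar : ∀ i j, i + r ≤ j →
      ∫ ω, η i ω * η j ω ∂P ≤ v ^ 2 + α * b ^ 2 + 2 * v / b := by
    intro i j hij
    set φ : ℝ → ℝ := (Iic b).indicator id with hφ
    have hφm : Measurable φ := measurable_id.indicator measurableSet_Iic
    have hφ0 : ∀ x, 0 ≤ x → 0 ≤ φ x := fun x hx => by
      by_cases hx' : x ≤ b <;> simp [hφ, hx', hx]
    have hφb : ∀ x, φ x ≤ b := fun x => by
      by_cases hx : x ≤ b <;> simp [hφ, hx, hb.le]
    have hφle : ∀ x, 0 ≤ x → φ x ≤ x := fun x hx => by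
      by_cases hx' : x ≤ b <;> simp [hφ, hx', hx]
    have hcov := integral_mul_le_of_mixing (P := P) (hφm.comp (hη i)) (hφm.comp (hη j))
      (fun ω => hφ0 _ (hη0 i ω)) (fun ω => hφ0 _ (hη0 j ω)) hb.le (fun ω => hφb _)
      (fun ω => hφb _) hα fun s t => hmix i j hij (φ ⁻¹' Ioi s) (φ ⁻¹' Ioi t)
        (hφm measurableSet_Ioi) (hφm measurableSet_Ioi)
    have hφint : ∀ i, Integrable (φ ∘ η i) P := fun i =>
      (hint1 i).mono' (hφm.comp (hη i)).aestronglyMeasurable (ae_of_all _ fun ω => by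
        rw [Function.comp, Real.norm_of_nonneg (hφ0 _ (hη0 i ω))]
        exact hφle _ (hη0 i ω))
    have hφv : ∀ i, ∫ ω, (φ ∘ η i) ω ∂P ≤ v := fun i =>
      (integral_mono (hφint i) (hint1 i) fun ω => hφle _ (hη0 i ω)).trans (h1 i)
    have hφv0 : ∀ i, 0 ≤ ∫ ω, (φ ∘ η i) ω ∂P := fun i =>
      integral_nonneg fun ω => hφ0 _ (hη0 i ω)
    have hφprod : Integrable (fun ω => (φ ∘ η i) ω * (φ ∘ η j) ω) P :=
      (hprod i j).mono' ((hφm.comp (hη i)).mul (hφm.comp (hη j))).aestronglyMeasurable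
        (ae_of_all _ fun ω => by
          rw [Function.comp, Function.comp,
            Real.norm_of_nonneg (mul_nonneg (hφ0 _ (hη0 i ω)) (hφ0 _ (hη0 j ω)))]
          exact mul_le_mul (hφle _ (hη0 i ω)) (hφle _ (hη0 j ω)) (hφ0 _ (hη0 j ω)) (hη0 i ω))
    have hpt : ∀ x y : ℝ, 0 ≤ x → 0 ≤ y → x * y ≤ φ x * φ y + (x ^ 3 + y ^ 3) / b := by
      have aux : ∀ x y : ℝ, 0 ≤ x → x ≤ y → b < y → x * y ≤ (x ^ 3 + y ^ 3) / b := by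
        intro x y hx hxy hy
        rw [le_div_iff₀ hb]
        have hy0 := hx.trans hxy
        have : x * y * b ≤ y * y * y := by gcongr
        nlinarith [pow_nonneg hx 3]
      intro x y hx hy
      by_cases hxb : x ≤ b
      · by_cases hyb : y ≤ b
        · have : 0 ≤ (x ^ 3 + y ^ 3) / b := by positivity
          simpa [hφ, hxb, hyb] using this
        · have := aux x y hx (hxb.trans (not_le.1 hyb).le) (not_le.1 hyb)
          simpa [hφ, hyb] using this
      · have hx0 : φ x = 0 := by simp [hφ, hxb]
        rw [hx0, zero_mul, zero_add]
        rcases le_total x y with hxy | hxy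
        · exact aux x y hx hxy ((not_le.1 hxb).trans_le hxy)
        · have := aux y x hy hxy (not_le.1 hxb)
          rwa [mul_comm x y, add_comm (x ^ 3)]
    have hcube : Integrable (fun ω => (η i ω ^ 3 + η j ω ^ 3) / b) P :=
      ((hint i).add (hint j)).div_const b
    have hle : ∫ ω, η i ω * η j ω ∂P ≤
        ∫ ω, ((φ ∘ η i) ω * (φ ∘ η j) ω + (η i ω ^ 3 + η j ω ^ 3) / b) ∂P :=
      integral_mono (hprod i j) (hφprod.add hcube) fun ω => hpt _ _ (hη0 i ω) (hη0 j ω)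
    rw [integral_add hφprod hcube, integral_div, integral_add (hint i) (hint j)] at hle
    have hmul : (∫ ω, (φ ∘ η i) ω ∂P) * (∫ ω, (φ ∘ η j) ω ∂P) ≤ v ^ 2 := by
      rw [sq]
      exact mul_le_mul (hφv i) (hφv j) (hφv0 j) hv
    have hdiv : (∫ ω, η i ω ^ 3 ∂P + ∫ ω, η j ω ^ 3 ∂P) / b ≤ 2 * v / b := by
      gcongr
      linarith [h3 i, h3 j]
    linarith
  have hpos : 0 ≤ v ^ 2 + α * b ^ 2 + 2 * v / b := by positivity
  have hall : ∀ i j, ∫ ω, η i ω * η j ω ∂P ≤ (v ^ 2 + α * b ^ 2 + 2 * v / b) +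
      if j ∈ Finset.Ico (i + 1 - r) (i + r) then 2 * v else 0 := by
    intro i j
    by_cases hij : i + r ≤ j
    · have : 0 ≤ if j ∈ Finset.Ico (i + 1 - r) (i + r) then 2 * v else 0 := by
        split_ifs <;> positivity
      linarith [hfar i j hij]
    by_cases hji : j + r ≤ i
    · have : 0 ≤ if j ∈ Finset.Ico (i + 1 - r) (i + r) then 2 * v else 0 := by
        split_ifs <;> positivity
      have := hfar j i hji
      simp only [mul_comm (η j _)] at this
      linarith
    · rw [if_pos (by rw [Finset.mem_Ico]; omega)]
      linarith [hcrude i j]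
  have hrow : ∀ i, ∑ j ∈ Finset.range n, (if j ∈ Finset.Ico (i + 1 - r) (i + r)
      then 2 * v else 0) ≤ 4 * r * v := by
    intro i
    rw [← Finset.sum_filter, Finset.sum_const, nsmul_eq_mul]
    have hcard : ((Finset.range n).filter fun j => j ∈ Finset.Ico (i + 1 - r) (i + r)).card ≤
        2 * r := by
      refine (Finset.card_le_card (t := Finset.Ico (i + 1 - r) (i + r)) fun j hj =>
        (Finset.mem_filter.1 hj).2).trans ?_
      rw [Nat.card_Ico]
      omega
    have : ((((Finset.range n).filter fun j => j ∈ Finset.Ico (i + 1 - r) (i + r)).card : ℕ) : ℝ) ≤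
        2 * r := by exact_mod_cast hcard
    nlinarith
  calc ∫ ω, (∑ i ∈ Finset.range n, η i ω) ^ 2 ∂P
      = ∑ i ∈ Finset.range n, ∑ j ∈ Finset.range n, ∫ ω, η i ω * η j ω ∂P := by
        simp only [sq, Finset.sum_mul_sum]
        rw [integral_finsetSum _ fun i _ => integrable_finsetSum _ fun j _ => hprod i j]
        exact Finset.sum_congr rfl fun i _ => integral_finsetSum _ fun j _ => hprod i j
    _ ≤ ∑ i ∈ Finset.range n, ∑ j ∈ Finset.range n, ((v ^ 2 + α * b ^ 2 + 2 * v / b) +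
          if j ∈ Finset.Ico (i + 1 - r) (i + r) then 2 * v else 0) :=
        Finset.sum_le_sum fun i _ => Finset.sum_le_sum fun j _ => hall i j
    _ ≤ ∑ i ∈ Finset.range n, (n * (v ^ 2 + α * b ^ 2 + 2 * v / b) + 4 * r * v) := by
        refine Finset.sum_le_sum fun i _ => ?_
        rw [Finset.sum_add_distrib, Finset.sum_const, Finset.card_range, nsmul_eq_mul]
        linarith [hrow i]
    _ = n ^ 2 * (v ^ 2 + α * b ^ 2 + 2 * v / b) + 4 * n * r * v := by
        rw [Finset.sum_const, Finset.card_range, nsmul_eq_mul]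
        ring

/-- Dyadic decomposition of the integer interval `[0, K)`. -/
lemma ite_lt_eq_sum_dyadic (M : ℕ) : ∀ k K : ℕ, K < 2 ^ M →
    (if k < K then (1 : ℝ) else 0) = ∑ m ∈ Finset.range M,
      if K / 2 ^ m % 2 = 1 ∧ k / 2 ^ m + 1 = K / 2 ^ m then (1 : ℝ) else 0 := by
  induction M with
  | zero =>
    intro k K hK
    have : K = 0 := by simpa using hK
    simp [this]
  | succ M ih =>
    intro k K hK
    have hK2 : K / 2 < 2 ^ M := by rw [pow_succ] at hK; omega
    have hdiv : ∀ x m : ℕ, x / 2 ^ (m + 1) = x / 2 / 2 ^ m := fun x m => by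
      rw [pow_succ', Nat.div_div_eq_div_mul]
    rw [Finset.sum_range_succ']
    simp only [hdiv]
    rw [← ih (k / 2) (K / 2) hK2]
    simp only [pow_zero, Nat.div_one]
    split_ifs <;> first | omega | norm_num

/-- A weighted sum over a discrete orthant is controlled by weighted sums over dyadic boxes. -/
theorem abs_sum_orthant_le_sum_dyadic {ι : Type*} (s : Finset ι) (x : ι → ℝ)
    (κ : ι → Fin d → ℕ) {M : ℕ} {K : Fin d → ℕ} (hK : ∀ i, K i < 2 ^ M)
    (t : (Fin d → ℕ) → ℝ) (ht : ∀ m, 0 ≤ t m)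
    (h : ∀ m ∈ Fintype.piFinset fun _ : Fin d => Finset.range M,
      ∀ q ∈ Fintype.piFinset fun _ : Fin d => Finset.range (2 ^ M),
        |∑ l ∈ s, x l * (if ∀ i, κ l i / 2 ^ m i = q i then 1 else 0)| ≤ t m) :
    |∑ l ∈ s, x l * (if ∀ i, κ l i < K i then 1 else 0)| ≤
      ∑ m ∈ Fintype.piFinset fun _ : Fin d => Finset.range M, t m := by
  have hprod : ∀ p : Fin d → Prop, ∀ [∀ i, Decidable (p i)],
      (∏ i, if p i then (1 : ℝ) else 0) = if ∀ i, p i then 1 else 0 := by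
    intro p _
    simp [Finset.prod_ite_zero]
  have hdec : ∀ l, (if ∀ i, κ l i < K i then (1 : ℝ) else 0) =
      ∑ m ∈ Fintype.piFinset fun _ : Fin d => Finset.range M,
        if ∀ i, K i / 2 ^ m i % 2 = 1 ∧ κ l i / 2 ^ m i + 1 = K i / 2 ^ m i
          then (1 : ℝ) else 0 := by
    intro l
    rw [← hprod, Finset.prod_congr rfl fun i _ => ite_lt_eq_sum_dyadic M (κ l i) (K i) (hK i),
      Finset.prod_univ_sum]
    exact Finset.sum_congr rfl fun m _ => hprod _
  simp only [hdec, Finset.mul_sum]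
  rw [Finset.sum_comm]
  refine (Finset.abs_sum_le_sum_abs _ _).trans (Finset.sum_le_sum fun m hm => ?_)
  by_cases hodd : ∀ i, K i / 2 ^ m i % 2 = 1
  · refine le_of_eq_of_le ?_ (h m hm (fun i => K i / 2 ^ m i - 1)
      (Fintype.mem_piFinset.2 fun i => Finset.mem_range.2 ?_))
    · refine congrArg _ (Finset.sum_congr rfl fun l _ => ?_)
      congr 2
      refine propext (forall_congr' fun i => ?_)
      have := hodd i
      generalize K i / 2 ^ m i = a at *
      omega
    · have := Nat.div_le_self (K i) (2 ^ m i)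
      have := hK i
      omega
  · have : ∀ l, ¬ ∀ i, K i / 2 ^ m i % 2 = 1 ∧ κ l i / 2 ^ m i + 1 = K i / 2 ^ m i :=
      fun l hl => hodd fun i => (hl i).1
    simp [this, ht m]

lemma card_le_of_forall_lt_add {s : Finset ℕ} {r : ℕ}
    (h : ∀ a ∈ s, ∀ b ∈ s, b < a + r) : s.card ≤ r := by
  rcases s.eq_empty_or_nonempty with rfl | hne
  · simp
  · have hsub : s ⊆ Finset.Ico (s.min' hne) (s.min' hne + r) := fun b hb =>
      Finset.mem_Ico.2 ⟨s.min'_le b hb, h _ (s.min'_mem hne) b hb⟩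
    simpa using Finset.card_le_card hsub

lemma measure_le_of_forall_Ioc_le {ν : Measure ℝ} [IsFiniteMeasure ν] [NullSingletonClass ν]
    {s : Set ℝ} (hs : MeasurableSet s) {h : ℝ≥0∞}
    (H : ∀ x ∈ s, ∀ y ∈ s, x ≤ y → ν (Ioc x y) ≤ h) : ν s ≤ h := by
  refine le_of_forall_lt fun c hc => ?_
  obtain ⟨k, hks, hk, hck⟩ := hs.exists_lt_isCompact hc
  refine hck.trans_le ?_
  rcases k.eq_empty_or_nonempty with rfl | hne
  · simp
  · have hx := hk.sInf_mem hne
    have hy := hk.sSup_mem hne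
    have hsub : k ⊆ Icc (sInf k) (sSup k) := fun z hz =>
      ⟨csInf_le hk.bddBelow hz, le_csSup hk.bddAbove hz⟩
    calc ν k ≤ ν (Icc (sInf k) (sSup k)) := measure_mono hsub
      _ = ν (Ioc (sInf k) (sSup k)) := (measure_congr Ioc_ae_eq_Icc).symm
      _ ≤ h := H _ (hks hx) _ (hks hy) (hsub hx).2

/-- Label of the `N`-quantile cell of `ν` that contains `x`. -/
def quantileLabel (ν : Measure ℝ) (N : ℕ) (x : ℝ) : ℕ :=
  ⌊N * (ν.real (Iic x) / ν.real univ)⌋₊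

lemma monotone_quantileLabel (ν : Measure ℝ) [IsFiniteMeasure ν] (N : ℕ) :
    Monotone (quantileLabel ν N) := fun _ _ hxy =>
  Nat.floor_le_floor (by gcongr; exact measure_ne_top _ _)

lemma quantileLabel_le (ν : Measure ℝ) [IsFiniteMeasure ν] (N : ℕ) (x : ℝ) :
    quantileLabel ν N x ≤ N := by
  refine Nat.floor_le_of_le ?_
  have : ν.real (Iic x) / ν.real univ ≤ 1 :=
    div_le_one_of_le₀ (measureReal_mono (subset_univ _)) measureReal_nonneg
  nlinarith [(Nat.cast_nonneg N : (0 : ℝ) ≤ N)]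

lemma measurable_quantileLabel (ν : Measure ℝ) [IsFiniteMeasure ν] (N : ℕ) :
    Measurable (quantileLabel ν N) :=
  (monotone_quantileLabel ν N).measurable

/-- A block of `w` consecutive quantile cells has mass at most `w / N` of the total. -/
lemma measureReal_quantileLabel_div_eq_le (ν : Measure ℝ) [IsFiniteMeasure ν]
    [NullSingletonClass ν] {N : ℕ} (hN : 0 < N) {w : ℕ} (hw : 0 < w) (q : ℕ) :
    ν.real {x | quantileLabel ν N x / w = q} ≤ w / N * ν.real univ := by
  have hm : MeasurableSet {x | quantileLabel ν N x / w = q} :=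
    (measurable_quantileLabel ν N) (MeasurableSet.of_discrete (s := {k : ℕ | k / w = q}))
  rcases (measureReal_nonneg (μ := ν) (s := univ)).eq_or_lt with h0 | hpos
  · rw [← h0, mul_zero, h0]
    exact measureReal_mono (subset_univ _)
  have hNr : (0 : ℝ) < N := by exact_mod_cast hN
  rw [measureReal_def]
  refine ENNReal.toReal_le_of_le_ofReal (by positivity) (measure_le_of_forall_Ioc_le hm ?_)
  intro x hx y hy hxy
  rw [← ENNReal.ofReal_toReal (measure_ne_top ν (Ioc x y))]
  refine ENNReal.ofReal_le_ofReal ?_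
  have hdiff : ν.real (Ioc x y) = ν.real (Iic y) - ν.real (Iic x) := by
    rw [← measureReal_sdiff (Iic_subset_Iic.2 hxy) measurableSet_Iic]
    congr 1
    ext t
    simp [and_comm]
  rw [← measureReal_def, hdiff]
  have hx' : (q * w : ℕ) ≤ quantileLabel ν N x := by
    have : quantileLabel ν N x / w = q := hx
    rw [← this]
    exact Nat.div_mul_le_self _ _
  have hy' : quantileLabel ν N y + 1 ≤ q * w + w := by
    have : quantileLabel ν N y / w = q := hy
    rw [← this]
    exact Nat.lt_div_mul_add hw
  have hfx : (quantileLabel ν N x : ℝ) ≤ N * (ν.real (Iic x) / ν.real univ) :=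
    Nat.floor_le (by positivity)
  have hfy : N * (ν.real (Iic y) / ν.real univ) < (quantileLabel ν N y : ℝ) + 1 :=
    Nat.lt_floor_add_one _
  have hx'' : (q * w : ℝ) ≤ quantileLabel ν N x := by exact_mod_cast hx'
  have hy'' : (quantileLabel ν N y : ℝ) + 1 ≤ q * w + w := by exact_mod_cast hy'
  have hsub : N * (ν.real (Iic y) / ν.real univ) - N * (ν.real (Iic x) / ν.real univ) ≤ w := by
    linarith
  rw [div_mul_eq_mul_div, le_div_iff₀ hNr]
  have e : (ν.real (Iic y) - ν.real (Iic x)) * N =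
      (N * (ν.real (Iic y) / ν.real univ) - N * (ν.real (Iic x) / ν.real univ)) *
        ν.real univ := by
    field_simp
  rw [e]
  exact mul_le_mul_of_nonneg_right hsub hpos.le

/-- Collision probability of two weakly dependent labels. -/
lemma measure_eq_le_of_mixing {P : Measure Ω} [IsProbabilityMeasure P] {κ κ' : Ω → ℕ}
    (hκ : Measurable κ) {N : ℕ} (hN : ∀ ω, κ ω ≤ N) {p α : ℝ≥0∞}
    (hp : ∀ k, P (κ' ⁻¹' {k}) ≤ p)
    (hmix : ∀ k, P (κ ⁻¹' {k} ∩ κ' ⁻¹' {k}) ≤ P (κ ⁻¹' {k}) * P (κ' ⁻¹' {k}) + α) :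
    P {ω | κ ω = κ' ω} ≤ p + (N + 1) * α := by
  have hsub : {ω | κ ω = κ' ω} ⊆
      ⋃ k ∈ Finset.range (N + 1), (κ ⁻¹' {k} ∩ κ' ⁻¹' {k}) := by
    intro ω hω
    simp only [mem_iUnion, Finset.mem_range, exists_prop]
    exact ⟨κ ω, Nat.lt_succ_of_le (hN ω), rfl, (show κ ω = κ' ω from hω).symm⟩
  have htot : ∑ k ∈ Finset.range (N + 1), P (κ ⁻¹' {k}) ≤ 1 := by
    rw [← measure_biUnion_finset (fun a _ b _ hab => ?_)
      fun k _ => hκ (measurableSet_singleton k)]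
    · exact prob_le_one
    · exact Disjoint.preimage _ (by simpa using hab)
  calc P {ω | κ ω = κ' ω}
      ≤ ∑ k ∈ Finset.range (N + 1), P (κ ⁻¹' {k} ∩ κ' ⁻¹' {k}) :=
        (measure_mono hsub).trans (measure_biUnion_finset_le _ _)
    _ ≤ ∑ k ∈ Finset.range (N + 1), (P (κ ⁻¹' {k}) * p + α) :=
        Finset.sum_le_sum fun k _ => (hmix k).trans (by gcongr; exact hp k)
    _ = (∑ k ∈ Finset.range (N + 1), P (κ ⁻¹' {k})) * p + (N + 1) * α := by
        rw [Finset.sum_add_distrib, Finset.sum_mul]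
        simp
    _ ≤ p + (N + 1) * α := by
        gcongr
        exact mul_le_of_le_one_left' htot

/-- A centred noise sequence `U` with a predictable covariate sequence `X`, whose truncated even
moments up to order six are dominated by `μ` and whose dependence at lag `r` is at most `α r`. -/
structure IsMixingNoise (P : Measure Ω) (𝒢 : Filtration ℕ ‹MeasurableSpace Ω›)
    (U : ℕ → Ω → ℝ) (X : ℕ → Ω → Fin d → ℝ) (μ : Measure (Fin d → ℝ)) (α : ℕ → ℝ) : Prop where
  measurable_noise : ∀ l, Measurable (U l)
  measurable_covariate : ∀ l, Measurable (X l)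
  adapted : ∀ l, Measurable[𝒢 (l + 1)] (U l)
  predictable : ∀ l, Measurable[𝒢 l] (X l)
  condExp_eq_zero : ∀ l, P[U l|𝒢 l] =ᵐ[P] 0
  integrable_pow_six : ∀ l, Integrable (fun ω => U l ω ^ 6) P
  setIntegral_le : ∀ l, ∀ k ≤ 3, ∀ B, MeasurableSet B →
    ∫ ω in X l ⁻¹' B, U l ω ^ (2 * k) ∂P ≤ μ.real B
  nonneg : ∀ r, 0 ≤ α r
  mixing : ∀ r i j, i + r ≤ j → ∀ A B : Set (ℝ × (Fin d → ℝ)), MeasurableSet A →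
    MeasurableSet B →
    P ((fun ω => (U i ω, X i ω)) ⁻¹' A ∩ (fun ω => (U j ω, X j ω)) ⁻¹' B) ≤
      P ((fun ω => (U i ω, X i ω)) ⁻¹' A) * P ((fun ω => (U j ω, X j ω)) ⁻¹' B) +
        ENNReal.ofReal (α r)

namespace IsMixingNoise

variable {P : Measure Ω} {𝒢 : Filtration ℕ ‹MeasurableSpace Ω›}
  {U : ℕ → Ω → ℝ} {X : ℕ → Ω → Fin d → ℝ} {μ : Measure (Fin d → ℝ)} {α : ℕ → ℝ}

lemma memLp_four [IsProbabilityMeasure P] (H : IsMixingNoise P 𝒢 U X μ α) (l : ℕ) :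
    MemLp (U l) 4 P := by
  have h6 : MemLp (U l) 6 P := by
    rw [← integrable_norm_rpow_iff (H.measurable_noise l).aestronglyMeasurable (by norm_num)
      (by norm_num)]
    refine (H.integrable_pow_six l).congr (ae_of_all _ fun ω => ?_)
    simp only [ENNReal.toReal_ofNat, Real.rpow_ofNat]
    exact ((show Even 6 by decide).pow_abs (U l ω)).symm
  exact h6.mono_exponent (by norm_num)

lemma measureReal_preimage_le (H : IsMixingNoise P 𝒢 U X μ α) (l : ℕ) {B : Set (Fin d → ℝ)}
    (hB : MeasurableSet B) : P.real (X l ⁻¹' B) ≤ μ.real B := by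
  simpa using H.setIntegral_le l 0 (by norm_num) B hB

/-- Maximal inequality for the partial sums of the noise over a block `B` of covariates. -/
theorem measure_exists_le_abs_sum_indicator_le [IsProbabilityMeasure P]
    (H : IsMixingNoise P 𝒢 U X μ α)
    {B : Set (Fin d → ℝ)} (hB : MeasurableSet B) {n : ℕ} (hn : 0 < n) (r : ℕ)
    {t : ℝ} (ht : 0 < t) :
    P {ω | ∃ k ≤ n, t ≤ |∑ l ∈ Finset.range k, U l ω * B.indicator 1 (X l ω)|} ≤
      ENNReal.ofReal (87 * (n ^ 2 * μ.real B ^ 2 + n ^ 4 * α r +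
        (2 + 4 * r) * n * μ.real B) / t ^ 4) := by
  have hBm : Measurable (B.indicator (1 : (Fin d → ℝ) → ℝ)) := measurable_one.indicator hB
  have hXB : ∀ l, MeasurableSet (X l ⁻¹' B) := fun l => H.measurable_covariate l hB
  set ξ : ℕ → Ω → ℝ := fun l ω => U l ω * B.indicator 1 (X l ω) with hξ
  have hξind : ∀ l, ξ l = (X l ⁻¹' B).indicator (U l) := by
    intro l
    funext ω
    by_cases h : X l ω ∈ B <;> simp [hξ, h]
  have hL4 : ∀ l, MemLp (ξ l) 4 P := fun l => by
    rw [hξind]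
    exact (H.memLp_four l).indicator (hXB l)
  have hpow : ∀ l k, k ≠ 0 → (fun ω => (ξ l ω ^ 2) ^ k) =
      (X l ⁻¹' B).indicator fun ω => U l ω ^ (2 * k) := by
    intro l k hk
    funext ω
    rw [hξind, ← pow_mul]
    by_cases h : ω ∈ X l ⁻¹' B
    · rw [indicator_of_mem h, indicator_of_mem h]
    · rw [indicator_of_notMem h, indicator_of_notMem h, zero_pow (by positivity)]
  have hmom : ∀ l k, k ≠ 0 → k ≤ 3 → ∫ ω, (ξ l ω ^ 2) ^ k ∂P ≤ μ.real B := by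
    intro l k hk hk3
    rw [hpow l k hk, integral_indicator (hXB l)]
    exact H.setIntegral_le l k hk3 B hB
  have hn' : (0 : ℝ) < n := by exact_mod_cast hn
  have h2 := integral_sq_sum_le_of_mixing (P := P) (η := fun l ω => ξ l ω ^ 2)
    (fun l => ((H.measurable_noise l).mul (hBm.comp (H.measurable_covariate l))).pow_const 2)
    (fun l ω => sq_nonneg _)
    (fun l => by
      rw [hpow l 3 (by norm_num)]
      exact (H.integrable_pow_six l).indicator (hXB l))
    (v := μ.real B)
    (fun l => by simpa using hmom l 1 (by norm_num) (by norm_num))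
    (fun l => hmom l 2 (by norm_num) (by norm_num))
    (fun l => hmom l 3 (by norm_num) le_rfl) (H.nonneg r) (r := r)
    (fun i j hij A A' hA hA' => by
      have hφ : Measurable fun p : ℝ × (Fin d → ℝ) => (p.1 * B.indicator 1 p.2) ^ 2 :=
        (measurable_fst.mul (hBm.comp measurable_snd)).pow_const 2
      exact H.mixing r i j hij _ _ (hφ hA) (hφ hA')) hn' n
  refine (measure_exists_le_abs_sum_le 𝒢 ξ ?_ hL4 ?_ n ht).trans ?_
  · intro l
    exact Measurable.stronglyMeasurable ((H.adapted l).mul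
      (hBm.comp ((H.predictable l).mono (𝒢.mono (Nat.le_succ l)) le_rfl)))
  · intro l
    have hint : Integrable (U l) P := (H.memLp_four l).integrable (by norm_num)
    have hcomm : ξ l = fun ω => B.indicator 1 (X l ω) * U l ω := by
      funext ω
      exact mul_comm _ _
    have hξint : Integrable (ξ l) P := (hL4 l).integrable (by norm_num)
    rw [hcomm] at hξint ⊢
    exact condExp_mul_eq_zero (hBm.comp (H.predictable l)).stronglyMeasurable hξint hint
      (H.condExp_eq_zero l)
  · refine ENNReal.ofReal_le_ofReal ?_
    have hv : 0 ≤ μ.real B := measureReal_nonneg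
    gcongr
    refine h2.trans (le_of_eq ?_)
    field_simp
    ring

end IsMixingNoise

/-- The coordinatewise quantile labels of `x`, at resolution `N`, with respect to the marginals
of `μ`. -/
def gridLabel (μ : Measure (Fin d → ℝ)) (N : ℕ) (x : Fin d → ℝ) (i : Fin d) : ℕ :=
  quantileLabel (μ.map fun x => x i) N (x i)

/-- The points of `D` whose grid labels, coarsened by `2 ^ m i` in coordinate `i`, equal `q`. -/
def dyadicBlock (μ : Measure (Fin d → ℝ)) (D : Set (Fin d → ℝ)) (N : ℕ) (m q : Fin d → ℕ) :
    Set (Fin d → ℝ) :=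
  {x | x ∈ D ∧ ∀ i, gridLabel μ N x i / 2 ^ m i = q i}

lemma mul_indicator_dyadicBlock (μ : Measure (Fin d → ℝ)) (D : Set (Fin d → ℝ)) (N : ℕ)
    (m q : Fin d → ℕ) (x : Fin d → ℝ) (u : ℝ) :
    u * D.indicator 1 x * (if ∀ i, gridLabel μ N x i / 2 ^ m i = q i then 1 else 0) =
      u * (dyadicBlock μ D N m q).indicator 1 x := by
  by_cases h1 : x ∈ D <;> by_cases h2 : ∀ i, gridLabel μ N x i / 2 ^ m i = q i <;>
    simp [dyadicBlock, Set.indicator, h1, h2]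

section Blocks

variable {μ : Measure (Fin d → ℝ)} [IsFiniteMeasure μ] {D : Set (Fin d → ℝ)}

lemma measurable_gridLabel (μ : Measure (Fin d → ℝ)) [IsFiniteMeasure μ] (N : ℕ) (i : Fin d) :
    Measurable fun x => gridLabel μ N x i :=
  (measurable_quantileLabel _ N).comp (measurable_pi_apply i)

lemma monotone_gridLabel (μ : Measure (Fin d → ℝ)) [IsFiniteMeasure μ] (N : ℕ) (i : Fin d) :
    Monotone fun x => gridLabel μ N x i := fun _ _ h => monotone_quantileLabel _ N (h i)

lemma le_of_gridLabel_lt {N : ℕ} {x z : Fin d → ℝ}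
    (h : ∀ i, gridLabel μ N x i < gridLabel μ N z i) : x ≤ z := fun i =>
  ((monotone_quantileLabel _ N).reflect_lt (h i)).le

lemma measurableSet_gridLabel_div_eq (N w q : ℕ) (i : Fin d) :
    MeasurableSet {x | gridLabel μ N x i / w = q} :=
  (measurable_gridLabel μ N i) (MeasurableSet.of_discrete (s := {k : ℕ | k / w = q}))

lemma measurableSet_dyadicBlock (hD : MeasurableSet D) (N : ℕ) (m q : Fin d → ℕ) :
    MeasurableSet (dyadicBlock μ D N m q) := by
  have : dyadicBlock μ D N m q = D ∩ ⋂ i, {x | gridLabel μ N x i / 2 ^ m i = q i} := by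
    ext x
    simp [dyadicBlock]
  rw [this]
  exact hD.inter (MeasurableSet.iInter fun i => measurableSet_gridLabel_div_eq N _ _ i)

lemma measureReal_gridLabel_div_eq_le (hμ : ∀ i, NullSingletonClass (μ.map fun x => x i))
    {N : ℕ} (hN : 0 < N) {w : ℕ} (hw : 0 < w) (q : ℕ) (i : Fin d) :
    μ.real {x | gridLabel μ N x i / w = q} ≤ w / N * μ.real univ := by
  have := hμ i
  have h := measureReal_quantileLabel_div_eq_le (μ.map fun x => x i) hN hw q
  have hm : MeasurableSet {x | quantileLabel (μ.map fun x => x i) N x / w = q} :=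
    (measurable_quantileLabel _ N) (MeasurableSet.of_discrete (s := {k : ℕ | k / w = q}))
  rwa [map_measureReal_apply (measurable_pi_apply i) hm,
    map_measureReal_apply (measurable_pi_apply i) MeasurableSet.univ] at h

lemma measureReal_dyadicBlock_le (hμ : ∀ i, NullSingletonClass (μ.map fun x => x i))
    (hd : 0 < d) {L : ℕ} {m : Fin d → ℕ} (hm : ∀ i, m i ≤ L) (q : Fin d → ℕ) {ρ : ℝ}
    (hρ0 : 0 ≤ ρ) (hρ1 : ρ ≤ 1) (hρ : ρ ^ d = 1 / 2) :
    μ.real (dyadicBlock μ D (2 ^ L) m q) ≤ (∏ i, ρ ^ (L - m i)) * μ.real univ := by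
  have : Nonempty (Fin d) := ⟨⟨0, hd⟩⟩
  obtain ⟨i, hi⟩ := exists_eq_ciInf_of_finite (f := m)
  have hmin : ∀ j, m i ≤ m j := fun j => hi ▸ ciInf_le (OrderBot.bddBelow _) j
  have h1 : μ.real (dyadicBlock μ D (2 ^ L) m q) ≤ 2 ^ m i / 2 ^ L * μ.real univ := by
    refine (measureReal_mono fun x hx => hx.2 i).trans
      ((measureReal_gridLabel_div_eq_le hμ (by positivity) (by positivity) (q i) i).trans ?_)
    push_cast
    exact le_rfl
  refine h1.trans (mul_le_mul_of_nonneg_right ?_ measureReal_nonneg)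
  calc (2 : ℝ) ^ m i / 2 ^ L = (1 / 2) ^ (L - m i) := by
        rw [one_div, inv_pow, ← Nat.sub_add_cancel (hm i), pow_add]
        simp
        field_simp
    _ = ∏ _j : Fin d, ρ ^ (L - m i) := by
        rw [← hρ, Finset.prod_const, Finset.card_univ, Fintype.card_fin, ← pow_mul, ← pow_mul,
          mul_comm]
    _ ≤ ∏ j, ρ ^ (L - m j) := Finset.prod_le_prod (fun _ _ => by positivity) fun j _ =>
        pow_le_pow_of_le_one hρ0 hρ1 (Nat.sub_le_sub_left (hmin j) L)

lemma sum_measureReal_dyadicBlock_le (hD : MeasurableSet D) (N : ℕ) (m : Fin d → ℕ)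
    (s : Finset (Fin d → ℕ)) :
    ∑ q ∈ s, μ.real (dyadicBlock μ D N m q) ≤ μ.real D := by
  rw [← measureReal_biUnion_finset]
  · exact measureReal_mono (iUnion₂_subset fun q _ x hx => hx.1)
  · intro q _ q' _ hqq'
    refine Set.disjoint_left.2 fun x hx hx' => hqq' ?_
    funext i
    rw [← hx.2 i, ← hx'.2 i]
  · exact fun q _ => measurableSet_dyadicBlock hD N m q

end Blocks

/-- Summable weights for the dyadic scales. -/
def scaleWeight (L : ℕ) (m : Fin d → ℕ) : ℝ :=
  ∏ i, (((L - m i : ℕ) + 1 : ℝ) * ((L - m i : ℕ) + 2))⁻¹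

lemma scaleWeight_pos (L : ℕ) (m : Fin d → ℕ) : 0 < scaleWeight L m :=
  Finset.prod_pos fun _ _ => by positivity

lemma sum_piFinset_prod_sub (L : ℕ) (g : ℕ → ℝ) :
    ∑ m ∈ Fintype.piFinset fun _ : Fin d => Finset.range (L + 1), ∏ i, g (L - m i) =
      (∑ j ∈ Finset.range (L + 1), g j) ^ d := by
  rw [← Finset.prod_univ_sum (fun _ : Fin d => Finset.range (L + 1)) fun _ j => g (L - j)]
  have := Finset.sum_range_reflect g (L + 1)
  simp only [Nat.add_sub_cancel] at this
  simp [this]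

lemma sum_scaleWeight_le_one (L : ℕ) :
    ∑ m ∈ Fintype.piFinset fun _ : Fin d => Finset.range (L + 1), scaleWeight L m ≤ 1 := by
  have h : ∀ N : ℕ, ∑ j ∈ Finset.range N, ((j + 1 : ℝ) * (j + 2))⁻¹ = 1 - 1 / (N + 1) := by
    intro N
    induction N with
    | zero => simp
    | succ N ih =>
      rw [Finset.sum_range_succ, ih]
      push_cast
      field_simp
      ring
  refine (sum_piFinset_prod_sub L fun j => ((j + 1 : ℝ) * (j + 2))⁻¹).le.trans ?_
  rw [h]
  refine pow_le_one₀ ?_ ?_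
  · rw [sub_nonneg, div_le_one (by positivity)]
    linarith [(Nat.cast_nonneg (L + 1) : (0 : ℝ) ≤ ((L + 1 : ℕ) : ℝ))]
  · linarith [show (0 : ℝ) ≤ 1 / (((L + 1 : ℕ) : ℝ) + 1) by positivity]

lemma inv_scaleWeight_pow_four_le (L : ℕ) (m : Fin d → ℕ) :
    (scaleWeight L m ^ 4)⁻¹ ≤ ∏ i, ((L - m i : ℕ) + 2 : ℝ) ^ 8 := by
  rw [scaleWeight, ← Finset.prod_pow, ← Finset.prod_inv_distrib]
  refine Finset.prod_le_prod (fun _ _ => by positivity) fun i _ => ?_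
  rw [inv_pow, inv_inv, mul_pow, show 8 = 4 + 4 from rfl, pow_add]
  gcongr
  norm_num

/-- Chaining for partial sums over orthants: control over the dyadic blocks, of the size of the
summands and of coincidences of labels controls the sums over all orthants. -/
theorem abs_sum_indicator_Iic_le (μ : Measure (Fin d → ℝ)) [IsFiniteMeasure μ]
    (D : Set (Fin d → ℝ)) (L r k : ℕ) {τ y : ℝ} (hτ : 0 ≤ τ) (hy : 0 ≤ y) (hry : d * r * y ≤ τ)
    (u : ℕ → ℝ) (x : ℕ → Fin d → ℝ)
    (hblock : ∀ m ∈ Fintype.piFinset fun _ : Fin d => Finset.range (L + 1),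
      ∀ q ∈ Fintype.piFinset fun _ : Fin d => Finset.range (2 ^ (L + 1)),
        |∑ l ∈ Finset.range k, u l * (dyadicBlock μ D (2 ^ L) m q).indicator 1 (x l)| ≤
          scaleWeight L m * τ)
    (hu : ∀ l < k, |u l| ≤ y)
    (hx : ∀ i, ∀ l < k, ∀ l' < k, l + r ≤ l' →
      gridLabel μ (2 ^ L) (x l) i ≠ gridLabel μ (2 ^ L) (x l') i) (z : Fin d → ℝ) :
    |∑ l ∈ Finset.range k, u l * D.indicator 1 (x l) * (Iic z).indicator 1 (x l)| ≤ 2 * τ := by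
  set κ : (Fin d → ℝ) → Fin d → ℕ := gridLabel μ (2 ^ L) with hκ
  set inner : ℕ → ℝ := fun l => u l * D.indicator 1 (x l) *
    (if ∀ i, κ (x l) i < κ z i then 1 else 0) with hinner
  have hgrid : |∑ l ∈ Finset.range k, inner l| ≤ τ := by
    refine (abs_sum_orthant_le_sum_dyadic (Finset.range k) (fun l => u l * D.indicator 1 (x l))
      (fun l => κ (x l)) (M := L + 1) (K := κ z) (fun i => ?_) (fun m => scaleWeight L m * τ)
      (fun m => mul_nonneg (scaleWeight_pos L m).le hτ) fun m hm q hq => ?_).trans ?_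
    · exact (quantileLabel_le _ _ _).trans_lt
        (Nat.pow_lt_pow_right (by norm_num) (Nat.lt_succ_self L))
    · simp only [hκ, mul_indicator_dyadicBlock]
      exact hblock m hm q hq
    · rw [← Finset.sum_mul]
      exact mul_le_of_le_one_left hτ (sum_scaleWeight_le_one L)
  have hstrip : ∀ i, ∑ l ∈ Finset.range k, (if κ (x l) i = κ z i then y else 0) ≤ r * y := by
    intro i
    rw [← Finset.sum_filter, Finset.sum_const, nsmul_eq_mul]
    gcongr
    refine card_le_of_forall_lt_add fun a ha b hb => ?_
    by_contra hab
    rw [Finset.mem_filter, Finset.mem_range] at ha hb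
    exact hx i a ha.1 b hb.1 (not_lt.1 hab) (ha.2.trans hb.2.symm)
  have hterm : ∀ l ∈ Finset.range k,
      |u l * D.indicator 1 (x l) * (Iic z).indicator 1 (x l) - inner l| ≤
        ∑ i, if κ (x l) i = κ z i then y else 0 := by
    intro l hl
    have hnn : ∀ i ∈ Finset.univ, (0 : ℝ) ≤ if κ (x l) i = κ z i then y else 0 := by
      intro i _
      split_ifs <;> simp [hy]
    by_cases hlt : ∀ i, κ (x l) i < κ z i
    · have : x l ∈ Iic z := le_of_gridLabel_lt hlt
      simpa [hinner, hlt, this] using Finset.sum_nonneg hnn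
    by_cases hle : x l ∈ Iic z
    · push Not at hlt
      obtain ⟨i, hi⟩ := hlt
      have heq : κ (x l) i = κ z i := le_antisymm (monotone_gridLabel μ _ i hle) hi
      refine le_trans ?_ (Finset.single_le_sum hnn (Finset.mem_univ i))
      rw [if_pos heq]
      have h0 : ¬ ∀ i, κ (x l) i < κ z i := fun h => (h i).not_ge hi
      by_cases hD : x l ∈ D
      · simpa [hinner, h0, hle, hD] using hu l (Finset.mem_range.1 hl)
      · simpa [hinner, h0, hle, hD] using hy
    · simpa [hinner, hlt, hle] using Finset.sum_nonneg hnn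
  have hdiff : |∑ l ∈ Finset.range k, u l * D.indicator 1 (x l) * (Iic z).indicator 1 (x l) -
      ∑ l ∈ Finset.range k, inner l| ≤ τ := by
    rw [← Finset.sum_sub_distrib]
    refine (Finset.abs_sum_le_sum_abs _ _).trans ((Finset.sum_le_sum hterm).trans ?_)
    rw [Finset.sum_comm]
    refine (Finset.sum_le_sum fun i _ => hstrip i).trans (le_trans (le_of_eq ?_) hry)
    simp [mul_assoc]
  have := abs_sub_abs_le_abs_sub
    (∑ l ∈ Finset.range k, u l * D.indicator 1 (x l) * (Iic z).indicator 1 (x l))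
    (∑ l ∈ Finset.range k, inner l)
  linarith

namespace IsMixingNoise

variable {P : Measure Ω} [IsProbabilityMeasure P] {𝒢 : Filtration ℕ ‹MeasurableSpace Ω›}
  {U : ℕ → Ω → ℝ} {X : ℕ → Ω → Fin d → ℝ} {μ : Measure (Fin d → ℝ)} {α : ℕ → ℝ}

lemma measure_exists_le_abs_noise_le (H : IsMixingNoise P 𝒢 U X μ α) (n : ℕ) {y : ℝ}
    (hy : 0 < y) :
    P {ω | ∃ l < n, y ≤ |U l ω|} ≤ ENNReal.ofReal (n * μ.real univ / y ^ 6) := by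
  have h1 : ∀ l, P {ω | y ≤ |U l ω|} ≤ ENNReal.ofReal (μ.real univ / y ^ 6) := by
    intro l
    have hsub : {ω | y ≤ |U l ω|} ⊆ {ω | y ^ 6 ≤ U l ω ^ 6} := fun ω hω => by
      have := pow_le_pow_left₀ hy.le hω 6
      rwa [(show Even 6 by decide).pow_abs] at this
    refine (measure_mono hsub).trans ?_
    rw [← ofReal_measureReal]
    refine ENNReal.ofReal_le_ofReal ((le_div_iff₀' (by positivity)).2 ?_)
    refine (mul_meas_ge_le_integral_of_nonneg (ae_of_all _ fun ω => ?_)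
      (H.integrable_pow_six l) _).trans ?_
    · exact (show Even 6 by decide).pow_nonneg _
    · simpa using H.setIntegral_le l 3 le_rfl univ MeasurableSet.univ
  have hsub : {ω | ∃ l < n, y ≤ |U l ω|} ⊆ ⋃ l ∈ Finset.range n, {ω | y ≤ |U l ω|} := by
    rintro ω ⟨l, hl, h⟩
    exact mem_iUnion₂.2 ⟨l, Finset.mem_range.2 hl, h⟩
  refine (measure_mono hsub).trans ((measure_biUnion_finset_le _ _).trans
    ((Finset.sum_le_sum fun l _ => h1 l).trans (le_of_eq ?_)))
  rw [Finset.sum_const, Finset.card_range, nsmul_eq_mul, ← ENNReal.ofReal_natCast,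
    ← ENNReal.ofReal_mul (by positivity), mul_div_assoc]

lemma measure_exists_gridLabel_eq_le [IsFiniteMeasure μ] (H : IsMixingNoise P 𝒢 U X μ α)
    (hμ : ∀ i, NullSingletonClass (μ.map fun x => x i)) {N : ℕ} (hN : 0 < N) (n r : ℕ) :
    P {ω | ∃ i, ∃ l < n, ∃ l' < n, l + r ≤ l' ∧
        gridLabel μ N (X l ω) i = gridLabel μ N (X l' ω) i} ≤
      ENNReal.ofReal (d * n ^ 2 * (μ.real univ / N + (N + 1) * α r)) := by
  have hm : ∀ i l, Measurable fun ω => gridLabel μ N (X l ω) i := fun i l =>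
    (measurable_gridLabel μ N i).comp (H.measurable_covariate l)
  have h1 : ∀ i l l', P {ω | l + r ≤ l' ∧ gridLabel μ N (X l ω) i = gridLabel μ N (X l' ω) i} ≤
      ENNReal.ofReal (μ.real univ / N + (N + 1) * α r) := by
    intro i l l'
    by_cases hll : l + r ≤ l'
    · simp only [hll, true_and]
      refine (measure_eq_le_of_mixing (hm i l) (N := N) (fun ω => quantileLabel_le _ _ _)
        (p := ENNReal.ofReal (μ.real univ / N)) (α := ENNReal.ofReal (α r)) (fun k => ?_)
        fun k => ?_).trans (le_of_eq ?_)
      · have hk : MeasurableSet {x | gridLabel μ N x i = k} :=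
          measurable_gridLabel μ N i (measurableSet_singleton k)
        have h2 := measureReal_gridLabel_div_eq_le hμ hN one_pos k i
        rw [← ofReal_measureReal]
        refine ENNReal.ofReal_le_ofReal ((H.measureReal_preimage_le l' hk).trans ?_)
        simp only [Nat.div_one] at h2
        refine h2.trans (le_of_eq ?_)
        simp
        ring
      · have hs : MeasurableSet {p : ℝ × (Fin d → ℝ) | gridLabel μ N p.2 i = k} :=
          ((measurable_gridLabel μ N i).comp measurable_snd) (measurableSet_singleton k)
        exact H.mixing r l l' hll _ _ hs hs
      · have := H.nonneg r
        rw [ENNReal.ofReal_add (by positivity) (by positivity), ENNReal.ofReal_mul (by positivity)]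
        congr
        rw [ENNReal.ofReal_add (by positivity) zero_le_one]
        simp
    · simp [hll]
  have hsub : {ω | ∃ i, ∃ l < n, ∃ l' < n, l + r ≤ l' ∧
      gridLabel μ N (X l ω) i = gridLabel μ N (X l' ω) i} ⊆
      ⋃ t ∈ (Finset.univ : Finset (Fin d)) ×ˢ Finset.range n ×ˢ Finset.range n,
        {ω | t.2.1 + r ≤ t.2.2 ∧
          gridLabel μ N (X t.2.1 ω) t.1 = gridLabel μ N (X t.2.2 ω) t.1} := by
    rintro ω ⟨i, l, hl, l', hl', h⟩
    exact mem_iUnion₂.2 ⟨(i, l, l'), by simp [hl, hl'], h⟩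
  refine (measure_mono hsub).trans ((measure_biUnion_finset_le _ _).trans
    ((Finset.sum_le_sum fun t _ => h1 t.1 t.2.1 t.2.2).trans (le_of_eq ?_)))
  have := H.nonneg r
  rw [Finset.sum_const, nsmul_eq_mul, ← ENNReal.ofReal_natCast,
    ← ENNReal.ofReal_mul (by positivity)]
  simp
  ring_nf

theorem measure_exists_dyadicBlock_le [IsFiniteMeasure μ] (H : IsMixingNoise P 𝒢 U X μ α)
    (hμ : ∀ i, NullSingletonClass (μ.map fun x => x i)) (hd : 0 < d) {D : Set (Fin d → ℝ)}
    (hD : MeasurableSet D) {ρ A : ℝ} (hρ0 : 0 ≤ ρ) (hρ1 : ρ ≤ 1) (hρ : ρ ^ d = 1 / 2)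
    (hA : ∀ N, ∑ j ∈ Finset.range N, ((j : ℝ) + 2) ^ 8 * ρ ^ j ≤ A) {n : ℕ} (hn : 0 < n)
    (r L : ℕ) {τ : ℝ} (hτ : 0 < τ) :
    P {ω | ∃ m ∈ Fintype.piFinset fun _ : Fin d => Finset.range (L + 1),
        ∃ q ∈ Fintype.piFinset fun _ : Fin d => Finset.range (2 ^ (L + 1)), ∃ k ≤ n,
          scaleWeight L m * τ ≤
            |∑ l ∈ Finset.range k,
              U l ω * (dyadicBlock μ D (2 ^ L) m q).indicator 1 (X l ω)|} ≤
      ENNReal.ofReal (87 / τ ^ 4 * (n ^ 2 * (μ.real univ * μ.real D) * A ^ d +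
        (n ^ 4 * α r * (2 ^ (L + 1)) ^ d + (2 + 4 * r) * n * μ.real univ) *
          ((L : ℝ) + 2) ^ (9 * d))) := by
  set S := Fintype.piFinset fun _ : Fin d => Finset.range (L + 1) with hS
  set T := Fintype.piFinset fun _ : Fin d => Finset.range (2 ^ (L + 1)) with hT
  set v : (Fin d → ℕ) → (Fin d → ℕ) → ℝ := fun m q => μ.real (dyadicBlock μ D (2 ^ L) m q)
    with hv
  have hv0 : ∀ m q, 0 ≤ v m q := fun m q => measureReal_nonneg
  have hα := H.nonneg r
  have hμD : μ.real D ≤ μ.real univ := measureReal_mono (subset_univ _)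
  have hT' : (T.card : ℝ) = (2 ^ (L + 1)) ^ d := by simp [hT]
  have hsumv : ∀ m, ∑ q ∈ T, v m q ≤ μ.real D := fun m =>
    sum_measureReal_dyadicBlock_le hD _ m T
  set R : ℝ := n ^ 4 * α r * (2 ^ (L + 1)) ^ d + (2 + 4 * r) * n * μ.real univ with hR
  have hR0 : 0 ≤ R := by positivity
  set e : (Fin d → ℕ) → (Fin d → ℕ) → ℝ := fun m q =>
    87 * (n ^ 2 * v m q ^ 2 + n ^ 4 * α r + (2 + 4 * r) * n * v m q) /
      (scaleWeight L m * τ) ^ 4 with he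
  have he0 : ∀ m q, 0 ≤ e m q := fun m q => by
    have := hv0 m q
    positivity
  have hsum : ∀ m ∈ S, ∑ q ∈ T, e m q ≤ 87 / τ ^ 4 *
      (n ^ 2 * (μ.real univ * μ.real D) * ∏ i, (((L - m i : ℕ) + 2 : ℝ) ^ 8 * ρ ^ (L - m i)) +
        R * ∏ i, ((L - m i : ℕ) + 2 : ℝ) ^ 8) := by
    intro m hm
    have hmL : ∀ i, m i ≤ L := fun i => by
      have := Fintype.mem_piFinset.1 hm i
      rw [Finset.mem_range] at this
      omega
    set p := ∏ i, ρ ^ (L - m i) with hp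
    have hp0 : 0 ≤ p := Finset.prod_nonneg fun _ _ => by positivity
    have hsq : ∑ q ∈ T, v m q ^ 2 ≤ p * (μ.real univ * μ.real D) := by
      calc ∑ q ∈ T, v m q ^ 2 ≤ ∑ q ∈ T, p * μ.real univ * v m q := by
            refine Finset.sum_le_sum fun q _ => ?_
            rw [sq]
            exact mul_le_mul_of_nonneg_right
              (measureReal_dyadicBlock_le hμ hd hmL q hρ0 hρ1 hρ) (hv0 m q)
        _ = p * μ.real univ * ∑ q ∈ T, v m q := by rw [Finset.mul_sum]
        _ ≤ p * μ.real univ * μ.real D := by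
            gcongr
            exact hsumv m
        _ = _ := by ring
    have hnum : ∑ q ∈ T, (n ^ 2 * v m q ^ 2 + n ^ 4 * α r + (2 + 4 * r) * n * v m q) ≤
        n ^ 2 * (p * (μ.real univ * μ.real D)) + R := by
      rw [Finset.sum_add_distrib, Finset.sum_add_distrib, ← Finset.mul_sum, ← Finset.mul_sum,
        Finset.sum_const, nsmul_eq_mul, hT', hR, add_assoc]
      refine add_le_add (by gcongr) (add_le_add (le_of_eq (by ring)) ?_)
      rw [← Finset.mul_sum]
      exact mul_le_mul_of_nonneg_left ((hsumv m).trans hμD) (by positivity)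
    calc ∑ q ∈ T, e m q = 87 / τ ^ 4 * (scaleWeight L m ^ 4)⁻¹ *
          ∑ q ∈ T, (n ^ 2 * v m q ^ 2 + n ^ 4 * α r + (2 + 4 * r) * n * v m q) := by
          rw [Finset.mul_sum]
          refine Finset.sum_congr rfl fun q _ => ?_
          simp only [he]
          rw [mul_pow]
          have := (scaleWeight_pos L m).ne'
          field_simp
      _ ≤ 87 / τ ^ 4 * (∏ i, ((L - m i : ℕ) + 2 : ℝ) ^ 8) *
          (n ^ 2 * (p * (μ.real univ * μ.real D)) + R) := by
          have := inv_scaleWeight_pow_four_le L m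
          refine mul_le_mul (by gcongr) hnum (Finset.sum_nonneg fun q _ => ?_) (by positivity)
          have := hv0 m q
          positivity
      _ = _ := by
          rw [Finset.prod_mul_distrib]
          ring
  have htot : ∑ m ∈ S, ∑ q ∈ T, e m q ≤ 87 / τ ^ 4 * (n ^ 2 * (μ.real univ * μ.real D) * A ^ d +
      R * ((L : ℝ) + 2) ^ (9 * d)) := by
    refine (Finset.sum_le_sum hsum).trans ?_
    rw [← Finset.mul_sum, Finset.sum_add_distrib, ← Finset.mul_sum, ← Finset.mul_sum,
      sum_piFinset_prod_sub L fun j => ((j : ℝ) + 2) ^ 8 * ρ ^ j,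
      sum_piFinset_prod_sub L fun j => ((j : ℝ) + 2) ^ 8]
    have h9 : ∑ j ∈ Finset.range (L + 1), ((j : ℝ) + 2) ^ 8 ≤ ((L : ℝ) + 2) ^ 9 := by
      calc ∑ j ∈ Finset.range (L + 1), ((j : ℝ) + 2) ^ 8
          ≤ ∑ _j ∈ Finset.range (L + 1), ((L : ℝ) + 2) ^ 8 := by
            refine Finset.sum_le_sum fun j hj => ?_
            have : (j : ℝ) ≤ L := by exact_mod_cast Nat.lt_succ_iff.1 (Finset.mem_range.1 hj)
            gcongr
        _ = (L + 1) * ((L : ℝ) + 2) ^ 8 := by simp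
        _ ≤ (L + 2) * ((L : ℝ) + 2) ^ 8 := by
            gcongr
            norm_num
        _ = _ := by ring
    have h9' := pow_le_pow_left₀ (Finset.sum_nonneg fun _ _ => by positivity) h9 d
    have hA' := pow_le_pow_left₀ (Finset.sum_nonneg fun _ _ => by positivity) (hA (L + 1)) d
    rw [← pow_mul] at h9'
    exact mul_le_mul_of_nonneg_left (add_le_add (mul_le_mul_of_nonneg_left hA' (by positivity))
      (mul_le_mul_of_nonneg_left h9' hR0)) (by positivity)
  have hsub : {ω | ∃ m ∈ S, ∃ q ∈ T, ∃ k ≤ n, scaleWeight L m * τ ≤ |∑ l ∈ Finset.range k,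
        U l ω * (dyadicBlock μ D (2 ^ L) m q).indicator 1 (X l ω)|} ⊆
      ⋃ m ∈ S, ⋃ q ∈ T, {ω | ∃ k ≤ n, scaleWeight L m * τ ≤ |∑ l ∈ Finset.range k,
        U l ω * (dyadicBlock μ D (2 ^ L) m q).indicator 1 (X l ω)|} := by
    rintro ω ⟨m, hm, q, hq, h⟩
    exact mem_iUnion₂.2 ⟨m, hm, mem_iUnion₂.2 ⟨q, hq, h⟩⟩
  calc _ ≤ ∑ m ∈ S, ∑ q ∈ T, ENNReal.ofReal (e m q) := by
        refine (measure_mono hsub).trans ((measure_biUnion_finset_le _ _).trans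
          (Finset.sum_le_sum fun m _ => (measure_biUnion_finset_le _ _).trans
            (Finset.sum_le_sum fun q _ => ?_)))
        exact H.measure_exists_le_abs_sum_indicator_le (measurableSet_dyadicBlock hD _ m q) hn r
          (mul_pos (scaleWeight_pos L m) hτ)
    _ = ENNReal.ofReal (∑ m ∈ S, ∑ q ∈ T, e m q) := by
        rw [ENNReal.ofReal_sum_of_nonneg fun m _ => Finset.sum_nonneg fun q _ => he0 m q]
        exact Finset.sum_congr rfl fun m _ =>
          (ENNReal.ofReal_sum_of_nonneg fun q _ => he0 m q).symm
    _ ≤ _ := ENNReal.ofReal_le_ofReal htot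

/-- Non-asymptotic maximal inequality, uniform over orthants, for the noise with covariates
in `D`. -/
theorem measure_exists_lt_abs_sum_le [IsFiniteMeasure μ] (H : IsMixingNoise P 𝒢 U X μ α)
    (hμ : ∀ i, NullSingletonClass (μ.map fun x => x i)) (hd : 0 < d) {D : Set (Fin d → ℝ)}
    (hD : MeasurableSet D) {ρ A : ℝ} (hρ0 : 0 ≤ ρ) (hρ1 : ρ ≤ 1) (hρ : ρ ^ d = 1 / 2)
    (hA : ∀ N, ∑ j ∈ Finset.range N, ((j : ℝ) + 2) ^ 8 * ρ ^ j ≤ A) {n : ℕ} (hn : 0 < n)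
    (r L : ℕ) {τ y : ℝ} (hτ : 0 < τ) (hy : 0 < y) (hry : d * r * y ≤ τ) :
    P {ω | ∃ k ≤ n, ∃ z : Fin d → ℝ, 2 * τ < |∑ l ∈ Finset.range k,
        U l ω * D.indicator 1 (X l ω) * (Iic z).indicator 1 (X l ω)|} ≤
      ENNReal.ofReal (87 / τ ^ 4 * (n ^ 2 * (μ.real univ * μ.real D) * A ^ d +
        (n ^ 4 * α r * (2 ^ (L + 1)) ^ d + (2 + 4 * r) * n * μ.real univ) *
          ((L : ℝ) + 2) ^ (9 * d))) +
      ENNReal.ofReal (n * μ.real univ / y ^ 6) +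
      ENNReal.ofReal (d * n ^ 2 * (μ.real univ / 2 ^ L + (2 ^ L + 1) * α r)) := by
  have h3 := H.measure_exists_gridLabel_eq_le hμ (N := 2 ^ L) (by positivity) n r
  push_cast at h3
  refine le_trans (measure_mono ?_) ((measure_union_le _ _).trans (add_le_add
    ((measure_union_le _ _).trans (add_le_add
      (H.measure_exists_dyadicBlock_le hμ hd hD hρ0 hρ1 hρ hA hn r L hτ)
      (H.measure_exists_le_abs_noise_le n hy))) h3))
  rintro ω ⟨k, hk, z, hz⟩
  by_contra hω
  simp only [mem_union, mem_ofPred_eq, not_or, not_exists, not_and, not_le] at hω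
  obtain ⟨⟨h1, h2⟩, h3⟩ := hω
  refine hz.not_ge (abs_sum_indicator_Iic_le μ D L r k hτ.le hy.le hry (fun l => U l ω)
    (fun l => X l ω) (fun m hm q hq => (h1 m hm q hq k hk).le)
    (fun l hl => (h2 l (hl.trans_le hk)).le)
    (fun i l hl l' hl' hll => h3 i l (hl.trans_le hk) l' (hl'.trans_le hk) hll) z)

end IsMixingNoise

lemma tendsto_natLog_atTop : Tendsto (Nat.log 2) atTop atTop :=
  tendsto_atTop_mono' _ (Eventually.of_forall fun _ => le_rfl)
    (Monotone.tendsto_atTop_atTop (fun _ _ h => Nat.log_mono_right h) fun b =>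
      ⟨2 ^ b, (Nat.log_pow one_lt_two b).ge⟩)

lemma tendsto_succ_pow_mul_inv_two_pow (p : ℕ) :
    Tendsto (fun k : ℕ => ((k : ℝ) + 1) ^ p * (1 / 2) ^ k) atTop (𝓝 0) := by
  have h := ((tendsto_pow_const_mul_const_pow_of_abs_lt_one p (r := (1 / 2 : ℝ))
    (by rw [abs_of_pos] <;> norm_num)).comp (tendsto_add_atTop_nat 1)).const_mul 2
  rw [mul_zero] at h
  refine h.congr fun k => ?_
  simp only [Function.comp]
  push_cast
  ring

/-- A geometrically decaying sequence, evaluated at `k ^ 2`, beats every exponential. -/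
lemma tendsto_succ_pow_mul_pow_mul_comp_sq {α : ℕ → ℝ} (hα : ∀ r, 0 ≤ α r) {a : ℝ} (ha : 1 < a)
    (hO : α =O[atTop] fun t : ℕ => (a ^ t)⁻¹) (p : ℕ) {K : ℝ} (hK : 0 ≤ K) :
    Tendsto (fun k : ℕ => ((k : ℝ) + 1) ^ p * K ^ k * α (k ^ 2)) atTop (𝓝 0) := by
  obtain ⟨C, hC0, hC⟩ := hO.exists_nonneg
  have hsq : Tendsto (fun k : ℕ => k ^ 2) atTop atTop := tendsto_pow_atTop two_ne_zero
  have hlim := (tendsto_succ_pow_mul_inv_two_pow p).const_mul C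
  rw [mul_zero] at hlim
  refine squeeze_zero' (Eventually.of_forall fun k => ?_) ?_ hlim
  · have := hα (k ^ 2)
    positivity
  filter_upwards [hsq.eventually hC.bound,
    (tendsto_pow_atTop_atTop_of_one_lt ha).eventually_ge_atTop (2 * K)] with k hk hkK
  have ha0 : 0 < a := one_pos.trans ha
  rw [Real.norm_of_nonneg (hα _), Real.norm_of_nonneg (by positivity)] at hk
  have h1 : K ^ k * (a ^ k ^ 2)⁻¹ ≤ (1 / 2) ^ k := by
    rw [sq, pow_mul, ← inv_pow, ← mul_pow]
    refine pow_le_pow_left₀ (by positivity) ?_ k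
    rw [← div_eq_mul_inv, div_le_iff₀ (by positivity)]
    linarith
  calc ((k : ℝ) + 1) ^ p * K ^ k * α (k ^ 2)
      ≤ ((k : ℝ) + 1) ^ p * K ^ k * (C * (a ^ k ^ 2)⁻¹) := by gcongr
    _ = C * (((k : ℝ) + 1) ^ p * (K ^ k * (a ^ k ^ 2)⁻¹)) := by ring
    _ ≤ _ := by gcongr

lemma exists_pow_eq_half_and_sum_le (hd : 0 < d) : ∃ ρ A : ℝ, 0 ≤ ρ ∧ ρ ≤ 1 ∧ ρ ^ d = 1 / 2 ∧
    ∀ N, ∑ j ∈ Finset.range N, ((j : ℝ) + 2) ^ 8 * ρ ^ j ≤ A := by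
  set ρ : ℝ := (1 / 2) ^ ((d : ℝ)⁻¹) with hρ
  have hρ0 : 0 < ρ := by positivity
  have hρ1 : ρ < 1 := Real.rpow_lt_one (by norm_num) (by norm_num) (by positivity)
  have hs : Summable fun j : ℕ => ((j : ℝ) + 2) ^ 8 * ρ ^ j := by
    have h := (summable_nat_add_iff 2).2 (summable_pow_mul_geometric_of_norm_lt_one 8
      (r := ρ) (by rwa [Real.norm_of_nonneg hρ0.le]))
    refine (h.mul_right (ρ ^ 2)⁻¹).congr fun j => ?_
    push_cast
    field_simp
    rw [pow_add, mul_comm]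
  exact ⟨ρ, _, hρ0.le, hρ1.le, Real.rpow_inv_natCast_pow (by norm_num) hd.ne', fun N =>
    hs.sum_le_tsum _ fun j _ => by positivity⟩

namespace IsMixingNoise

variable {P : Measure Ω} [IsProbabilityMeasure P] {𝒢 : Filtration ℕ ‹MeasurableSpace Ω›}
  {U : ℕ → Ω → ℝ} {X : ℕ → Ω → Fin d → ℝ} {μ : Measure (Fin d → ℝ)} {α : ℕ → ℝ}

/-- Partial sums of the noise over orthants intersected with vanishing sets `D n` are
uniformly of smaller order than `√n`. -/
theorem tendsto_measure_exists_lt_abs_sum [IsFiniteMeasure μ] (H : IsMixingNoise P 𝒢 U X μ α)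
    (hμ : ∀ i, NullSingletonClass (μ.map fun x => x i)) (hd : 0 < d)
    {D : ℕ → Set (Fin d → ℝ)} (hD : ∀ n, MeasurableSet (D n))
    (hD0 : Tendsto (fun n => μ.real (D n)) atTop (𝓝 0)) {a : ℝ} (ha : 1 < a)
    (hO : α =O[atTop] fun t : ℕ => (a ^ t)⁻¹) {ε : ℝ} (hε : 0 < ε) :
    Tendsto (fun n : ℕ => P {ω | ∃ k ≤ n, ∃ z : Fin d → ℝ,
      ε * √n < |∑ l ∈ Finset.range k,
        U l ω * (D n).indicator 1 (X l ω) * (Iic z).indicator 1 (X l ω)|}) atTop (𝓝 0) := by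
  obtain ⟨ρ, A, hρ0, hρ1, hρ, hA⟩ := exists_pow_eq_half_and_sum_le hd
  set ℓ : ℕ → ℕ := Nat.log 2 with hℓ
  have hαnn := H.nonneg
  have hd' : (0 : ℝ) < d := by exact_mod_cast hd
  have hlow : ∀ n : ℕ, 0 < n → (2 : ℝ) ^ ℓ n ≤ n := fun n hn => by
    exact_mod_cast Nat.pow_log_le_self 2 hn.ne'
  have hup : ∀ n : ℕ, (n : ℝ) ≤ 2 * 2 ^ ℓ n := fun n => by
    have := Nat.lt_pow_succ_log_self one_lt_two n
    rw [pow_succ'] at this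
    exact_mod_cast this.le
  have hexp := fun (p : ℕ) (K : ℝ) (hK : 0 ≤ K) =>
    (tendsto_succ_pow_mul_pow_mul_comp_sq hαnn ha hO p hK).comp tendsto_natLog_atTop
  have hpoly := fun p : ℕ => (tendsto_succ_pow_mul_inv_two_pow p).comp tendsto_natLog_atTop
  have hL : ∀ n : ℕ, (((3 * (ℓ n + 1) : ℕ) : ℝ) + 2) ^ (9 * d) ≤
      5 ^ (9 * d) * ((ℓ n : ℝ) + 1) ^ (9 * d) := fun n => by
    rw [← mul_pow]
    refine pow_le_pow_left₀ (by positivity) ?_ _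
    push_cast
    linarith [(Nat.cast_nonneg (ℓ n) : (0 : ℝ) ≤ ℓ n)]
  have hsmall : ∀ᶠ n : ℕ in atTop, d * ((ℓ n ^ 2 : ℕ) : ℝ) * √(√n) ≤ ε * √n / 2 := by
    have h8 := (hpoly 8).eventually_le_const (show (0 : ℝ) < (ε / (2 * d)) ^ 4 by positivity)
    filter_upwards [h8, eventually_gt_atTop 0] with n hn hn0
    simp only [Function.comp] at hn
    set y := √(√n) with hy
    have hy2 : y ^ 2 = √n := Real.sq_sqrt (Real.sqrt_nonneg _)
    have hy4 : y ^ 4 = n := by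
      rw [show 4 = 2 * 2 from rfl, pow_mul, hy2, Real.sq_sqrt (Nat.cast_nonneg n)]
    have hy0 : 0 ≤ y := Real.sqrt_nonneg _
    have hle : ((ℓ n : ℝ) ^ 2) ^ 4 ≤ (ε / (2 * d) * y) ^ 4 := by
      calc ((ℓ n : ℝ) ^ 2) ^ 4 ≤ ((ℓ n : ℝ) + 1) ^ 8 := by
            rw [← pow_mul]
            gcongr
            linarith
        _ = ((ℓ n : ℝ) + 1) ^ 8 * (1 / 2) ^ ℓ n * 2 ^ ℓ n := by
            rw [mul_assoc, ← mul_pow]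
            norm_num
        _ ≤ (ε / (2 * d)) ^ 4 * n := by
            gcongr
            exact hlow n hn0
        _ = _ := by rw [mul_pow, hy4]
    have h2 := (pow_le_pow_iff_left₀ (by positivity) (by positivity) (by norm_num)).1 hle
    rw [← hy2]
    push_cast
    calc d * (ℓ n : ℝ) ^ 2 * y ≤ d * (ε / (2 * d) * y) * y := by gcongr
      _ = _ := by field_simp
  have hbound : ∀ᶠ n : ℕ in atTop, P {ω | ∃ k ≤ n, ∃ z : Fin d → ℝ,
      ε * √n < |∑ l ∈ Finset.range k,
        U l ω * (D n).indicator 1 (X l ω) * (Iic z).indicator 1 (X l ω)|} ≤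
      ENNReal.ofReal (1392 / ε ^ 4 * (μ.real univ * A ^ d * μ.real (D n) +
        4 * 16 ^ d * 5 ^ (9 * d) *
          (((ℓ n : ℝ) + 1) ^ (9 * d) * (4 * 8 ^ d) ^ ℓ n * α (ℓ n ^ 2)) +
        4 * μ.real univ * 5 ^ (9 * d) * (((ℓ n : ℝ) + 1) ^ (9 * d + 2) * (1 / 2) ^ ℓ n))) +
      ENNReal.ofReal (μ.real univ * (√n)⁻¹) +
      ENNReal.ofReal (d * (μ.real univ * (((ℓ n : ℝ) + 1) ^ 0 * (1 / 2) ^ ℓ n) +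
        64 * (((ℓ n : ℝ) + 1) ^ 0 * 32 ^ ℓ n * α (ℓ n ^ 2)))) := by
    filter_upwards [hsmall, eventually_gt_atTop 0] with n hn hn0
    have hn0' : (0 : ℝ) < n := by exact_mod_cast hn0
    have hs : √(n : ℝ) ^ 2 = n := Real.sq_sqrt hn0'.le
    have hs0 : 0 < √(n : ℝ) := Real.sqrt_pos.2 hn0'
    have hα := hαnn (ℓ n ^ 2)
    have h := H.measure_exists_lt_abs_sum_le hμ hd (hD n) hρ0 hρ1 hρ hA hn0 (ℓ n ^ 2)
      (3 * (ℓ n + 1)) (τ := ε * √n / 2) (y := √(√n)) (by positivity) (by positivity) hn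
    rw [mul_div_cancel₀ _ (two_ne_zero' ℝ)] at h
    have hsq : (n : ℝ) ^ 2 ≤ 4 * 4 ^ ℓ n := by
      calc (n : ℝ) ^ 2 ≤ (2 * 2 ^ ℓ n) ^ 2 := by
            have := hup n
            gcongr
        _ = _ := by
            rw [mul_pow, ← pow_mul, mul_comm (ℓ n), pow_mul]
            norm_num
    refine h.trans (add_le_add (add_le_add (ENNReal.ofReal_le_ofReal ?_)
      (ENNReal.ofReal_le_ofReal (le_of_eq ?_))) (ENNReal.ofReal_le_ofReal ?_))
    · have hL' := hL n
      have hτ : (87 : ℝ) / (ε * √n / 2) ^ 4 = 1392 / ε ^ 4 / n ^ 2 := by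
        rw [div_pow, mul_pow, show √(n : ℝ) ^ 4 = (√(n : ℝ) ^ 2) ^ 2 by ring, hs]
        field_simp
        norm_num
      rw [hτ, div_mul_eq_mul_div, mul_div_assoc]
      refine mul_le_mul_of_nonneg_left ?_ (by positivity)
      have hpow : ((2 : ℝ) ^ (3 * (ℓ n + 1) + 1)) ^ d = 16 ^ d * (8 ^ d) ^ ℓ n := by
        rw [pow_right_comm 8 d, ← mul_pow, show 3 * (ℓ n + 1) + 1 = 4 + 3 * ℓ n by ring, pow_add,
          pow_mul]
        norm_num
      have hr : (2 + 4 * ((ℓ n ^ 2 : ℕ) : ℝ)) / n ≤ 4 * ((ℓ n : ℝ) + 1) ^ 2 * (1 / 2) ^ ℓ n := by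
        calc (2 + 4 * ((ℓ n ^ 2 : ℕ) : ℝ)) / n ≤ 4 * ((ℓ n : ℝ) + 1) ^ 2 / 2 ^ ℓ n := by
              refine div_le_div₀ (by positivity) ?_ (by positivity) (hlow n hn0)
              push_cast
              nlinarith [(Nat.cast_nonneg (ℓ n) : (0 : ℝ) ≤ ℓ n)]
          _ = _ := by rw [div_eq_mul_inv, one_div, inv_pow]
      have hμ0 : 0 ≤ μ.real univ := measureReal_nonneg
      set Λ : ℝ := ((3 * (ℓ n + 1) : ℕ) : ℝ) + 2
      have hΛ : 0 ≤ Λ := by positivity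
      calc _ = μ.real univ * A ^ d * μ.real (D n) +
            n ^ 2 * α (ℓ n ^ 2) * (2 ^ (3 * (ℓ n + 1) + 1)) ^ d * Λ ^ (9 * d) +
            (2 + 4 * ((ℓ n ^ 2 : ℕ) : ℝ)) / n * μ.real univ * Λ ^ (9 * d) := by
            field_simp
            ring
        _ ≤ μ.real univ * A ^ d * μ.real (D n) +
            4 * 4 ^ ℓ n * α (ℓ n ^ 2) * (16 ^ d * (8 ^ d) ^ ℓ n) *
              (5 ^ (9 * d) * ((ℓ n : ℝ) + 1) ^ (9 * d)) +
            4 * ((ℓ n : ℝ) + 1) ^ 2 * (1 / 2) ^ ℓ n * μ.real univ *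
              (5 ^ (9 * d) * ((ℓ n : ℝ) + 1) ^ (9 * d)) := by
            rw [hpow]
            gcongr
        _ = _ := by
            rw [mul_pow, pow_add]
            ring
    · rw [show √(√(n : ℝ)) ^ 6 = (√(√(n : ℝ)) ^ 2) ^ 3 by ring, Real.sq_sqrt hs0.le]
      rw [show √(n : ℝ) ^ 3 = √(n : ℝ) ^ 2 * √n by ring, hs]
      field_simp
    · have hpow : (2 : ℝ) ^ (3 * (ℓ n + 1)) = 8 * 8 ^ ℓ n := by
        rw [mul_add, pow_add, pow_mul]
        norm_num
        ring
      have h8 : (1 : ℝ) ≤ 8 * 8 ^ ℓ n := by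
        linarith [one_le_pow₀ (show (1 : ℝ) ≤ 8 by norm_num) (n := ℓ n)]
      have hq : (4 * 4 ^ ℓ n : ℝ) / (8 * 8 ^ ℓ n) ≤ (1 / 2) ^ ℓ n := by
        rw [show (1 / 2 : ℝ) = 4 / 8 by norm_num, div_pow, mul_div_mul_comm]
        exact mul_le_of_le_one_left (by positivity) (by norm_num)
      rw [hpow, mul_assoc]
      refine mul_le_mul_of_nonneg_left ?_ hd'.le
      calc (n : ℝ) ^ 2 * (μ.real univ / (8 * 8 ^ ℓ n) + (8 * 8 ^ ℓ n + 1) * α (ℓ n ^ 2))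
          ≤ 4 * 4 ^ ℓ n *
            (μ.real univ / (8 * 8 ^ ℓ n) + (8 * 8 ^ ℓ n + 8 * 8 ^ ℓ n) * α (ℓ n ^ 2)) := by
            gcongr
        _ = μ.real univ * (4 * 4 ^ ℓ n / (8 * 8 ^ ℓ n)) +
            64 * ((4 * 8) ^ ℓ n * α (ℓ n ^ 2)) := by
            rw [mul_pow]
            ring
        _ ≤ μ.real univ * (1 / 2) ^ ℓ n + 64 * ((4 * 8) ^ ℓ n * α (ℓ n ^ 2)) := by gcongr
        _ = _ := by norm_num
  have h1 := (((hD0.const_mul (μ.real univ * A ^ d)).add ((hexp (9 * d) (4 * 8 ^ d)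
    (by positivity)).const_mul (4 * 16 ^ d * 5 ^ (9 * d)))).add ((hpoly (9 * d + 2)).const_mul
      (4 * μ.real univ * 5 ^ (9 * d)))).const_mul (1392 / ε ^ 4)
  have h2 := ((tendsto_inv_atTop_zero.comp (Real.tendsto_sqrt_atTop.comp
    (tendsto_natCast_atTop_atTop (R := ℝ)))).const_mul (μ.real univ))
  have h3 := (((hpoly 0).const_mul (μ.real univ)).add ((hexp 0 32 (by norm_num)).const_mul
    64)).const_mul (d : ℝ)
  simp only [mul_zero, add_zero] at h1 h2 h3
  have htot := ((ENNReal.tendsto_ofReal h1).add (ENNReal.tendsto_ofReal h2)).add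
    (ENNReal.tendsto_ofReal h3)
  simp only [ENNReal.ofReal_zero, add_zero] at htot
  exact tendsto_of_tendsto_of_tendsto_of_le_of_le' tendsto_const_nhds htot
    (Eventually.of_forall fun _ => zero_le) hbound

end IsMixingNoise

section Model

variable {P : Measure Ω} {Y : ℤ → Ω → ℝ} {X : ℤ → Ω → Fin d → ℝ}
  {m : (Fin d → ℝ) → ℝ}

lemma measurable_sigPast {Ω : Type*} {Y : ℤ → Ω → ℝ} {X : ℤ → Ω → Fin d → ℝ} {s k : ℤ}
    (h : s ≤ k) :
    Measurable[sigPast Y X k] fun ω => (Y s ω, X s ω) := by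
  have hle : MeasurableSpace.comap (Y s) inferInstance ⊔ MeasurableSpace.comap (X s) inferInstance
      ≤ sigPast Y X k :=
    le_iSup₂ (f := fun (s : ℤ) (_ : s ≤ k) => MeasurableSpace.comap (Y s) inferInstance ⊔
      MeasurableSpace.comap (X s) inferInstance) s h
  exact Measurable.prodMk ((comap_measurable _).mono (le_sup_left.trans hle) le_rfl)
    ((comap_measurable _).mono (le_sup_right.trans hle) le_rfl)

lemma measurable_sigFuture {Ω : Type*} {Y : ℤ → Ω → ℝ} {X : ℤ → Ω → Fin d → ℝ} {s k : ℤ}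
    (h : k ≤ s) :
    Measurable[sigFuture Y X k] fun ω => (Y s ω, X s ω) := by
  have hle : MeasurableSpace.comap (Y s) inferInstance ⊔ MeasurableSpace.comap (X s) inferInstance
      ≤ sigFuture Y X k :=
    le_iSup₂ (f := fun (s : ℤ) (_ : k ≤ s) => MeasurableSpace.comap (Y s) inferInstance ⊔
      MeasurableSpace.comap (X s) inferInstance) s h
  exact Measurable.prodMk ((comap_measurable _).mono (le_sup_left.trans hle) le_rfl)
    ((comap_measurable _).mono (le_sup_right.trans hle) le_rfl)

lemma alphaMix_nonneg (t : ℕ) : 0 ≤ alphaMix P Y X t := by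
  refine Real.sSup_nonneg ?_
  rintro _ ⟨k, A, B, -, -, rfl⟩
  exact abs_nonneg _

lemma measure_inter_le_alphaMix [IsProbabilityMeasure P] {t : ℕ} {k : ℤ} {A B : Set Ω}
    (hA : MeasurableSet[sigPast Y X k] A) (hB : MeasurableSet[sigFuture Y X (k + t)] B) :
    P (A ∩ B) ≤ P A * P B + ENNReal.ofReal (alphaMix P Y X t) := by
  have hbdd : BddAbove {r : ℝ | ∃ (k : ℤ) (A B : Set Ω),
      MeasurableSet[sigPast Y X k] A ∧ MeasurableSet[sigFuture Y X (k + t)] B ∧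
      r = |(P (A ∩ B)).toReal - (P A).toReal * (P B).toReal|} := by
    refine ⟨1, ?_⟩
    rintro _ ⟨k, A, B, -, -, rfl⟩
    have h1 : P.real (A ∩ B) ≤ 1 := measureReal_le_one
    have h2 : P.real A * P.real B ≤ 1 :=
      mul_le_one₀ measureReal_le_one measureReal_nonneg measureReal_le_one
    have h3 : 0 ≤ P.real (A ∩ B) := measureReal_nonneg
    have h4 : 0 ≤ P.real A * P.real B := mul_nonneg measureReal_nonneg measureReal_nonneg
    exact abs_sub_le_iff.2 ⟨by simp only [measureReal_def] at *; linarith,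
      by simp only [measureReal_def] at *; linarith⟩
  have h := (le_abs_self _).trans (le_csSup hbdd ⟨k, A, B, hA, hB, rfl⟩)
  rw [← ENNReal.ofReal_toReal (measure_ne_top P (A ∩ B)),
    ← ENNReal.ofReal_toReal (measure_ne_top P A), ← ENNReal.ofReal_toReal (measure_ne_top P B),
    ← ENNReal.ofReal_mul ENNReal.toReal_nonneg,
    ← ENNReal.ofReal_add (by positivity) (alphaMix_nonneg t)]
  exact ENNReal.ofReal_le_ofReal (sub_le_iff_le_add'.1 h)

lemma measurable_residual_sigF {Ω : Type*} {Y : ℤ → Ω → ℝ} {X : ℤ → Ω → Fin d → ℝ} {s t : ℤ}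
    (h : s + 1 ≤ t) :
    Measurable[sigF Y X m t] fun ω => Y s ω - m (X s ω) := by
  have hle := le_iSup₂ (f := fun (j : ℤ) (_ : j ≤ t) =>
    MeasurableSpace.comap (fun ω => Y (j - 1) ω - m (X (j - 1) ω)) inferInstance ⊔
      MeasurableSpace.comap (X j) inferInstance) (s + 1) h
  simp only [add_sub_cancel_right] at hle
  exact (comap_measurable _).mono (le_sup_left.trans hle) le_rfl

lemma measurable_covariate_sigF {Ω : Type*} {Y : ℤ → Ω → ℝ} {X : ℤ → Ω → Fin d → ℝ} {s t : ℤ}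
    (h : s ≤ t) : Measurable[sigF Y X m t] (X s) := by
  have hle := le_iSup₂ (f := fun (j : ℤ) (_ : j ≤ t) =>
    MeasurableSpace.comap (fun ω => Y (j - 1) ω - m (X (j - 1) ω)) inferInstance ⊔
      MeasurableSpace.comap (X j) inferInstance) s h
  exact (comap_measurable _).mono (le_sup_right.trans hle) le_rfl

/-- The filtration `k ↦ F^{k+1}`. -/
def residualFiltration (hY : ∀ t, Measurable (Y t)) (hX : ∀ t, Measurable (X t))
    (hm : Measurable m) : Filtration ℕ ‹MeasurableSpace Ω› where
  seq k := sigF Y X m (k + 1)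
  mono' := fun _ _ hkl => biSup_mono fun _ hj => hj.trans (by gcongr)
  le' := fun _ => iSup₂_le fun j _ => sup_le
    (((hY (j - 1)).sub (hm.comp (hX (j - 1)))).comap_le) (hX j).comap_le

lemma identDistrib_of_stationary (hY : ∀ t, Measurable (Y t)) (hX : ∀ t, Measurable (X t))
    (hstat : ∀ (k : ℤ) (I : Finset ℤ),
      Measure.map (fun ω (i : I) => (Y (i : ℤ) ω, X (i : ℤ) ω)) P =
        Measure.map (fun ω (i : I) => (Y ((i : ℤ) + k) ω, X ((i : ℤ) + k) ω)) P) (t : ℤ) :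
    IdentDistrib (fun ω => (Y t ω, X t ω)) (fun ω => (Y 1 ω, X 1 ω)) P P := by
  have hpair : ∀ s, Measurable fun ω => (Y s ω, X s ω) := fun s => (hY s).prodMk (hX s)
  refine ⟨(hpair t).aemeasurable, (hpair 1).aemeasurable, ?_⟩
  let e : ({1} : Finset ℤ) := ⟨1, Finset.mem_singleton_self 1⟩
  have h := congrArg (Measure.map fun φ : ({1} : Finset ℤ) → ℝ × (Fin d → ℝ) => φ e)
    (hstat (t - 1) {1})
  rw [Measure.map_map (measurable_pi_apply e) (measurable_pi_lambda _ fun i => hpair _),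
    Measure.map_map (measurable_pi_apply e) (measurable_pi_lambda _ fun i => hpair _)] at h
  simpa [Function.comp_def, e] using h.symm

lemma integrable_pow_six_of_rpow [IsProbabilityMeasure P] {g : Ω → ℝ} (hg : Measurable g)
    {q : ℝ} (hq : 6 ≤ q) (h : Integrable (fun ω => |g ω| ^ q) P) :
    Integrable (fun ω => g ω ^ 6) P := by
  refine ((integrable_const (1 : ℝ)).add h).mono' (hg.pow_const 6).aestronglyMeasurable
    (ae_of_all _ fun ω => ?_)
  rw [norm_pow, Real.norm_eq_abs, Pi.add_apply]
  have h0 : 0 ≤ |g ω| ^ q := by positivity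
  rcases le_total |g ω| 1 with h1 | h1
  · linarith [pow_le_one₀ (abs_nonneg (g ω)) h1 (n := 6)]
  · have := Real.rpow_le_rpow_of_exponent_le h1 hq
    rw [Real.rpow_ofNat] at this
    linarith

/-- The law of `Z` under the measure with density `1 + g ^ 6`. -/
def momentMeasure (P : Measure Ω) (g : Ω → ℝ) (Z : Ω → Fin d → ℝ) : Measure (Fin d → ℝ) :=
  (P.withDensity fun ω => ENNReal.ofReal (1 + g ω ^ 6)).map Z

variable {g : Ω → ℝ} {Z : Ω → Fin d → ℝ}

lemma isFiniteMeasure_momentMeasure [IsProbabilityMeasure P]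
    (hg6 : Integrable (fun ω => g ω ^ 6) P) :
    IsFiniteMeasure (momentMeasure P g Z) := by
  have := isFiniteMeasure_withDensity_ofReal ((integrable_const (1 : ℝ)).add hg6).2
  exact Measure.isFiniteMeasure_map (P.withDensity fun ω => ENNReal.ofReal (1 + g ω ^ 6)) Z

lemma momentMeasure_real [IsProbabilityMeasure P] (hZ : Measurable Z)
    (hg6 : Integrable (fun ω => g ω ^ 6) P) {B : Set (Fin d → ℝ)} (hB : MeasurableSet B) :
    (momentMeasure P g Z).real B = ∫ ω in Z ⁻¹' B, (1 + g ω ^ 6) ∂P := by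
  have h0 : ∀ ω, 0 ≤ 1 + g ω ^ 6 := fun ω => by
    have := (show Even 6 by decide).pow_nonneg (g ω)
    positivity
  rw [momentMeasure, map_measureReal_apply hZ hB, measureReal_def,
    withDensity_apply _ (hZ hB), integral_eq_lintegral_of_nonneg_ae (ae_of_all _ h0)
      ((integrable_const (1 : ℝ)).add hg6).aestronglyMeasurable.restrict]

lemma setIntegral_pow_le_momentMeasure [IsProbabilityMeasure P] (hZ : Measurable Z)
    (hg6 : Integrable (fun ω => g ω ^ 6) P) {k : ℕ} (hk : k ≤ 3) {B : Set (Fin d → ℝ)}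
    (hB : MeasurableSet B) :
    ∫ ω in Z ⁻¹' B, g ω ^ (2 * k) ∂P ≤ (momentMeasure P g Z).real B := by
  rw [momentMeasure_real hZ hg6 hB]
  have hint := (integrable_const (μ := P) (1 : ℝ)).add hg6
  have hle : ∀ ω, g ω ^ (2 * k) ≤ 1 + g ω ^ 6 := fun ω => by
    have h2 : 0 ≤ g ω ^ 2 := sq_nonneg _
    have h6 : g ω ^ 6 = (g ω ^ 2) ^ 3 := by ring
    rw [pow_mul, h6]
    rcases le_total (g ω ^ 2) 1 with h1 | h1
    · linarith [pow_le_one₀ h2 h1 (n := k), pow_nonneg h2 3]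
    · linarith [pow_le_pow_right₀ h1 hk]
  refine integral_mono_of_nonneg (ae_of_all _ fun ω => ?_) hint.restrict (ae_of_all _ hle)
  exact (even_two_mul k).pow_nonneg _

lemma nullSingletonClass_map_momentMeasure (hZ : Measurable Z)
    (hac : P.map Z ≪ (volume : Measure (Fin d → ℝ))) (i : Fin d) :
    NullSingletonClass ((momentMeasure P g Z).map fun x => x i) := by
  refine ⟨fun t => ?_⟩
  have hs : MeasurableSet {x : Fin d → ℝ | x i = t} :=
    measurableSet_eq_fun (measurable_pi_apply i) measurable_const
  rw [Measure.map_apply (measurable_pi_apply i) (measurableSet_singleton t)]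
  change momentMeasure P g Z {x : Fin d → ℝ | x i = t} = 0
  rw [momentMeasure, Measure.map_apply hZ hs]
  refine withDensity_absolutelyContinuous _ _ ?_
  rw [← Measure.map_apply hZ hs]
  refine hac ?_
  rw [volume_pi]
  exact Measure.pi_hyperplane (α := fun _ => ℝ) (fun _ => volume) i t

lemma sum_Icc_one_eq_sum_range (N : ℤ) (F : ℤ → ℝ) :
    ∑ i ∈ Finset.Icc 1 N, F i = ∑ l ∈ Finset.range N.toNat, F (l + 1) := by
  refine Finset.sum_nbij' (fun i => (i - 1).toNat) (fun l => (l : ℤ) + 1) ?_ ?_ ?_ ?_ ?_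
  · intro i hi
    simp only [Finset.mem_Icc, Finset.mem_range] at *
    omega
  · intro l hl
    simp only [Finset.mem_Icc, Finset.mem_range] at *
    omega
  · intro i hi
    simp only [Finset.mem_Icc] at *
    omega
  · intro l hl
    simp
  · intro i hi
    simp only [Finset.mem_Icc] at hi
    congr 1
    omega

theorem isMixingNoise_of_stationary [IsProbabilityMeasure P]
    (hY : ∀ t, Measurable (Y t)) (hX : ∀ t, Measurable (X t)) (hm : Measurable m)
    (hstat : ∀ (k : ℤ) (I : Finset ℤ),
      Measure.map (fun ω (i : I) => (Y (i : ℤ) ω, X (i : ℤ) ω)) P =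
        Measure.map (fun ω (i : I) => (Y ((i : ℤ) + k) ω, X ((i : ℤ) + k) ω)) P)
    (hmart : ∀ t : ℤ, P[fun ω => Y t ω - m (X t ω)|sigF Y X m t] =ᵐ[P] 0)
    (h6 : ∀ t : ℤ, Integrable (fun ω => (Y t ω - m (X t ω)) ^ 6) P) :
    IsMixingNoise P (residualFiltration hY hX hm)
      (fun l ω => Y (l + 1) ω - m (X (l + 1) ω)) (fun l => X (l + 1))
      (momentMeasure P (fun ω => Y 1 ω - m (X 1 ω)) (X 1)) (alphaMix P Y X) where
  measurable_noise l := (hY _).sub (hm.comp (hX _))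
  measurable_covariate l := hX _
  adapted l := measurable_residual_sigF (by push_cast; exact le_rfl)
  predictable l := measurable_covariate_sigF le_rfl
  condExp_eq_zero l := hmart _
  integrable_pow_six l := h6 _
  setIntegral_le l k hk B hB := by
    refine le_trans (le_of_eq ?_) (setIntegral_pow_le_momentMeasure
      (hX 1) (h6 1) hk hB)
    have hφ : Measurable fun p : ℝ × (Fin d → ℝ) =>
        (Prod.snd ⁻¹' B).indicator (fun p => (p.1 - m p.2) ^ (2 * k)) p :=
      ((measurable_fst.sub (hm.comp measurable_snd)).pow_const _).indicator (measurable_snd hB)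
    have h := ((identDistrib_of_stationary hY hX hstat (l + 1)).comp hφ).integral_eq
    rw [← integral_indicator (hX _ hB), ← integral_indicator (hX _ hB)]
    exact h
  nonneg := alphaMix_nonneg
  mixing r i j hij A B hA hB := by
    have hφ : Measurable fun p : ℝ × (Fin d → ℝ) => (p.1 - m p.2, p.2) :=
      (measurable_fst.sub (hm.comp measurable_snd)).prodMk measurable_snd
    exact measure_inter_le_alphaMix
      (measurable_sigPast (Y := Y) (X := X) (k := (i : ℤ) + 1) le_rfl (hφ hA))
      (measurable_sigFuture (Y := Y) (X := X) (k := (i : ℤ) + 1 + r) (s := (j : ℤ) + 1)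
        (by omega) (hφ hB))

lemma tendsto_measureReal_compl_Icc (μ : Measure (Fin d → ℝ)) [IsFiniteMeasure μ] {c : ℕ → ℝ}
    (hc : Tendsto c atTop atTop) :
    Tendsto (fun n => μ.real (Icc (fun _ : Fin d => -c n) fun _ => c n)ᶜ) atTop (𝓝 0) := by
  have h := tendsto_measure_of_tendsto_indicator_of_isFiniteMeasure atTop (μ := μ) (A := ∅)
    (As := fun n => (Icc (fun _ : Fin d => -c n) fun _ => c n)ᶜ)
    (fun n => measurableSet_Icc.compl) fun x => by
      filter_upwards [hc.eventually_ge_atTop ‖x‖] with n hn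
      simp only [mem_empty_iff_false, iff_false, not_not, mem_compl_iff]
      have hx : ∀ i, |x i| ≤ c n := fun i => (norm_le_pi_norm x i).trans hn
      exact ⟨fun i => (abs_le.1 (hx i)).1, fun i => (abs_le.1 (hx i)).2⟩
  rw [measure_empty] at h
  exact (ENNReal.tendsto_toReal ENNReal.zero_ne_top).comp h

end Model

lemma mul_cube_mul_orth_sub (u c : ℝ) (z x : Fin d → ℝ) :
    u * cube c x * orth z x - u * orth z x =
      -(u * (Icc (fun _ : Fin d => -c) fun _ => c)ᶜ.indicator 1 x * (Iic z).indicator 1 x) := by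
  change u * cube c x * (Iic z).indicator 1 x - u * (Iic z).indicator 1 x = _
  rw [indicator_compl, cube, Pi.sub_apply, Pi.one_apply, Pi.one_def]
  ring

/-- **Lemma A.4 (Lemma 1).** Under the assumptions of Theorem 3.1(i) and under H0,
`A_{n2}(s,z) = n^{-1/2} Σ_{i=1}^{⌊ns⌋} U_i ω_n(X_i) 1{X_i ≤ z}` satisfies
`A_{n2}(s,z) = T_n(s,z) + o_P(1)` uniformly in `s ∈ [0,1]` and `z ∈ ℝ^d`. -/
theorem statement4
    {Ω : Type*} [MeasurableSpace Ω] {d : ℕ} (hd : 0 < d)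
    (P : Measure Ω) [IsProbabilityMeasure P]
    (Y : ℤ → Ω → ℝ) (X : ℤ → Ω → Fin d → ℝ)
    (hY : ∀ t, Measurable (Y t)) (hX : ∀ t, Measurable (X t))
    -- H0: the conditional mean function is time-invariant, `Y_t = m(X_t) + U_t`
    -- with `U_t := Y_t - m(X_t)`; that `m` is the conditional mean is part of (U).
    (m : (Fin d → ℝ) → ℝ) (hm : Measurable m)
    -- (G) strict stationarity:
    (hstat : ∀ (k : ℤ) (I : Finset ℤ),
      Measure.map (fun ω (i : I) => (Y (i : ℤ) ω, X (i : ℤ) ω)) P =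
        Measure.map (fun ω (i : I) => (Y ((i : ℤ) + k) ω, X ((i : ℤ) + k) ω)) P)
    -- (G) geometric α-mixing, `α(t) = O(a^{-t})` for some `a > 1`:
    (a : ℝ) (ha : 1 < a)
    (hmix : (fun t : ℕ => alphaMix P Y X t) =O[atTop] fun t : ℕ => (a ^ t)⁻¹)
    -- (U):
    (γ : ℝ) (hγ : 0 < γ) (Q : ℕ) (hQeven : Even Q) (hQ : ((d : ℝ) + 1) * (2 + γ) < Q)
    (σ2 c : (Fin d → ℝ) → ℝ) (hσ2 : Measurable σ2) (hc : Measurable c)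
    (hmart : ∀ t : ℤ, P[fun ω => Y t ω - m (X t ω)|sigF Y X m t] =ᵐ[P] 0)
    (hUsq : ∀ t : ℤ, Integrable (fun ω => (Y t ω - m (X t ω)) ^ 2) P)
    (hcondvar : ∀ t : ℤ,
      P[fun ω => (Y t ω - m (X t ω)) ^ 2|MeasurableSpace.comap (X t) inferInstance]
        =ᵐ[P] fun ω => σ2 (X t ω))
    (hUQ : ∀ t : ℤ,
      Integrable (fun ω => |Y t ω - m (X t ω)| ^ ((Q : ℝ) * (2 + γ) / 2)) P)
    (hcondmom : ∀ t : ℤ,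
      P[fun ω => |Y t ω - m (X t ω)| ^ ((Q : ℝ) * (2 + γ) / 2)|
          MeasurableSpace.comap (X t) inferInstance] ≤ᵐ[P] fun ω => c (X t ω) ^ Q)
    (f : (Fin d → ℝ) → ℝ) (hf : Measurable f) (hf0 : ∀ x, 0 ≤ f x)
    (M : ℝ) (hM : (∫ u, cbar σ2 c Q u * f u) ≤ M)
    -- (M):
    (hXlaw : Measure.map (X 1) P =
      (volume : Measure (Fin d → ℝ)).withDensity fun x => ENNReal.ofReal (f x))
    (b : ℝ) (hb : 2 < b) (hYmom : Integrable (fun ω => |Y 1 ω| ^ b) P)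
    (g1 : (Fin d → ℝ) → ℝ)
    (hg1 : P[fun ω => |Y 1 ω| ^ b|MeasurableSpace.comap (X 0) inferInstance] =ᵐ[P]
      fun ω => g1 (X 0 ω))
    (B1 : ℝ) (hB1 : ∀ x, g1 x * f x ≤ B1)
    (Bf : ℝ) (hBf : ∀ x, f x ≤ Bf)
    (jstar : ℤ)
    (hpair : ∀ j : ℤ, jstar ≤ j →
      ∃ (f1j gj : (Fin d → ℝ) → (Fin d → ℝ) → ℝ) (Bj : ℝ),
        Measure.map (fun ω => (X 1 ω, X j ω)) P =
          (volume : Measure ((Fin d → ℝ) × (Fin d → ℝ))).withDensity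
            (fun pr => ENNReal.ofReal (f1j pr.1 pr.2)) ∧
        (P[fun ω => abs (Y 1 ω * Y j ω)|
            MeasurableSpace.comap (fun ω => (X 1 ω, X j ω)) inferInstance] =ᵐ[P]
          fun ω => gj (X 1 ω) (X j ω)) ∧
        ∀ x1 xj, gj x1 xj * f1j x1 xj ≤ Bj)
    -- (J):
    (cn : ℕ → ℝ) (hcn : Tendsto cn atTop atTop)
    (hcnO : cn =O[atTop] fun n : ℕ => Real.log (n : ℝ) ^ ((1 : ℝ) / d))
    -- bandwidth:
    (h : ℕ → ℝ) (hh : ∀ n, 0 < h n)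
    -- (F1):
    (CK : ℝ) (hCK : 0 < CK) (δ p q : ℕ → ℝ) (r l : ℕ)
    (hδ : ∀ n : ℕ, 0 < (δ n)⁻¹ ∧
      (δ n)⁻¹ = sInf (f '' Icc (fun _ : Fin d => -cn n) fun _ : Fin d => cn n))
    (hp : ∀ (n : ℕ) (k : Fin d → ℕ), 1 ≤ ∑ i, k i → ∑ i, k i ≤ l + 1 + r →
      ∀ x ∈ Icc (fun _ : Fin d => -cn n - CK * h n) fun _ : Fin d => cn n + CK * h n,
        |mderiv k f x| ≤ p n)
    (hq0 : ∀ n, 0 < q n)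
    (hq : ∀ (n : ℕ) (k : Fin d → ℕ), ∑ i, k i ≤ l + 1 + r →
      ∀ x ∈ Icc (fun _ : Fin d => -cn n - CK * h n) fun _ : Fin d => cn n + CK * h n,
        |mderiv k m x| ≤ q n)
    -- (F2):
    (hF2 : ∃ C2 : ℝ, ∀ (n : ℕ) (k : Fin d → ℕ), ∑ i, k i = 2 →
      ∀ x ∈ Icc (fun _ : Fin d => -cn n - 2 * h n * CK)
          fun _ : Fin d => cn n + 2 * h n * CK,
        |mderiv k m x| ≤ C2 * q n)
    -- (K):
    (K : (Fin d → ℝ) → ℝ) (hr2 : 2 ≤ r)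
    (hKsym : ∀ (i : Fin d) (x : Fin d → ℝ), K (Function.update x i (-x i)) = K x)
    (hKsmooth : ContDiff ℝ (l + 1 : ℕ) K)
    (hKint : (∫ z : Fin d → ℝ, K z) = 1)
    (hKsupp : ∀ x : Fin d → ℝ, x ∉ Icc (fun _ : Fin d => -CK) (fun _ : Fin d => CK) →
      K x = 0)
    (hKord : ∀ k : Fin d → ℕ, 1 ≤ ∑ i, k i → ∑ i, k i ≤ r - 1 →
      (∫ z : Fin d → ℝ, K z * ∏ i, z i ^ k i) = 0)
    (Λ : ℝ)
    (hKlip : ∀ k : Fin d → ℕ, ∑ i, k i ≤ l + 1 →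
      ∀ u u' : Fin d → ℝ, |mderiv k K u - mderiv k K u'| ≤ Λ * ‖u - u'‖)
    -- (B1):
    (η : ℝ) (hη0 : 0 < η) (hη1 : η < 1)
    (hB1a : (fun n : ℕ =>
      (Real.sqrt (Real.log (n : ℝ) / ((n : ℝ) * h n ^ (d + 2 * (l + 1)))) +
          h n ^ r * p n) * p n ^ (l + 1) * δ n ^ (l + 2)) =O[atTop] fun _ : ℕ => (1 : ℝ))
    (hB1b : (fun n : ℕ =>
      (Real.sqrt (Real.log (n : ℝ) / ((n : ℝ) * h n ^ (d + 2 * (l + 1)))) +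
          h n ^ r * p n) * p n ^ ((l : ℝ) + η) * q n * δ n ^ ((l : ℝ) + 1 + η))
        =o[atTop] fun _ : ℕ => (1 : ℝ))
    -- (B2):
    (hB2a : (fun n : ℕ =>
      Real.log (n : ℝ) ^ ((3 : ℝ) + (d : ℝ) / ((l : ℝ) + η)) /
          Real.sqrt ((n : ℝ) ^ ((1 : ℝ) - (d : ℝ) / ((l : ℝ) + η)) * h n ^ d) *
        q n ^ 2 * δ n ^ 2) =o[atTop] fun _ : ℕ => (1 : ℝ))
    (hB2b : (fun n : ℕ => Real.log (h n) / Real.sqrt ((n : ℝ) * h n ^ d))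
      =o[atTop] fun _ : ℕ => (1 : ℝ))
    (hB2c : (fun n : ℕ => Real.sqrt (n : ℝ) * h n ^ r * p n * q n)
      =o[atTop] fun _ : ℕ => (1 : ℝ))
    (hB2d : (fun n : ℕ => Real.log (n : ℝ) ^ 3 * h n * q n ^ 2)
      =o[atTop] fun _ : ℕ => (1 : ℝ)) :
    ∀ ε : ℝ, 0 < ε →
      Tendsto (fun n : ℕ =>
          P {ω | ∃ s ∈ Icc (0 : ℝ) 1, ∃ z : Fin d → ℝ,
              ε < |((Real.sqrt n)⁻¹ * ∑ i ∈ Finset.Icc (1 : ℤ) ⌊(n : ℝ) * s⌋,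
                      (Y i ω - m (X i ω)) * cube (cn n) (X i ω) * orth z (X i ω)) -
                    Tn Y X m n s z ω|})
        atTop (𝓝 (0 : ℝ≥0∞)) := by
  intro ε hε
  have hQ6 : 6 ≤ Q := by
    have hd1 : (1 : ℝ) ≤ d := by exact_mod_cast hd
    have h4 : (4 : ℝ) < Q := by nlinarith
    have h4' : 4 < Q := by exact_mod_cast h4
    obtain ⟨k, rfl⟩ := hQeven
    omega
  have hq6 : (6 : ℝ) ≤ (Q : ℝ) * (2 + γ) / 2 := by
    have hQ6' : (6 : ℝ) ≤ Q := by exact_mod_cast hQ6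
    nlinarith
  have hU (t : ℤ) : Measurable fun ω => Y t ω - m (X t ω) := (hY t).sub (hm.comp (hX t))
  have h6 (t : ℤ) : Integrable (fun ω => (Y t ω - m (X t ω)) ^ 6) P :=
    integrable_pow_six_of_rpow (hU t) hq6 (hUQ t)
  have hac : P.map (X 1) ≪ (volume : Measure (Fin d → ℝ)) := by
    rw [hXlaw]
    exact withDensity_absolutelyContinuous _ _
  have := isFiniteMeasure_momentMeasure (Z := X 1) (h6 1)
  have hnoise := isMixingNoise_of_stationary hY hX hm hstat hmart h6
  have hlim := hnoise.tendsto_measure_exists_lt_abs_sum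
    (nullSingletonClass_map_momentMeasure (hX 1) hac) hd
    (fun n => measurableSet_Icc.compl) (tendsto_measureReal_compl_Icc _ hcn) ha hmix hε
  refine tendsto_of_tendsto_of_tendsto_of_le_of_le tendsto_const_nhds hlim
    (fun _ => zero_le) fun n => measure_mono ?_
  rintro ω ⟨s, hs, z, hz⟩
  refine ⟨⌊(n : ℝ) * s⌋.toNat, ?_, z, ?_⟩
  · rw [Int.toNat_le, Int.floor_le_iff]
    have : (n : ℝ) * s ≤ n := mul_le_of_le_one_right n.cast_nonneg hs.2
    push_cast
    linarith
  · rw [Tn, ← mul_sub, ← Finset.sum_sub_distrib, sum_Icc_one_eq_sum_range] at hz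
    simp only [mul_cube_mul_orth_sub] at hz
    rw [Finset.sum_neg_distrib, mul_neg, abs_neg, abs_mul,
      abs_of_nonneg (by positivity : 0 ≤ (√(n : ℝ))⁻¹)] at hz
    have hn : 0 < √(n : ℝ) := by
      by_contra! h0
      rw [le_antisymm h0 (Real.sqrt_nonneg _), inv_zero, zero_mul] at hz
      exact hz.not_gt hε
    rwa [inv_mul_eq_div, lt_div_iff₀ hn] at hz

end ChangePointDetection
end
end
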